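/- Let f ∈ Q̄[x_1,x_2,x_3] be an irreducible polynomial of degree d ≥ 3 whose leading form F has no irreducible factors of degree 1 or 2. Then the number N(f,B) of integer solutions x ∈ Z^3 with f(x)=0 and |x| ≤ B satisfies: N(f,B) ≪_{d,ε} B^{5/(3√3)+1/4+ε} if d = 3; N(f,B) ≪_{d,ε} B^{3/(2√d)+1/3+ε} if d = 4 or 5; and N(f,B) ≪_{d,ε} B^{1+ε} if d ≥ 6. -/

import Mathlib

open MvPolynomial

/-- An integer matrix with `s` columns all of whose `s × s` minors vanish has a nonzero integer
kernel vector whose size is controlled by the entries. -/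
theorem exists_small_kernel_vector {ι : Type*} {s : ℕ} (M : ι → Fin s → ℤ) (b : ℕ) (hb : 1 ≤ b)
    (hM : ∀ i j, |M i j| ≤ b)
    (hdet : ∀ rows : Fin s → ι, Matrix.det (Matrix.of fun i j => M (rows i) j) = 0) :
    ∃ w : Fin s → ℤ, w ≠ 0 ∧ (∀ j, |w j| ≤ (s.factorial * b ^ s : ℕ)) ∧
      ∀ i, ∑ j, M i j * w j = 0 := by
  classical
  let Q : ℕ → Prop := fun r => ∃ (I : Fin r → ι) (J : Fin r → Fin s),
    Matrix.det (Matrix.of fun i j => M (I i) (J j)) ≠ 0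
  have hQ0 : Q 0 := ⟨Fin.elim0, Fin.elim0, by simp⟩
  have hinj : ∀ {r : ℕ} {I : Fin r → ι} {J : Fin r → Fin s},
      Matrix.det (Matrix.of fun i j => M (I i) (J j)) ≠ 0 → Function.Injective J := by
    intro r I J h a c hac
    by_contra hne
    exact h (Matrix.det_zero_of_column_eq hne fun k => by simp [hac])
  have hQs : ∀ r, Q r → r < s := by
    rintro r ⟨I, J, h⟩
    have hi := hinj h
    have hle : r ≤ s := by simpa using Fintype.card_le_of_injective J hi
    refine lt_of_le_of_ne hle ?_
    rintro rfl
    have hbij : Function.Bijective J := Finite.injective_iff_bijective.mp hi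
    have h2 := hdet I
    have h3 := Matrix.det_permute' (Equiv.ofBijective J hbij) (Matrix.of fun i j => M (I i) j)
    apply h
    rw [h2, mul_zero] at h3
    rw [← h3]
    rfl
  let r := Nat.findGreatest Q s
  have hr : Q r := Nat.findGreatest_spec (m := 0) (Nat.zero_le s) hQ0
  have hmax : ¬ Q (r + 1) := fun h =>
    Nat.findGreatest_is_greatest (lt_add_one r) (hQs _ h).le h
  have hrs := hQs r hr
  obtain ⟨I, J, hIJ⟩ := hr
  have hJ := hinj hIJ
  obtain ⟨j₀, hj₀⟩ : ∃ j₀, j₀ ∉ Set.range J := by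
    by_contra! hall
    have : Function.Surjective J := fun x => by simpa using hall x
    have := Fintype.card_le_of_surjective J this
    simp at this
    omega
  let J' : Fin (r + 1) → Fin s := Fin.cons j₀ J
  have hJ' : Function.Injective J' := by
    rw [Fin.cons_injective_iff]
    exact ⟨hj₀, hJ⟩
  let c : Fin (r + 1) → ℤ := fun k => (-1) ^ (k : ℕ) *
    Matrix.det (Matrix.of fun i j => M (I i) (J' (k.succAbove j)))
  have hc : ∀ k, |c k| ≤ (s.factorial * b ^ s : ℕ) := by
    intro k
    have h1 := Matrix.det_le (A := Matrix.of fun i j => M (I i) (J' (k.succAbove j)))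
      (abv := AbsoluteValue.abs) (x := (b : ℤ)) (fun i j => hM _ _)
    have h2 : |c k| ≤ (r.factorial : ℤ) * (b : ℤ) ^ r := by
      simp only [c, abs_mul, abs_pow, abs_neg, abs_one, one_pow, one_mul]
      simpa using h1
    refine h2.trans ?_
    norm_cast
    gcongr
  refine ⟨fun j => ∑ k, if J' k = j then c k else 0, ?_, ?_, ?_⟩
  · intro h0
    have h1 := congrFun h0 j₀
    have h2 : (∑ k, if J' k = j₀ then c k else 0) = c 0 := by
      rw [Finset.sum_eq_single 0]
      · simp [J']
      · intro k _ hk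
        have : J' k ≠ j₀ := fun h => hk (hJ' (by simpa [J'] using h))
        simp [this]
      · simp
    rw [h2] at h1
    apply hIJ
    simpa [c, J'] using h1
  · intro j
    by_cases hj : ∃ k, J' k = j
    · obtain ⟨k, rfl⟩ := hj
      have : (∑ k', if J' k' = J' k then c k' else 0) = c k := by
        simp [hJ'.eq_iff]
      simp only [this]
      exact hc k
    · push Not at hj
      simp only [hj, if_false, Finset.sum_const_zero, abs_zero]
      positivity
  · intro i
    have h1 : Matrix.det (Matrix.of fun a j => M ((Fin.cons i I : Fin (r + 1) → ι) a) (J' j)) = 0 := by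
      by_contra h
      exact hmax ⟨_, _, h⟩
    rw [Matrix.det_succ_row_zero] at h1
    calc ∑ j, M i j * ∑ k, (if J' k = j then c k else 0)
        = ∑ k, M i (J' k) * c k := by
          simp_rw [Finset.mul_sum]
          rw [Finset.sum_comm]
          refine Finset.sum_congr rfl fun k _ => ?_
          simp
      _ = 0 := by
          rw [← h1]
          refine Finset.sum_congr rfl fun k _ => ?_
          simp only [c, Matrix.of_apply, Fin.cons_zero]
          rw [mul_left_comm, ← mul_assoc]
          congr 1

theorem dvd_eval_sub_eval {σ : Type*} (G : MvPolynomial σ ℤ) {q : ℤ} {η ξ : σ → ℤ}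
    (h : ∀ i, q ∣ η i - ξ i) : q ∣ eval η G - eval ξ G := by
  induction G using MvPolynomial.induction_on with
  | C a => simp
  | add p r hp hr =>
    have := dvd_add hp hr
    rwa [show eval η p - eval ξ p + (eval η r - eval ξ r) = eval η (p + r) - eval ξ (p + r) by
      simp only [map_add]; ring] at this
  | mul_X p i hp =>
    have := dvd_add (hp.mul_right (η i)) ((h i).mul_left (eval ξ p))
    rwa [show (eval η p - eval ξ p) * η i + eval ξ p * (η i - ξ i)
        = eval η (p * X i) - eval ξ (p * X i) by simp only [map_mul, eval_X]; ring] at this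

theorem finSuccEquiv_pderiv_zero {R : Type*} [CommRing R] {n : ℕ}
    (G : MvPolynomial (Fin (n + 1)) R) :
    finSuccEquiv R n (pderiv 0 G) = Polynomial.derivative (finSuccEquiv R n G) := by
  induction G using MvPolynomial.induction_on with
  | C a => simp [finSuccEquiv_apply]
  | add p r hp hr => simp [hp, hr]
  | mul_X p i hp =>
    rw [Derivation.leibniz, map_add, smul_eq_mul, smul_eq_mul, map_mul, map_mul, map_mul, hp,
      Polynomial.derivative_mul]
    refine Fin.cases ?_ (fun j => ?_) i
    · simp [finSuccEquiv_X_zero]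
      ring
    · simp [finSuccEquiv_X_succ, pderiv_X_of_ne (Fin.succ_ne_zero j)]
      ring

theorem eval_eq_eval_finSuccEquiv {R : Type*} [CommRing R] {n : ℕ}
    (G : MvPolynomial (Fin (n + 1)) R) (η : Fin (n + 1) → R) :
    eval η G = Polynomial.eval (η 0) ((finSuccEquiv R n G).map (eval (Fin.tail η))) := by
  rw [← eval_eq_eval_mv_eval', Fin.cons_self_tail]

/-- Newton iteration with fixed slope: near a point where the derivative in the first variable is
a unit modulo `q`, the first coordinate of a zero is a polynomial function of the other coordinates
modulo any power of `q`. -/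
theorem exists_polynomial_parametrization {n : ℕ} (G : MvPolynomial (Fin (n + 1)) ℤ) (q : ℤ)
    (ξ : Fin (n + 1) → ℤ) (hu : IsCoprime (eval ξ (pderiv 0 G)) q) (N : ℕ) :
    ∃ φ : MvPolynomial (Fin n) ℤ, ∀ η : Fin (n + 1) → ℤ, (∀ i, q ∣ η i - ξ i) →
      q ^ (N + 1) ∣ eval η G → q ^ (N + 1) ∣ η 0 - eval (Fin.tail η) φ := by
  obtain ⟨a, b, hab⟩ := hu
  induction N with
  | zero =>
    refine ⟨C (ξ 0), fun η h _ => ?_⟩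
    simpa using h 0
  | succ N ih =>
    obtain ⟨φ, hφ⟩ := ih
    refine ⟨φ - C a * Polynomial.eval φ (finSuccEquiv ℤ n G), fun η h hG => ?_⟩
    have hδ := hφ η h (dvd_trans (pow_dvd_pow q (by omega)) hG)
    set x := eval (Fin.tail η) φ with hx
    set p := (finSuccEquiv ℤ n G).map (eval (Fin.tail η)) with hp
    have hGp : eval η G = p.eval (η 0) := eval_eq_eval_finSuccEquiv G η
    have hev : eval (Fin.tail η) (Polynomial.eval φ (finSuccEquiv ℤ n G)) = p.eval x := by
      rw [hp, hx, Polynomial.eval_map, ← Polynomial.eval₂_hom]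
    obtain ⟨k, hk⟩ := Polynomial.binomExpansion p x (η 0 - x)
    rw [add_sub_cancel] at hk
    have hder : q ∣ p.derivative.eval x - eval ξ (pderiv 0 G) := by
      have h1 : p.derivative.eval x = eval (Fin.cons x (Fin.tail η) : Fin (n + 1) → ℤ)
          (pderiv 0 G) := by
        rw [eval_eq_eval_mv_eval', finSuccEquiv_pderiv_zero, hp, Polynomial.derivative_map]
      rw [h1]
      refine dvd_eval_sub_eval _ fun i => ?_
      refine Fin.cases ?_ (fun j => ?_) i
      · have h2 : q ∣ η 0 - x := dvd_trans (dvd_pow_self q (by omega)) hδ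
        have := dvd_sub (h 0) h2
        simpa using this
      · simpa [Fin.tail] using h j.succ
    have hval : η 0 - eval (Fin.tail η) (φ - C a * Polynomial.eval φ (finSuccEquiv ℤ n G))
        = a * p.eval (η 0) - a * (p.derivative.eval x - eval ξ (pderiv 0 G)) * (η 0 - x)
          + b * q * (η 0 - x) - a * k * (η 0 - x) ^ 2 := by
      rw [map_sub, map_mul, eval_C, hev, hk, ← hx]
      linear_combination -(η 0 - x) * hab
    rw [hval]
    have hq : q ^ (N + 1 + 1) ∣ q * (η 0 - x) := by
      rw [pow_succ']
      exact mul_dvd_mul_left q hδ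
    refine dvd_sub (dvd_add (dvd_sub ?_ ?_) ?_) ?_
    · rw [← hGp]
      exact hG.mul_left a
    · obtain ⟨c, hc⟩ := hder
      rw [hc]
      convert hq.mul_left (a * c) using 1
      ring
    · convert hq.mul_left b using 1
      ring
    · refine Dvd.dvd.mul_left ?_ _
      refine dvd_trans ?_ (pow_dvd_pow_of_dvd hδ 2)
      rw [← pow_mul]
      exact pow_dvd_pow q (by omega)

theorem pow_dvd_det_eval_mul {n s : ℕ} (q : ℤ) (e : ℕ) (φ : Fin s → MvPolynomial (Fin n) ℤ)
    (u : Fin s → Fin n → ℤ)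
    (he : ∀ β : Fin s → (Fin n →₀ ℕ), Function.Injective β → e ≤ ∑ j, (β j).degree) :
    q ^ e ∣ Matrix.det (Matrix.of fun i j => eval (fun k => q * u i k) (φ j)) := by
  classical
  let T : Finset (Fin n →₀ ℕ) := Finset.univ.biUnion fun j => (φ j).support
  have hrow : ∀ j i, eval (fun k => q * u i k) (φ j)
      = ∑ β ∈ T, ((coeff β (φ j) * q ^ β.degree) • fun i => ∏ k, u i k ^ β k) i := by
    intro j i
    rw [eval_eq']
    have hsub : (φ j).support ⊆ T := Finset.subset_biUnion_of_mem (fun j => (φ j).support)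
      (Finset.mem_univ j)
    rw [← Finset.sum_subset hsub]
    · refine Finset.sum_congr rfl fun β _ => ?_
      simp only [mul_pow, Finset.prod_mul_distrib, Finset.prod_pow_eq_pow_sum, Pi.smul_apply,
        smul_eq_mul, Finsupp.degree_eq_sum]
      ring
    · intro β _ hβ
      simp [notMem_support_iff.mp hβ]
  rw [← Matrix.det_transpose]
  have hT : (Matrix.of fun i j => eval (fun k => q * u i k) (φ j)).transpose
      = fun j => ∑ β ∈ T, ((coeff β (φ j) * q ^ β.degree) • fun i => ∏ k, u i k ^ β k) := by
    ext j i
    rw [Finset.sum_apply]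
    exact hrow j i
  rw [hT]
  have hsum := (Matrix.detRowAlternating (n := Fin s) (R := ℤ)).toMultilinearMap.map_sum_finset
    (fun j (β : Fin n →₀ ℕ) => (coeff β (φ j) * q ^ β.degree) •
      fun i : Fin s => ∏ k, u i k ^ β k) (fun _ => T)
  change q ^ e ∣ (Matrix.detRowAlternating (n := Fin s) (R := ℤ)).toMultilinearMap _
  rw [hsum]
  refine Finset.dvd_sum fun β _ => ?_
  rw [MultilinearMap.map_smul_univ]
  by_cases hβ : Function.Injective β
  · refine Dvd.dvd.mul_right ?_ _
    rw [Finset.prod_mul_distrib, Finset.prod_pow_eq_pow_sum]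
    exact (pow_dvd_pow q (he β hβ)).mul_left _
  · rw [Function.not_injective_iff] at hβ
    obtain ⟨a, b, hab, hne⟩ := hβ
    have : (Matrix.detRowAlternating (n := Fin s) (R := ℤ)).toMultilinearMap
        (fun j => fun i : Fin s => ∏ k, u i k ^ (β j) k) = 0 :=
      (Matrix.detRowAlternating (n := Fin s) (R := ℤ)).map_eq_zero_of_eq _ (by simp [hab]) hne
    rw [this, smul_zero]
    exact dvd_zero _

/-- The determinant method: a determinant of polynomial functions evaluated at points of a
hypersurface lying in a single smooth residue class is divisible by a high power of the modulus. -/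
theorem pow_dvd_det_of_residue_class {n s : ℕ} (q : ℤ) (e N : ℕ) (heN : e ≤ N + 1)
    (G : MvPolynomial (Fin (n + 1)) ℤ) (ξ : Fin (n + 1) → ℤ)
    (hu : IsCoprime (eval ξ (pderiv 0 G)) q)
    (ψ : Fin s → MvPolynomial (Fin (n + 1)) ℤ) (η : Fin s → Fin (n + 1) → ℤ)
    (hη : ∀ i k, q ∣ η i k - ξ k) (hG : ∀ i, q ^ (N + 1) ∣ eval (η i) G)
    (he : ∀ β : Fin s → (Fin n →₀ ℕ), Function.Injective β → e ≤ ∑ j, (β j).degree) :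
    q ^ e ∣ Matrix.det (Matrix.of fun i j => eval (η i) (ψ j)) := by
  obtain ⟨φ, hφ⟩ := exists_polynomial_parametrization G q ξ hu N
  choose u hu' using fun i (k : Fin n) => hη i k.succ
  let θ : Fin (n + 1) → MvPolynomial (Fin n) ℤ := Fin.cons φ X
  let ψ' : Fin s → MvPolynomial (Fin n) ℤ := fun j =>
    bind₁ (fun k => X k + C (ξ k.succ)) (bind₁ θ (ψ j))
  have htail : ∀ i, (fun k => eval (fun k => q * u i k) (X k + C (ξ k.succ)))
      = Fin.tail (η i) := by
    intro i
    funext k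
    simp only [map_add, eval_X, eval_C, Fin.tail]
    linarith [hu' i k]
  have hev : ∀ i j, eval (fun k => q * u i k) (ψ' j)
      = eval (Fin.cons (eval (Fin.tail (η i)) φ) (Fin.tail (η i)) : Fin (n + 1) → ℤ) (ψ j) := by
    intro i j
    have h1 : ∀ {σ τ : Type} (x : τ → ℤ) (g : σ → MvPolynomial τ ℤ) (p : MvPolynomial σ ℤ),
        eval x (bind₁ g p) = eval (fun k => eval x (g k)) p := by
      intro σ τ x g p
      simp only [← coe_aeval_eq_eval, RingHom.coe_coe, aeval_bind₁]
    rw [h1, h1, htail]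
    congr 2
    funext k
    refine Fin.cases ?_ (fun j => ?_) k
    · simp [θ]
    · simp [θ]
  have hdvd := pow_dvd_det_eval_mul q e ψ' u he
  let π := Ideal.Quotient.mk (Ideal.span {q ^ e})
  have hπ : ∀ x : ℤ, π x = 0 ↔ q ^ e ∣ x := fun x => by
    rw [Ideal.Quotient.eq_zero_iff_mem, Ideal.mem_span_singleton]
  rw [← hπ, RingHom.map_det] at hdvd ⊢
  rw [← hdvd]
  congr 1
  ext i j
  simp only [RingHom.mapMatrix_apply, Matrix.map_apply, Matrix.of_apply]
  rw [← sub_eq_zero, ← map_sub, hπ, hev]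
  refine dvd_eval_sub_eval _ fun k => ?_
  refine Fin.cases ?_ (fun j => ?_) k
  · simpa using dvd_trans (pow_dvd_pow q heN) (hφ (η i) (hη i) (hG i))
  · simp [Fin.tail]

theorem sum_comp_le_sum_of_injective {ι κ : Type*} [Fintype ι] (φ : ι → κ)
    (hφ : Function.Injective φ) (T : Finset κ) (g : κ → ℕ) (hg : ∀ x, x ∉ T → g x = 0) :
    ∑ j, g (φ j) ≤ ∑ x ∈ T, g x := by
  classical
  have hmap := Finset.sum_map Finset.univ ⟨φ, hφ⟩ g
  simp only [Function.Embedding.coeFn_mk] at hmap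
  rw [← hmap]
  rw [← Finset.sum_filter_add_sum_filter_not _ (fun x => x ∈ T)]
  rw [Finset.sum_eq_zero (s := Finset.filter (fun x => x ∉ T) _)
    (fun x hx => hg x (Finset.mem_filter.mp hx).2), add_zero]
  exact Finset.sum_le_sum_of_subset fun x hx => (Finset.mem_filter.mp hx).2

theorem le_sum_degree_of_injective_one {s : ℕ} (β : Fin s → (Fin 1 →₀ ℕ))
    (hβ : Function.Injective β) : s * (s - 1) ≤ 2 * ∑ j, (β j).degree := by
  have hinj : Function.Injective fun j => (β j).degree := by
    intro a b hab
    apply hβ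
    ext
    simpa [Finsupp.degree_eq_sum] using hab
  have h1 := sum_comp_le_sum_of_injective _ hinj (Finset.range s) (fun m => s - 1 - m)
    (by intro x hx; simp at hx; omega)
  rw [Finset.sum_range_reflect (fun m => m) s] at h1
  have h2 := Finset.sum_range_id_mul_two s
  have h3 : ∑ _j : Fin s, (s - 1) ≤ ∑ j, (s - 1 - (β j).degree) + ∑ j, (β j).degree := by
    rw [← Finset.sum_add_distrib]
    exact Finset.sum_le_sum fun j _ => by omega
  simp only [Finset.sum_const, Finset.card_univ, Fintype.card_fin, smul_eq_mul] at h3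
  omega

theorem six_mul_sum_sub (e : ℕ) :
    6 * ∑ a ∈ Finset.range e, ∑ b ∈ Finset.range e, (e - (a + b)) = e * (e + 1) * (e + 2) := by
  have h1 : ∀ c, ∀ e, c ≤ e → 2 * ∑ b ∈ Finset.range e, (c - b) = c * (c + 1) := by
    intro c
    induction c with
    | zero => intro e _; simp
    | succ c ih =>
      intro e he
      obtain ⟨e, rfl⟩ : ∃ e', e = e' + 1 := ⟨e - 1, by omega⟩
      rw [Finset.sum_range_succ']
      simp only [Nat.add_sub_add_right, Nat.sub_zero]
      rw [mul_add, ih e (by omega)]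
      ring
  have h2 : 2 * ∑ a ∈ Finset.range e, ∑ b ∈ Finset.range e, (e - (a + b))
      = ∑ a ∈ Finset.range e, (e - a) * (e - a + 1) := by
    rw [Finset.mul_sum]
    refine Finset.sum_congr rfl fun a _ => ?_
    rw [← h1 (e - a) e (by omega)]
    simp only [Nat.sub_add_eq]
  have h3 : ∀ e : ℕ, 3 * ∑ a ∈ Finset.range e, (e - a) * (e - a + 1) = e * (e + 1) * (e + 2) := by
    intro e
    induction e with
    | zero => simp
    | succ e ih =>
      rw [Finset.sum_range_succ']
      simp only [Nat.add_sub_add_right, Nat.sub_zero]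
      rw [mul_add, ih]
      ring
  rw [← h3, ← h2]
  ring

theorem le_sum_degree_of_injective_two {s e : ℕ} (β : Fin s → (Fin 2 →₀ ℕ))
    (hβ : Function.Injective β) :
    6 * (e * s) ≤ 6 * ∑ j, (β j).degree + e * (e + 1) * (e + 2) := by
  have hinj : Function.Injective fun j => (β j 0, β j 1) := by
    intro a b hab
    apply hβ
    ext i
    have := Prod.ext_iff.mp hab
    fin_cases i
    · exact this.1
    · exact this.2
  have h1 := sum_comp_le_sum_of_injective _ hinj (Finset.range e ×ˢ Finset.range e)
    (fun m => e - (m.1 + m.2)) (by rintro ⟨a, b⟩ hx; simp at hx; simp; omega)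
  rw [Finset.sum_product] at h1
  have h3 : ∑ _j : Fin s, e ≤ ∑ j, (e - (β j 0 + β j 1)) + ∑ j, (β j).degree := by
    rw [← Finset.sum_add_distrib]
    refine Finset.sum_le_sum fun j _ => ?_
    rw [Finsupp.degree_eq_sum, Fin.sum_univ_two]
    omega
  simp only [Finset.sum_const, Finset.card_univ, Fintype.card_fin, smul_eq_mul] at h3
  have h4 := six_mul_sum_sub e
  rw [mul_comm s e] at h3
  dsimp only at h1
  omega

theorem totalDegree_det_le {σ R : Type*} [CommRing R] {s : ℕ}
    (M : Matrix (Fin s) (Fin s) (MvPolynomial σ R)) (D : ℕ) (hM : ∀ i j, (M i j).totalDegree ≤ D) :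
    M.det.totalDegree ≤ s * D := by
  rw [Matrix.det_apply]
  refine totalDegree_finsetSum_le fun π _ => ?_
  refine (totalDegree_smul_le _ _).trans ?_
  refine (totalDegree_finsetProd _ _).trans ?_
  calc ∑ i, (M (π i) i).totalDegree ≤ ∑ _i : Fin s, D := Finset.sum_le_sum fun i _ => hM _ _
    _ = s * D := by simp

theorem resultant_ne_zero_of_prime {S : Type*} [CommRing S] [IsDomain S] {f g : Polynomial S}
    (hf : Prime f) (hfg : ¬ f ∣ g) : Polynomial.resultant f g ≠ 0 := by
  intro h0
  let b₁ := ((Polynomial.degreeLT.basis S f.natDegree).prod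
    (Polynomial.degreeLT.basis S g.natDegree)).reindex finSumFinEquiv
  let b₂ := Polynomial.degreeLT.basis S (f.natDegree + g.natDegree)
  have hM := Polynomial.toMatrix_sylvesterMap' f g le_rfl le_rfl
  obtain ⟨v, hv, hv0⟩ := Matrix.exists_mulVec_eq_zero_iff.mpr h0
  have hker : Polynomial.sylvesterMap f g le_rfl le_rfl (b₁.equivFun.symm v) = 0 := by
    apply b₂.equivFun.injective
    have := LinearMap.toMatrix_mulVec_repr b₁ b₂ (Polynomial.sylvesterMap f g le_rfl le_rfl)
      (b₁.equivFun.symm v)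
    rw [hM] at this
    have hr : ⇑(b₁.repr (b₁.equivFun.symm v)) = v := b₁.equivFun.apply_symm_apply v
    rw [hr] at this
    rw [map_zero, ← hv0, this]
    rfl
  set x := b₁.equivFun.symm v with hx
  have hx0 : x ≠ 0 := by
    intro h
    apply hv
    have : b₁.equivFun x = v := b₁.equivFun.apply_symm_apply v
    rw [← this, h, map_zero]
  have hE : f * x.2.1 + g * x.1.1 = 0 := congrArg Subtype.val hker
  have hdvd : f ∣ g * x.1.1 := ⟨- x.2.1, by linear_combination hE⟩
  have hx1 : x.1.1 = 0 := by
    by_contra hne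
    have h1 := (hf.dvd_or_dvd hdvd).resolve_left hfg
    have h2 := Polynomial.degree_le_of_dvd h1 hne
    have h3 := Polynomial.mem_degreeLT.mp x.1.2
    rw [Polynomial.degree_eq_natDegree hf.ne_zero] at h2
    exact absurd (h2.trans_lt h3) (lt_irrefl _)
  rw [hx1, mul_zero, add_zero] at hE
  have hx2 := (mul_eq_zero.mp hE).resolve_left hf.ne_zero
  exact hx0 (Prod.ext (Subtype.ext hx1) (Subtype.ext hx2))

/-- Elimination of the first variable from two equations, the first one being prime. -/
theorem exists_elimination {R : Type*} [CommRing R] [IsDomain R] {n D : ℕ}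
    {f g : MvPolynomial (Fin (n + 1)) R} (hf : Prime f) (hfg : ¬ f ∣ g)
    (hfD : f.totalDegree ≤ D) (hgD : g.totalDegree ≤ D) :
    ∃ r : MvPolynomial (Fin n) R, r ≠ 0 ∧ r.totalDegree ≤ 2 * D * D + D ∧
      ∀ x : Fin (n + 1) → R, eval x f = 0 → eval x g = 0 → eval (Fin.tail x) r = 0 := by
  set a := finSuccEquiv R n f with ha
  set b := finSuccEquiv R n g with hb
  have ha' : Prime a := (MulEquiv.prime_iff (finSuccEquiv R n).toMulEquiv).mpr hf
  have hab : ¬ a ∣ b := fun h => hfg ((map_dvd_iff (finSuccEquiv R n)).mp h)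
  have hdeg : ∀ p : MvPolynomial (Fin (n + 1)) R, p.totalDegree ≤ D → ∀ i,
      ((finSuccEquiv R n p).coeff i).totalDegree ≤ D := by
    intro p hp i
    by_cases h : (finSuccEquiv R n p).coeff i = 0
    · simp [h]
    · have := totalDegree_coeff_finSuccEquiv_add_le p i h
      omega
  have hnat : ∀ p : MvPolynomial (Fin (n + 1)) R, p.totalDegree ≤ D →
      (finSuccEquiv R n p).natDegree ≤ D := by
    intro p hp
    rw [natDegree_finSuccEquiv]
    exact (degreeOf_le_totalDegree p 0).trans hp
  by_cases h0 : a.natDegree = 0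
  · have haC := Polynomial.eq_C_of_natDegree_eq_zero h0
    refine ⟨a.coeff 0, ?_, (hdeg f hfD 0).trans (by omega), ?_⟩
    · intro h
      rw [h, map_zero] at haC
      exact ha'.ne_zero haC
    · intro x hx _
      rw [eval_eq_eval_finSuccEquiv, ← ha, haC] at hx
      simpa using hx
  · refine ⟨Polynomial.resultant a b, resultant_ne_zero_of_prime ha' hab, ?_, ?_⟩
    · refine (totalDegree_det_le _ D ?_).trans ?_
      · intro i j
        rw [Polynomial.sylvester, Matrix.of_apply]
        refine Fin.addCases (fun j => ?_) (fun j => ?_) j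
        · simp only [Fin.addCases_left]
          split_ifs
          · exact hdeg g hgD _
          · simp
        · simp only [Fin.addCases_right]
          split_ifs
          · exact hdeg f hfD _
          · simp
      · have h1 := hnat f hfD
        have h2 := hnat g hgD
        calc (a.natDegree + b.natDegree) * D ≤ (D + D) * D :=
              Nat.mul_le_mul_right _ (add_le_add h1 h2)
          _ ≤ _ := by nlinarith
    · intro x hx hgx
      obtain ⟨p, q, -, -, hpq⟩ := Polynomial.exists_mul_add_mul_eq_C_resultant a b le_rfl le_rfl
        (Or.inl h0)
      rw [eval_eq_eval_finSuccEquiv, ← ha] at hx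
      rw [eval_eq_eval_finSuccEquiv, ← hb] at hgx
      have := congrArg (fun P => Polynomial.eval (x 0) (P.map (eval (Fin.tail x)))) hpq
      simp only [Polynomial.map_add, Polynomial.map_mul, Polynomial.eval_add, Polynomial.eval_mul,
        hx, hgx, zero_mul, add_zero, Polynomial.map_C, Polynomial.eval_C] at this
      exact this.symm

theorem exists_finset_zeros_fin_one {R : Type*} [CommRing R] [IsDomain R]
    {r : MvPolynomial (Fin 1) R} (hr : r ≠ 0) {L : ℕ} (hL : r.totalDegree ≤ L) :
    ∃ T : Finset R, T.card ≤ L ∧ ∀ x : Fin 1 → R, eval x r = 0 → x 0 ∈ T := by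
  classical
  set p : Polynomial R := (finSuccEquiv R 0 r).map (eval finZeroElim) with hp
  have hp0 : p ≠ 0 := by
    rw [hp, Polynomial.map_ne_zero_iff]
    · simpa using hr
    · intro a b hab
      have key : ∀ a : MvPolynomial (Fin 0) R, C (eval finZeroElim a) = a := by
        intro a
        obtain ⟨c, rfl⟩ := C_surjective (Fin 0) a
        simp
      rw [← key a, ← key b, hab]
  refine ⟨p.roots.toFinset, ?_, ?_⟩
  · refine (Multiset.toFinset_card_le _).trans ((Polynomial.card_roots' p).trans ?_)
    refine Polynomial.natDegree_map_le.trans ?_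
    rw [natDegree_finSuccEquiv]
    exact (degreeOf_le_totalDegree _ _).trans hL
  · intro x hx
    rw [eval_eq_eval_finSuccEquiv] at hx
    rw [Multiset.mem_toFinset, Polynomial.mem_roots hp0, Polynomial.IsRoot, ← hx,
      hp, Subsingleton.elim (Fin.tail x) finZeroElim]

/-- A crude form of Bézout's theorem for plane curves. -/
theorem exists_finset_common_zeros {R : Type*} [CommRing R] [IsDomain R] {D : ℕ}
    {P Q : MvPolynomial (Fin 2) R} (hP : Prime P) (hPQ : ¬ P ∣ Q)
    (hPD : P.totalDegree ≤ D) (hQD : Q.totalDegree ≤ D) :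
    ∃ T : Finset (Fin 2 → R), T.card ≤ (2 * D * D + D) ^ 2 ∧
      ∀ x : Fin 2 → R, eval x P = 0 → eval x Q = 0 → x ∈ T := by
  classical
  have key : ∀ {P Q : MvPolynomial (Fin 2) R}, Prime P → ¬ P ∣ Q → P.totalDegree ≤ D →
      Q.totalDegree ≤ D → ∃ T : Finset R, T.card ≤ 2 * D * D + D ∧
        ∀ x : Fin 2 → R, eval x P = 0 → eval x Q = 0 → x 1 ∈ T := by
    intro P Q hP hPQ hPD hQD
    obtain ⟨r, hr0, hrL, hr⟩ := exists_elimination hP hPQ hPD hQD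
    obtain ⟨T, hT, hTx⟩ := exists_finset_zeros_fin_one hr0 hrL
    exact ⟨T, hT, fun x h1 h2 => hTx _ (hr x h1 h2)⟩
  obtain ⟨T₁, hT₁, h₁⟩ := key hP hPQ hPD hQD
  let e := renameEquiv R (Equiv.swap (0 : Fin 2) 1)
  obtain ⟨T₀, hT₀, h₀⟩ := key (P := e P) (Q := e Q)
    ((MulEquiv.prime_iff e.toMulEquiv).mpr hP) (fun h => hPQ ((map_dvd_iff e).mp h))
    ((totalDegree_rename_le _ _).trans hPD) ((totalDegree_rename_le _ _).trans hQD)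
  refine ⟨(T₀ ×ˢ T₁).image fun a => ![a.1, a.2], ?_, ?_⟩
  · refine Finset.card_image_le.trans ?_
    rw [Finset.card_product, sq]
    exact Nat.mul_le_mul hT₀ hT₁
  · intro x hx hy
    refine Finset.mem_image.mpr ⟨(x 0, x 1), Finset.mem_product.mpr ⟨?_, h₁ x hx hy⟩, ?_⟩
    · have hx' : ∀ p, eval (x ∘ Equiv.swap (0 : Fin 2) 1) (e p) = eval x p := by
        intro p
        simp only [e, renameEquiv_apply, eval_rename]
        congr 2
        funext i
        simp
      have := h₀ (x ∘ Equiv.swap (0 : Fin 2) 1) (by rw [hx', hx]) (by rw [hx', hy])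
      simpa using this
    · funext i
      fin_cases i <;> rfl

theorem card_zeros_le_of_subset_piFinset {R : Type*} [CommRing R] [IsDomain R] [DecidableEq R]
    {n L : ℕ} {r : MvPolynomial (Fin (n + 1)) R} (hr : r ≠ 0) (hL : r.totalDegree ≤ L)
    (S : Finset R) (E : Finset (Fin (n + 1) → R)) (hE : ∀ x ∈ E, eval x r = 0 ∧ ∀ i, x i ∈ S) :
    E.card ≤ L * S.card ^ n := by
  have h1 := schwartz_zippel_totalDegree hr S
  have hsub : E ⊆ (Fintype.piFinset fun _ => S).filter fun f => eval f r = 0 := by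
    intro x hx
    rw [Finset.mem_filter, Fintype.mem_piFinset]
    exact ⟨(hE x hx).2, (hE x hx).1⟩
  have hcard := Finset.card_le_card hsub
  rcases S.eq_empty_or_nonempty with rfl | hS
  · rcases E.eq_empty_or_nonempty with rfl | ⟨x, hx⟩
    · simp
    · exact absurd ((hE x hx).2 0) (by simp)
  · have hpos : (0 : ℚ≥0) < (S.card : ℚ≥0) := by exact_mod_cast hS.card_pos
    rw [div_le_div_iff₀ (by positivity) hpos, pow_succ] at h1
    have h2 : (((Fintype.piFinset fun _ => S).filter fun f => eval f r = 0).card : ℚ≥0)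
        ≤ r.totalDegree * S.card ^ n := by
      refine le_of_mul_le_mul_right ?_ hpos
      calc _ ≤ _ := h1
        _ = _ := by ring
    have h3 : ((Fintype.piFinset fun _ => S).filter fun f => eval f r = 0).card
        ≤ r.totalDegree * S.card ^ n := by exact_mod_cast h2
    exact hcard.trans (h3.trans (Nat.mul_le_mul_right _ hL))

theorem card_box_zeros_le {R : Type*} [CommRing R] [IsDomain R] [CharZero R]
    {n L N : ℕ} {r : MvPolynomial (Fin (n + 1)) R} (hr : r ≠ 0) (hL : r.totalDegree ≤ L)
    (E : Finset (Fin (n + 1) → ℤ))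
    (hE : ∀ x ∈ E, eval (fun i => (x i : R)) r = 0 ∧ ∀ i, |x i| ≤ N) :
    E.card ≤ L * (2 * N + 1) ^ n := by
  classical
  have hinj : Function.Injective fun (x : Fin (n + 1) → ℤ) i => (x i : R) := by
    intro x y hxy
    funext i
    exact Int.cast_injective (α := R) (congrFun hxy i)
  rw [← Finset.card_image_of_injective E hinj]
  have hS : ((Finset.Icc (-(N : ℤ)) N).image fun z : ℤ => (z : R)).card ≤ 2 * N + 1 := by
    refine Finset.card_image_le.trans ?_
    simp
    omega
  refine (card_zeros_le_of_subset_piFinset hr hL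
    ((Finset.Icc (-(N : ℤ)) N).image fun z : ℤ => (z : R)) _ ?_).trans
    (Nat.mul_le_mul_left _ (Nat.pow_le_pow_left hS n))
  intro x hx
  obtain ⟨y, hy, rfl⟩ := Finset.mem_image.mp hx
  refine ⟨(hE y hy).1, fun i => Finset.mem_image_of_mem _ ?_⟩
  exact Finset.mem_Icc.mpr (abs_le.mp ((hE y hy).2 i))

theorem coeff_finSuccEquiv_top {R : Type*} [CommRing R] {n d : ℕ}
    {f : MvPolynomial (Fin (n + 1)) R} (hf : f.totalDegree ≤ d) :
    (finSuccEquiv R n f).coeff d = C (coeff (Finsupp.single 0 d) f) := by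
  by_cases h0 : (finSuccEquiv R n f).coeff d = 0
  · have : coeff (Finsupp.cons d 0) f = 0 := by
      rw [← finSuccEquiv_coeff_coeff, h0, coeff_zero]
    have hc : (Finsupp.cons d 0 : Fin (n + 1) →₀ ℕ) = Finsupp.single 0 d := by
      ext i
      refine Fin.cases ?_ (fun j => ?_) i <;> simp
    rw [h0, ← hc, this, C_0]
  · have h1 := totalDegree_coeff_finSuccEquiv_add_le f d h0
    have h2 : ((finSuccEquiv R n f).coeff d).totalDegree = 0 := by omega
    rw [totalDegree_eq_zero_iff_eq_C.mp h2, finSuccEquiv_coeff_coeff]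
    congr 2
    ext i
    refine Fin.cases ?_ (fun j => ?_) i <;> simp

theorem exists_finset_fiber {R : Type*} [CommRing R] [IsDomain R] {n d : ℕ}
    {f : MvPolynomial (Fin (n + 1)) R} (hf : f.totalDegree ≤ d)
    (hc : coeff (Finsupp.single 0 d) f ≠ 0) (y : Fin n → R) :
    ∃ T : Finset R, T.card ≤ d ∧ ∀ x : Fin (n + 1) → R, Fin.tail x = y → eval x f = 0 → x 0 ∈ T := by
  classical
  set p : Polynomial R := (finSuccEquiv R n f).map (eval y) with hp
  have hp0 : p ≠ 0 := by
    intro h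
    have := congrArg (fun q => Polynomial.coeff q d) h
    simp only [hp, Polynomial.coeff_map, coeff_finSuccEquiv_top hf, eval_C, Polynomial.coeff_zero]
      at this
    exact hc this
  refine ⟨p.roots.toFinset, ?_, ?_⟩
  · refine (Multiset.toFinset_card_le _).trans ((Polynomial.card_roots' p).trans ?_)
    refine Polynomial.natDegree_map_le.trans ?_
    rw [natDegree_finSuccEquiv]
    exact (degreeOf_le_totalDegree _ _).trans hf
  · intro x hxy hx
    rw [eval_eq_eval_finSuccEquiv, hxy, ← hp] at hx
    rw [Multiset.mem_toFinset, Polynomial.mem_roots hp0]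
    exact hx

/-- Bounding a set of integral points of a hypersurface, monic in the first variable, by its
projection to the other coordinates. -/
theorem card_le_mul_card_image_tail {R : Type*} [CommRing R] [IsDomain R] [CharZero R] {n d : ℕ}
    {f : MvPolynomial (Fin (n + 1)) R} (hf : f.totalDegree ≤ d)
    (hc : coeff (Finsupp.single 0 d) f ≠ 0) (E : Finset (Fin (n + 1) → ℤ))
    (hE : ∀ x ∈ E, eval (fun i => (x i : R)) f = 0) :
    E.card ≤ d * (E.image Fin.tail).card := by
  classical
  refine Finset.card_le_mul_card_image E d fun y hy => ?_
  obtain ⟨T, hT, hTx⟩ := exists_finset_fiber hf hc (fun i => (y i : R))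
  refine le_trans (Finset.card_le_card_of_injOn (fun x => ((x 0 : ℤ) : R)) ?_ ?_) hT
  · intro x hx
    rw [Finset.mem_coe, Finset.mem_filter] at hx
    refine hTx (fun i => (x i : R)) ?_ (hE x hx.1)
    rw [← hx.2]
    rfl
  · intro x hx x' hx' h
    rw [Finset.mem_coe, Finset.mem_filter] at hx hx'
    rw [← Fin.cons_self_tail x, ← Fin.cons_self_tail x', hx.2, hx'.2]
    congr 1
    exact Int.cast_injective (α := R) h

/-- The intersection of an irreducible hypersurface with another one has few integral points. -/
theorem card_le_of_not_dvd {R : Type*} [CommRing R] [IsDomain R] [CharZero R] {n d D N : ℕ}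
    {f g : MvPolynomial (Fin (n + 2)) R} (hfd : f.totalDegree ≤ d)
    (hc : coeff (Finsupp.single 0 d) f ≠ 0) (hf : Prime f) (hfg : ¬ f ∣ g)
    (hdD : d ≤ D) (hgD : g.totalDegree ≤ D) (E : Finset (Fin (n + 2) → ℤ))
    (hE : ∀ x ∈ E, eval (fun i => (x i : R)) f = 0 ∧ eval (fun i => (x i : R)) g = 0 ∧
      ∀ i, |x i| ≤ N) :
    E.card ≤ d * ((2 * D * D + D) * (2 * N + 1) ^ n) := by
  obtain ⟨r, hr0, hrL, hr⟩ := exists_elimination hf hfg (hfd.trans hdD) hgD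
  have h1 := card_le_mul_card_image_tail hfd hc E fun x hx => (hE x hx).1
  have h2 : (E.image Fin.tail).card ≤ (2 * D * D + D) * (2 * N + 1) ^ n := by
    refine card_box_zeros_le hr0 hrL _ ?_
    intro y hy
    obtain ⟨x, hx, rfl⟩ := Finset.mem_image.mp hy
    obtain ⟨hx1, hx2, hx3⟩ := hE x hx
    refine ⟨?_, fun i => hx3 i.succ⟩
    have h0 := hr _ hx1 hx2
    exact h0
  exact h1.trans (Nat.mul_le_mul_left d h2)

theorem exists_prime_sequence (Y : ℕ) (hY : 1 ≤ Y) :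
    ∃ p : ℕ → ℕ, (∀ i, (p i).Prime) ∧ StrictMono p ∧ (∀ i, Y < p i) ∧
      ∀ i, p i ≤ 2 ^ (i + 1) * Y := by
  choose! φ hφ using fun n (hn : n ≠ 0) => Nat.exists_prime_lt_and_le_two_mul n hn
  let p : ℕ → ℕ := fun i => φ^[i + 1] Y
  have hsucc : ∀ i, p (i + 1) = φ (p i) := fun i => Function.iterate_succ_apply' φ (i + 1) Y
  have hp0 : p 0 = φ Y := rfl
  have hprime : ∀ i, (p i).Prime := by
    intro i
    induction i with
    | zero => rw [hp0]; exact (hφ Y (by omega)).1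
    | succ i ih => rw [hsucc]; exact (hφ _ ih.ne_zero).1
  have hmono : StrictMono p := strictMono_nat_of_lt_succ fun i => by
    rw [hsucc]; exact (hφ _ (hprime i).ne_zero).2.1
  have h0 : Y < p 0 := by rw [hp0]; exact (hφ Y (by omega)).2.1
  refine ⟨p, hprime, hmono, fun i => h0.trans_le (hmono.monotone (Nat.zero_le i)), fun i => ?_⟩
  induction i with
  | zero => rw [hp0]; simpa using (hφ Y (by omega)).2.2
  | succ i ih =>
    rw [hsucc, pow_succ]
    have := (hφ _ (hprime i).ne_zero).2.2
    linarith

theorem exists_block_not_dvd {p : ℕ → ℕ} (hp : ∀ i, (p i).Prime) (hmono : StrictMono p) {Y : ℕ}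
    (hY1 : 1 ≤ Y) (hY : ∀ i, Y < p i) {n : ℤ} (hn : n ≠ 0) {k : ℕ} (hk : |n| ≤ (Y : ℤ) ^ k) (M a : ℕ) :
    ∃ j < k + 1, ∀ i < M, ¬ (p (a + (j * M + i)) : ℤ) ∣ n := by
  by_contra! hcon
  choose! φ hφ hdvd using hcon
  have hinj : Set.InjOn (fun j => p (a + (j * M + φ j))) (Finset.range (k + 1)) := by
    intro j hj j' hj' h
    have h1 := hmono.injective h
    rw [Finset.mem_coe, Finset.mem_range] at hj hj'
    have h2 := hφ j hj
    have h3 := hφ j' hj'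
    have h4 : j * M + φ j = j' * M + φ j' := by omega
    rcases lt_trichotomy j j' with h | h | h
    · nlinarith
    · exact h
    · nlinarith
  have hprod : ∏ q ∈ (Finset.range (k + 1)).image (fun j => p (a + (j * M + φ j))), q ∣ n.natAbs := by
    refine Finset.prod_primes_dvd _ ?_ ?_
    · intro q hq
      obtain ⟨j, -, rfl⟩ := Finset.mem_image.mp hq
      exact (hp _).prime
    · intro q hq
      obtain ⟨j, hj, rfl⟩ := Finset.mem_image.mp hq
      exact Int.natCast_dvd.mp (hdvd j (Finset.mem_range.mp hj))
  rw [Finset.prod_image hinj] at hprod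
  have h1 := Nat.le_of_dvd (Int.natAbs_pos.mpr hn) hprod
  have h2 : (Y + 1) ^ (k + 1) ≤ ∏ j ∈ Finset.range (k + 1), p (a + (j * M + φ j)) := by
    calc (Y + 1) ^ (k + 1) = ∏ _j ∈ Finset.range (k + 1), (Y + 1) := by simp
      _ ≤ _ := Finset.prod_le_prod' fun j _ => hY _
  have h3 : n.natAbs ≤ Y ^ k := by
    zify
    exact hk
  have h4 : Y ^ k < (Y + 1) ^ (k + 1) :=
    (Nat.pow_le_pow_left (Nat.le_succ Y) k).trans_lt
      (Nat.pow_lt_pow_right (by omega) (by omega))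
  omega

/-- The residues of an integral point modulo `p a, …, p (a + t - 1)`. -/
def residueKey (p : ℕ → ℕ) (a t : ℕ) {n : ℕ} (ξ : Fin n → ℤ) : Fin t → Fin n → ℤ :=
  fun i k => ξ k % p (a + i)

theorem prod_dvd_sub_of_residueKey_eq {p : ℕ → ℕ} (hp : ∀ i, (p i).Prime) (hmono : StrictMono p)
    {a t n : ℕ} {ξ η : Fin n → ℤ} (h : residueKey p a t η = residueKey p a t ξ) (k : Fin n) :
    (∏ i : Fin t, (p (a + i) : ℤ)) ∣ η k - ξ k := by
  refine Finset.prod_dvd_of_coprime ?_ ?_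
  · intro i _ j _ hij
    rw [Function.onFun, Nat.isCoprime_iff_coprime]
    refine (Nat.coprime_primes (hp _) (hp _)).mpr fun h => hij ?_
    have := hmono.injective h
    exact Fin.ext (by omega)
  · intro i _
    have := congrFun (congrFun h i) k
    exact Int.ModEq.dvd (Int.ModEq.symm this)

theorem isCoprime_prod_of_not_dvd {p : ℕ → ℕ} (hp : ∀ i, (p i).Prime) {a t : ℕ} {m : ℤ}
    (h : ∀ i < t, ¬ (p (a + i) : ℤ) ∣ m) : IsCoprime m (∏ i : Fin t, (p (a + i) : ℤ)) := by
  refine IsCoprime.prod_right fun i _ => ?_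
  exact ((Nat.prime_iff_prime_int.mp (hp _)).irreducible.coprime_iff_not_dvd.mpr (h i i.2)).symm

theorem pow_le_prod_primes {p : ℕ → ℕ} {Y : ℕ} (hY : ∀ i, Y < p i) (a t : ℕ) :
    (Y : ℤ) ^ t ≤ ∏ i : Fin t, (p (a + i) : ℤ) := by
  calc (Y : ℤ) ^ t = ∏ _i : Fin t, (Y : ℤ) := by simp
    _ ≤ _ := Finset.prod_le_prod (fun _ _ => by positivity) fun i _ => by
      exact_mod_cast (hY _).le

theorem totalDegree_map_le_totalDegree {σ R S : Type*} [CommSemiring R] [CommSemiring S]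
    (φ : R →+* S) (f : MvPolynomial σ R) : (map φ f).totalDegree ≤ f.totalDegree :=
  Finset.sup_mono (support_map_subset φ f)

theorem card_image_emod_le {q : ℕ} (hq : q.Prime) {n d : ℕ} {f : MvPolynomial (Fin (n + 1)) ℤ}
    (hf : f.totalDegree ≤ d) (E : Finset (Fin (n + 1) → ℤ))
    (hE : ∀ ξ ∈ E, (q : ℤ) ∣ eval ξ f ∧ ¬ (q : ℤ) ∣ eval ξ (pderiv 0 f)) :
    (E.image fun (ξ : Fin (n + 1) → ℤ) k => ξ k % (q : ℤ)).card ≤ d * q ^ n := by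
  classical
  have := Fact.mk hq
  rcases E.eq_empty_or_nonempty with rfl | ⟨ξ₀, hξ₀⟩
  · simp
  set φ := Int.castRingHom (ZMod q)
  have hev : ∀ (g : MvPolynomial (Fin (n + 1)) ℤ) (ξ : Fin (n + 1) → ℤ),
      eval (fun k => (ξ k : ZMod q)) (map φ g) = ((eval ξ g : ℤ) : ZMod q) := by
    intro g ξ
    have := eval_map φ (fun k => (ξ k : ZMod q)) g
    rw [this]
    have h2 := eval₂_comp_left φ (RingHom.id ℤ) ξ g
    simp only [RingHom.comp_id] at h2
    exact h2.symm
  have hne : map φ f ≠ 0 := by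
    intro h0
    have h1 := hev (pderiv 0 f) ξ₀
    rw [← pderiv_map, h0, map_zero, map_zero] at h1
    exact (hE ξ₀ hξ₀).2 ((ZMod.intCast_zmod_eq_zero_iff_dvd _ _).mp h1.symm)
  have h1 := card_zeros_le_of_subset_piFinset hne ((totalDegree_map_le_totalDegree _ _).trans hf) Finset.univ
    (E.image fun ξ k => (ξ k : ZMod q)) (by
      intro x hx
      obtain ⟨ξ, hξ, rfl⟩ := Finset.mem_image.mp hx
      exact ⟨by rw [hev, (ZMod.intCast_zmod_eq_zero_iff_dvd _ _).mpr (hE ξ hξ).1], fun i => Finset.mem_univ _⟩)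
  rw [Finset.card_univ, ZMod.card] at h1
  refine le_trans (Finset.card_le_card_of_injOn (fun x k => ((x k : ℤ) : ZMod q)) ?_ ?_) h1
  · intro x hx
    obtain ⟨ξ, hξ, rfl⟩ := Finset.mem_image.mp hx
    refine Finset.mem_image.mpr ⟨ξ, hξ, ?_⟩
    funext k
    simp
  · intro x hx x' hx' h
    obtain ⟨ξ, hξ, rfl⟩ := Finset.mem_image.mp hx
    obtain ⟨ξ', hξ', rfl⟩ := Finset.mem_image.mp hx'
    funext k
    have := congrFun h k
    have h3 := (ZMod.intCast_eq_intCast_iff' _ _ _).mp this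
    simpa using h3

theorem card_image_residueKey_le {p : ℕ → ℕ} (hp : ∀ i, (p i).Prime) {n d a t : ℕ}
    {f : MvPolynomial (Fin (n + 1)) ℤ}
    (hf : f.totalDegree ≤ d) (E : Finset (Fin (n + 1) → ℤ))
    (hE : ∀ ξ ∈ E, eval ξ f = 0 ∧ ∀ i < t, ¬ (p (a + i) : ℤ) ∣ eval ξ (pderiv 0 f)) :
    (E.image (residueKey p a t)).card ≤ ∏ i : Fin t, d * p (a + i) ^ n := by
  have hsub : E.image (residueKey p a t) ⊆
      Fintype.piFinset fun i : Fin t => E.image fun (ξ : Fin (n + 1) → ℤ) k => ξ k % (p (a + i) : ℤ) := by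
    intro x hx
    obtain ⟨ξ, hξ, rfl⟩ := Finset.mem_image.mp hx
    exact Fintype.mem_piFinset.mpr fun i => Finset.mem_image_of_mem _ hξ
  refine (Finset.card_le_card hsub).trans ?_
  rw [Fintype.card_piFinset]
  exact Finset.prod_le_prod' fun i _ => card_image_emod_le (hp _) hf E
    fun ξ hξ => ⟨by rw [(hE ξ hξ).1]; exact dvd_zero _, (hE ξ hξ).2 i i.2⟩

theorem degree_le_of_mem_support {σ R : Type*} [CommSemiring R] {g : MvPolynomial σ R}
    {D : ℕ} (hD : g.totalDegree ≤ D) {m : σ →₀ ℕ} (hm : m ∈ g.support) : m.degree ≤ D :=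
  (le_totalDegree hm).trans hD

theorem totalDegree_le_of_degree_le {σ R : Type*} [CommSemiring R] {g : MvPolynomial σ R}
    {D : ℕ} (h : ∀ m ∈ g.support, m.degree ≤ D) : g.totalDegree ≤ D :=
  Finset.sup_le h

theorem card_support_le {R : Type*} [CommSemiring R] {n D : ℕ} (g : MvPolynomial (Fin n) R)
    (hD : g.totalDegree ≤ D) : g.support.card ≤ (D + 1) ^ n := by
  have h : g.support.card ≤ (Finset.univ : Finset (Fin n → Fin (D + 1))).card := by
    refine Finset.card_le_card_of_injOn (fun m i => Fin.ofNat (D + 1) (m i))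
      (fun _ _ => Finset.mem_coe.mpr (Finset.mem_univ _)) ?_
    intro m hm m' hm' h
    have hle : ∀ m ∈ g.support, ∀ i, m i ≤ D := fun m hm i =>
      (monomial_le_degreeOf i hm).trans ((degreeOf_le_totalDegree g i).trans hD)
    ext i
    have h1 := congrArg Fin.val (congrFun h i)
    simp only [Fin.ofNat] at h1
    rwa [Nat.mod_eq_of_lt (Nat.lt_succ_of_le (hle m hm i)),
      Nat.mod_eq_of_lt (Nat.lt_succ_of_le (hle m' hm' i))] at h1
  simpa using h

theorem abs_prod_pow_le {n D N : ℕ} (hN : 1 ≤ N) {ξ : Fin n → ℤ} (hξ : ∀ i, |ξ i| ≤ N)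
    {m : Fin n →₀ ℕ} (hm : m.degree ≤ D) : |∏ i, ξ i ^ m i| ≤ (N : ℤ) ^ D := by
  rw [Finset.abs_prod]
  calc ∏ i, |ξ i ^ m i| ≤ ∏ i, (N : ℤ) ^ m i :=
        Finset.prod_le_prod (fun _ _ => abs_nonneg _) fun i _ => by
          rw [abs_pow]
          exact pow_le_pow_left₀ (abs_nonneg _) (hξ i) _
    _ = (N : ℤ) ^ m.degree := by rw [Finset.prod_pow_eq_pow_sum, Finsupp.degree_eq_sum]
    _ ≤ (N : ℤ) ^ D := pow_le_pow_right₀ (by exact_mod_cast hN) hm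

theorem abs_eval_le {n D N H : ℕ} (hN : 1 ≤ N) {g : MvPolynomial (Fin n) ℤ}
    (hD : g.totalDegree ≤ D) (hH : ∀ m, |coeff m g| ≤ H) {ξ : Fin n → ℤ}
    (hξ : ∀ i, |ξ i| ≤ N) : |eval ξ g| ≤ (((D + 1) ^ n * H * N ^ D : ℕ) : ℤ) := by
  rw [eval_eq']
  refine (Finset.abs_sum_le_sum_abs _ _).trans ?_
  calc ∑ m ∈ g.support, |coeff m g * ∏ i, ξ i ^ m i|
      ≤ ∑ _m ∈ g.support, (H : ℤ) * (N : ℤ) ^ D := by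
        refine Finset.sum_le_sum fun m hm => ?_
        rw [abs_mul]
        refine mul_le_mul (hH m) (abs_prod_pow_le hN hξ ?_) (abs_nonneg _) (by positivity)
        exact degree_le_of_mem_support hD hm
    _ = (g.support.card : ℤ) * ((H : ℤ) * (N : ℤ) ^ D) := by simp
    _ ≤ ((D + 1) ^ n : ℕ) * ((H : ℤ) * (N : ℤ) ^ D) := by
        refine mul_le_mul_of_nonneg_right ?_ (by positivity)
        exact_mod_cast card_support_le g hD
    _ = _ := by push_cast; ring

theorem totalDegree_pderiv_le {σ R : Type*} [CommSemiring R] (i : σ) (g : MvPolynomial σ R) :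
    (pderiv i g).totalDegree ≤ g.totalDegree := by
  refine totalDegree_le_of_degree_le fun m hm => ?_
  rw [mem_support_iff, coeff_pderiv] at hm
  have h1 := degree_le_of_mem_support le_rfl (mem_support_iff.mpr (left_ne_zero_of_mul hm))
  rw [map_add] at h1
  omega

theorem abs_coeff_pderiv_le {n D H : ℕ} {g : MvPolynomial (Fin n) ℤ}
    (hD : g.totalDegree ≤ D) (hH : ∀ m, |coeff m g| ≤ H) (i : Fin n) (m : Fin n →₀ ℕ) :
    |coeff m (pderiv i g)| ≤ ((D * H : ℕ) : ℤ) := by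
  rw [coeff_pderiv]
  by_cases h : coeff (m + Finsupp.single i 1) g = 0
  · simp [h]
    positivity
  · have h1 := (monomial_le_degreeOf i (mem_support_iff.mpr h)).trans
      ((degreeOf_le_totalDegree g i).trans hD)
    simp only [Finsupp.coe_add, Pi.add_apply, Finsupp.single_eq_same] at h1
    rw [abs_mul]
    have h2 : |((m i : ℤ) + 1)| ≤ D := by
      rw [abs_of_nonneg (by positivity)]
      exact_mod_cast h1
    push_cast
    rw [mul_comm]
    exact mul_le_mul h2 (hH _) (abs_nonneg _) (by positivity)

theorem iterate_pderiv_bounds {n D H : ℕ} {g : MvPolynomial (Fin n) ℤ}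
    (hD : g.totalDegree ≤ D) (hH : ∀ m, |coeff m g| ≤ H) (i : Fin n) (k : ℕ) :
    ((pderiv i)^[k] g).totalDegree ≤ D ∧
      ∀ m, |coeff m ((pderiv i)^[k] g)| ≤ ((D ^ k * H : ℕ) : ℤ) := by
  induction k with
  | zero => simpa using ⟨hD, hH⟩
  | succ k ih =>
    rw [Function.iterate_succ_apply']
    refine ⟨(totalDegree_pderiv_le i _).trans ih.1, fun m => ?_⟩
    have := abs_coeff_pderiv_le ih.1 ih.2 i m
    rwa [pow_succ', mul_assoc]

theorem exists_poly_of_det_eq_zero {n s D N : ℕ} (hN : 1 ≤ N) (m : Fin s → (Fin n →₀ ℕ))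
    (hm : Function.Injective m) (hD : ∀ j, (m j).degree ≤ D) (E : Set (Fin n → ℤ))
    (hE : ∀ ξ ∈ E, ∀ i, |ξ i| ≤ N)
    (hdet : ∀ rows : Fin s → (Fin n → ℤ), (∀ i, rows i ∈ E) →
      Matrix.det (Matrix.of fun i j => eval (rows i) (monomial (m j) (1 : ℤ))) = 0) :
    ∃ g : MvPolynomial (Fin n) ℤ, g ≠ 0 ∧ (∀ k ∈ g.support, ∃ j, k = m j) ∧
      (∀ k, |coeff k g| ≤ (s.factorial * (N ^ D) ^ s : ℕ)) ∧ ∀ ξ ∈ E, eval ξ g = 0 := by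
  classical
  obtain ⟨w, hw0, hwb, hw⟩ := exists_small_kernel_vector
    (fun (ξ : E) j => eval ξ.1 (monomial (m j) (1 : ℤ))) (N ^ D) (Nat.one_le_pow _ _ hN)
    (by
      intro ξ j
      simp only [eval_monomial, one_mul, Nat.cast_pow, Finsupp.prod_fintype, pow_zero, implies_true]
      exact abs_prod_pow_le hN (hE ξ.1 ξ.2) (hD j))
    (fun rows => hdet (fun i => (rows i).1) fun i => (rows i).2)
  have hcoeff : ∀ k, coeff k (∑ j, monomial (m j) (w j)) = ∑ j, if m j = k then w j else 0 := by
    intro k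
    simp [coeff_sum, coeff_monomial]
  have hcoeff' : ∀ j, coeff (m j) (∑ j, monomial (m j) (w j)) = w j := by
    intro j
    rw [hcoeff, Finset.sum_eq_single j]
    · simp
    · intro b _ hb
      rw [if_neg fun h => hb (hm h)]
    · simp
  have hsupp : ∀ k, (¬ ∃ j, k = m j) → coeff k (∑ j, monomial (m j) (w j)) = 0 := by
    intro k hk
    rw [hcoeff]
    exact Finset.sum_eq_zero fun j _ => if_neg fun h => hk ⟨j, h.symm⟩
  refine ⟨∑ j, monomial (m j) (w j), ?_, ?_, ?_, ?_⟩
  · intro h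
    apply hw0
    funext j
    rw [← hcoeff' j, h, coeff_zero, Pi.zero_apply]
  · intro k hk
    by_contra hcon
    exact mem_support_iff.mp hk (hsupp k hcon)
  · intro k
    by_cases hk : ∃ j, k = m j
    · obtain ⟨j, rfl⟩ := hk
      rw [hcoeff']
      exact hwb j
    · rw [hsupp k hk, abs_zero]
      positivity
  · intro ξ hξ
    rw [map_sum, ← hw ⟨ξ, hξ⟩]
    refine Finset.sum_congr rfl fun j _ => ?_
    simp [eval_monomial, mul_comm]

/-- If some nonzero polynomial of degree at most `D` over a domain of characteristic zero vanishes
on a set of integral points, then so does one with small integral coefficients. -/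
theorem exists_small_poly {R : Type*} [CommRing R] [IsDomain R] [CharZero R] {n D N : ℕ}
    (hN : 1 ≤ N) {r : MvPolynomial (Fin n) R} (hr : r ≠ 0) (hrD : r.totalDegree ≤ D)
    (E : Set (Fin n → ℤ)) (hE : ∀ ξ ∈ E, (∀ i, |ξ i| ≤ N) ∧ eval (fun i => (ξ i : R)) r = 0) :
    ∃ g : MvPolynomial (Fin n) ℤ, g ≠ 0 ∧ g.totalDegree ≤ D ∧
      (∀ k, |coeff k g| ≤ (((D + 1) ^ n).factorial * N ^ (D * (D + 1) ^ n) : ℕ)) ∧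
      ∀ ξ ∈ E, eval ξ g = 0 := by
  classical
  have hs := card_support_le r hrD
  let e := r.support.equivFin
  let m : Fin r.support.card → (Fin n →₀ ℕ) := fun j => (e.symm j).1
  have hm : Function.Injective m := Subtype.val_injective.comp e.symm.injective
  have hmD : ∀ j, (m j).degree ≤ D := fun j => degree_le_of_mem_support hrD (e.symm j).2
  obtain ⟨g, hg0, hgs, hgh, hgE⟩ := exists_poly_of_det_eq_zero hN m hm hmD E
    (fun ξ hξ => (hE ξ hξ).1) (by
      intro rows hrows
      apply Int.cast_injective (α := R)
      rw [Int.cast_zero, ← eq_intCast (Int.castRingHom R), RingHom.map_det]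
      rw [← Matrix.exists_mulVec_eq_zero_iff]
      refine ⟨fun j => coeff (m j) r, ?_, ?_⟩
      · intro h
        obtain ⟨k, hk⟩ := support_nonempty.mpr hr
        have := congrFun h (e ⟨k, hk⟩)
        simp only [m, Equiv.symm_apply_apply, Pi.zero_apply] at this
        exact mem_support_iff.mp hk this
      · funext i
        have h1 := (hE _ (hrows i)).2
        rw [eval_eq'] at h1
        rw [Pi.zero_apply, ← h1, ← Finset.sum_coe_sort, ← e.symm.sum_comp]
        simp only [Matrix.mulVec, dotProduct]
        refine Finset.sum_congr rfl fun j _ => ?_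
        simp only [RingHom.mapMatrix_apply, Matrix.map_apply, Matrix.of_apply, eval_monomial,
          one_mul, Finsupp.prod_fintype, pow_zero, implies_true,
          Int.coe_castRingHom, m]
        push_cast
        ring)
  refine ⟨g, hg0, totalDegree_le_of_degree_le ?_, ?_, hgE⟩
  · intro k hk
    obtain ⟨j, rfl⟩ := hgs k hk
    exact hmD j
  · intro k
    refine (hgh k).trans ?_
    have : r.support.card.factorial * (N ^ D) ^ r.support.card
        ≤ ((D + 1) ^ n).factorial * N ^ (D * (D + 1) ^ n) := by
      refine Nat.mul_le_mul (Nat.factorial_le hs) ?_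
      rw [← pow_mul]
      exact Nat.pow_le_pow_right hN (Nat.mul_le_mul_left _ hs)
    exact_mod_cast this

theorem abs_det_monomial_le {n s N : ℕ} (m : Fin s → (Fin n →₀ ℕ)) (η : Fin s → Fin n → ℤ)
    (hN : 1 ≤ N) (hη : ∀ i k, |η i k| ≤ N) :
    |Matrix.det (Matrix.of fun i j => eval (η i) (monomial (m j) (1 : ℤ)))| ≤
      ((s.factorial * N ^ (∑ j, (m j).degree) : ℕ) : ℤ) := by
  rw [Matrix.det_apply]
  refine (Finset.abs_sum_le_sum_abs _ _).trans ?_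
  calc _ ≤ ∑ _σ : Equiv.Perm (Fin s), (N : ℤ) ^ (∑ j, (m j).degree) := by
        refine Finset.sum_le_sum fun σ _ => ?_
        have hs : ∀ x : ℤ, |Equiv.Perm.sign σ • x| = |x| := by
          intro x
          rcases Int.units_eq_one_or (Equiv.Perm.sign σ) with h | h <;> simp [h]
        rw [hs, Finset.abs_prod, ← Finset.prod_pow_eq_pow_sum]
        refine Finset.prod_le_prod (fun _ _ => abs_nonneg _) fun j _ => ?_
        simp only [Matrix.of_apply, eval_monomial, one_mul, Finsupp.prod_fintype, pow_zero,
          implies_true]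
        exact abs_prod_pow_le hN (hη _) le_rfl
    _ = _ := by
        simp [Fintype.card_perm]

theorem det_eq_zero_of_residue_class {n s N : ℕ} (q : ℤ) (e W : ℕ)
    (G : MvPolynomial (Fin (n + 1)) ℤ) (ξ : Fin (n + 1) → ℤ)
    (hu : IsCoprime (eval ξ (pderiv 0 G)) q) (m : Fin s → (Fin (n + 1) →₀ ℕ))
    (hW : ∑ j, (m j).degree ≤ W) (η : Fin s → Fin (n + 1) → ℤ)
    (hη : ∀ i k, q ∣ η i k - ξ k) (hG : ∀ i, eval (η i) G = 0)
    (hN : 1 ≤ N) (hsize : ∀ i k, |η i k| ≤ N)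
    (he : ∀ β : Fin s → (Fin n →₀ ℕ), Function.Injective β → e ≤ ∑ j, (β j).degree)
    (hbig : ((s.factorial * N ^ W : ℕ) : ℤ) < q ^ e) :
    Matrix.det (Matrix.of fun i j => eval (η i) (monomial (m j) (1 : ℤ))) = 0 := by
  have h1 := pow_dvd_det_of_residue_class q e e (Nat.le_succ e) G ξ hu
    (fun j => monomial (m j) (1 : ℤ)) η hη (fun i => by rw [hG i]; exact dvd_zero _) he
  refine Int.eq_zero_of_abs_lt_dvd h1 (lt_of_le_of_lt ?_ hbig)
  refine (abs_det_monomial_le m η hN hsize).trans ?_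
  have : s.factorial * N ^ (∑ j, (m j).degree) ≤ s.factorial * N ^ W :=
    Nat.mul_le_mul_left _ (Nat.pow_le_pow_right hN hW)
  exact_mod_cast this

/-- Auxiliary polynomial on a plane curve, with prescribed monomials. -/
theorem exists_curve_aux {s e W τ t Y N : ℕ} (q : ℤ) (hq : (Y : ℤ) ^ t ≤ q) (hY : 1 ≤ Y)
    (hN1 : 1 ≤ N) (hN : N ≤ 2 * Y ^ τ)
    (G : MvPolynomial (Fin 2) ℤ) (ξ : Fin 2 → ℤ) (hu : IsCoprime (eval ξ (pderiv 0 G)) q)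
    (m : Fin s → (Fin 2 →₀ ℕ)) (hm : Function.Injective m) (hW : ∑ j, (m j).degree ≤ W)
    (he : 2 * e ≤ s * (s - 1)) (hte : τ * W + 1 ≤ t * e) (hYs : s.factorial * 2 ^ W < Y)
    (E : Set (Fin 2 → ℤ))
    (hE : ∀ η ∈ E, eval η G = 0 ∧ (∀ i, |η i| ≤ N) ∧ ∀ i, q ∣ η i - ξ i) :
    ∃ h : MvPolynomial (Fin 2) ℤ, h ≠ 0 ∧ (∀ k ∈ h.support, ∃ j, k = m j) ∧
      ∀ η ∈ E, eval η h = 0 := by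
  obtain ⟨h, h0, hs, -, hE'⟩ := exists_poly_of_det_eq_zero (D := W) hN1 m hm
    (fun j => (Finset.single_le_sum (f := fun j => (m j).degree) (fun _ _ => Nat.zero_le _)
      (Finset.mem_univ j)).trans hW) E (fun η hη => (hE η hη).2.1) (by
      intro rows hrows
      refine det_eq_zero_of_residue_class (n := 1) (N := N) q e W G ξ hu m hW rows
        (fun i => (hE _ (hrows i)).2.2) (fun i => (hE _ (hrows i)).1) hN1
        (fun i => (hE _ (hrows i)).2.1) ?_ ?_
      · intro β hβ
        have := le_sum_degree_of_injective_one β hβ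
        omega
      · have h1 : s.factorial * N ^ W < Y ^ (t * e) :=
          calc s.factorial * N ^ W ≤ s.factorial * (2 * Y ^ τ) ^ W :=
                Nat.mul_le_mul_left _ (Nat.pow_le_pow_left hN W)
            _ = (s.factorial * 2 ^ W) * Y ^ (τ * W) := by rw [mul_pow, ← pow_mul]; ring
            _ < Y * Y ^ (τ * W) := Nat.mul_lt_mul_of_pos_right hYs (by positivity)
            _ = Y ^ (τ * W + 1) := by ring
            _ ≤ Y ^ (t * e) := Nat.pow_le_pow_right hY hte
        calc ((s.factorial * N ^ W : ℕ) : ℤ) < ((Y ^ (t * e) : ℕ) : ℤ) := by exact_mod_cast h1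
          _ = ((Y : ℤ) ^ t) ^ e := by push_cast; rw [pow_mul]
          _ ≤ q ^ e := pow_le_pow_left₀ (by positivity) hq e)
  exact ⟨h, h0, hs, hE'⟩

/-- Index set for the monomials `z ^ c * x ^ a * y ^ b` with `c < D` and `a + b ≤ k`. -/
abbrev BoxTriangle (D k : ℕ) : Type := Fin D × (Σ j : Fin (k + 1), Fin (j + 1))

/-- The exponent attached to an element of `BoxTriangle D k`. -/
noncomputable def BoxTriangle.exponent {D k : ℕ} (i : BoxTriangle D k) : Fin 3 →₀ ℕ :=
  Finsupp.equivFunOnFinite.symm ![(i.1 : ℕ), (i.2.1 : ℕ) - (i.2.2 : ℕ), (i.2.2 : ℕ)]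

theorem BoxTriangle.exponent_injective {D k : ℕ} :
    Function.Injective (BoxTriangle.exponent (D := D) (k := k)) := by
  rintro ⟨c, ⟨j, b⟩⟩ ⟨c', ⟨j', b'⟩⟩ h
  have h' := Finsupp.equivFunOnFinite.symm.injective h
  have h0 := congrFun h' 0
  have h1 := congrFun h' 1
  have h2 := congrFun h' 2
  simp at h0 h1 h2
  have hb := b.2
  have hb' := b'.2
  have hj : j = j' := Fin.ext (by omega)
  subst hj
  have hc : c = c' := Fin.ext (by omega)
  have hbb : b = b' := Fin.ext (by omega)
  rw [hc, hbb]

theorem BoxTriangle.degree_exponent {D k : ℕ} (i : BoxTriangle D k) :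
    (BoxTriangle.exponent i).degree = i.1 + i.2.1 := by
  have h2 := i.2.2.2
  rw [Finsupp.degree_eq_sum, Fin.sum_univ_three]
  simp [BoxTriangle.exponent]
  omega

theorem BoxTriangle.two_mul_card (D k : ℕ) :
    2 * Fintype.card (BoxTriangle D k) = D * (k + 1) * (k + 2) := by
  have h : ∀ k : ℕ, 2 * ∑ j : Fin (k + 1), ((j : ℕ) + 1) = (k + 1) * (k + 2) := by
    intro k
    rw [Fin.sum_univ_eq_sum_range (fun j => j + 1)]
    induction k with
    | zero => simp
    | succ k ih => rw [Finset.sum_range_succ, mul_add, ih]; ring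
  rw [Fintype.card_prod, Fintype.card_sigma]
  simp only [Fintype.card_fin]
  have := h k
  rw [mul_left_comm, this]
  ring

theorem BoxTriangle.sum_degree (D k : ℕ) :
    12 * ∑ i : BoxTriangle D k, (BoxTriangle.exponent i).degree
      = 4 * D * k * (k + 1) * (k + 2) + 3 * (D * (D - 1)) * (k + 1) * (k + 2) := by
  simp only [BoxTriangle.degree_exponent]
  rw [Fintype.sum_prod_type]
  have h1 : ∀ c : ℕ, ∀ k : ℕ, 6 * ∑ x : (Σ j : Fin (k + 1), Fin (j + 1)), (c + (x.1 : ℕ))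
      = 3 * c * (k + 1) * (k + 2) + 2 * k * (k + 1) * (k + 2) := by
    intro c k
    rw [Fintype.sum_sigma]
    simp only [Finset.sum_const, Finset.card_univ, Fintype.card_fin, smul_eq_mul]
    rw [Fin.sum_univ_eq_sum_range (fun j => (j + 1) * (c + j))]
    induction k with
    | zero => simp; ring
    | succ k ih => rw [Finset.sum_range_succ, mul_add, ih]; ring
  calc 12 * ∑ c : Fin D, ∑ x : (Σ j : Fin (k + 1), Fin (j + 1)), ((c : ℕ) + (x.1 : ℕ))
      = 2 * ∑ c : Fin D, 6 * ∑ x : (Σ j : Fin (k + 1), Fin (j + 1)), ((c : ℕ) + (x.1 : ℕ)) := by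
        rw [← Finset.mul_sum]; ring
    _ = 2 * ∑ c : Fin D, (3 * (c : ℕ) * (k + 1) * (k + 2) + 2 * k * (k + 1) * (k + 2)) := by
        simp only [h1]
    _ = 3 * ((∑ c ∈ Finset.range D, c) * 2) * (k + 1) * (k + 2)
        + 4 * D * k * (k + 1) * (k + 2) := by
        rw [Fin.sum_univ_eq_sum_range (fun c => 3 * c * (k + 1) * (k + 2)
          + 2 * k * (k + 1) * (k + 2)), Finset.sum_add_distrib]
        have h3 : ∑ c ∈ Finset.range D, 3 * c = 3 * ∑ c ∈ Finset.range D, c :=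
          (Finset.mul_sum _ _ _).symm
        simp only [← Finset.sum_mul, Finset.sum_const, Finset.card_range, smul_eq_mul, h3]
        ring
    _ = _ := by rw [Finset.sum_range_id_mul_two]; ring

theorem not_dvd_of_degreeOf_lt {R σ : Type*} [CommRing R] [IsDomain R] {f g : MvPolynomial σ R}
    (hf : f ≠ 0) (hg : g ≠ 0) (i : σ) (h : g.degreeOf i < f.degreeOf i) : ¬ f ∣ g := by
  rintro ⟨c, rfl⟩
  rw [degreeOf_mul_eq hf (right_ne_zero_of_mul hg)] at h
  omega

theorem le_degreeOf_of_coeff_ne_zero {R σ : Type*} [CommSemiring R] {f : MvPolynomial σ R} {i : σ}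
    {d : ℕ} (h : coeff (Finsupp.single i d) f ≠ 0) : d ≤ f.degreeOf i := by
  have := monomial_le_degreeOf i (mem_support_iff.mpr h)
  simpa using this

/-- Numerical conditions under which the determinant method produces an auxiliary polynomial of
degree less than `D` in the first variable. -/
structure SurfaceParams (D k τ t s e W : ℕ) : Prop where
  card : 2 * s = D * (k + 1) * (k + 2)
  weight : 12 * W = 4 * D * k * (k + 1) * (k + 2) + 3 * (D * (D - 1)) * (k + 1) * (k + 2)
  exponent : 6 * e + 2 * k * (2 * k + 1) * (2 * k + 2) ≤ 6 * (2 * k * s)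
  bound : τ * W + 1 ≤ t * e

theorem exists_surface_aux {D k τ t s e W Y : ℕ} (hpar : SurfaceParams D k τ t s e W)
    (hY : 1 ≤ Y) (hYs : s.factorial < Y) (q : ℤ) (hq : (Y : ℤ) ^ t ≤ q)
    (f : MvPolynomial (Fin 3) ℤ) (ξ : Fin 3 → ℤ) (hu : IsCoprime (eval ξ (pderiv 0 f)) q)
    (E : Set (Fin 3 → ℤ))
    (hE : ∀ η ∈ E, eval η f = 0 ∧ (∀ i, |η i| ≤ (Y ^ τ : ℕ)) ∧ ∀ i, q ∣ η i - ξ i) :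
    ∃ g : MvPolynomial (Fin 3) ℤ, g ≠ 0 ∧ g.totalDegree ≤ D + k ∧ (0 < D → g.degreeOf 0 < D) ∧
      ∀ η ∈ E, eval η g = 0 := by
  have hcard : Fintype.card (BoxTriangle D k) = s := by
    have h1 := BoxTriangle.two_mul_card D k
    have h2 := hpar.card
    omega
  let ε : Fin s ≃ BoxTriangle D k := (Fintype.equivFinOfCardEq hcard).symm
  let m : Fin s → (Fin 3 →₀ ℕ) := fun j => BoxTriangle.exponent (ε j)
  have hm : Function.Injective m := BoxTriangle.exponent_injective.comp ε.injective
  have hW : ∑ j, (m j).degree ≤ W := by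
    have h1 := BoxTriangle.sum_degree D k
    have h2 := hpar.weight
    have h3 : ∑ j, (m j).degree = ∑ i : BoxTriangle D k, (BoxTriangle.exponent i).degree :=
      ε.sum_comp fun i => (BoxTriangle.exponent i).degree
    omega
  have hN1 : 1 ≤ Y ^ τ := Nat.one_le_pow _ _ hY
  have hmdeg : ∀ j, (m j).degree ≤ D + k := by
    intro j
    rw [BoxTriangle.degree_exponent]
    have := (ε j).1.2
    have := (ε j).2.1.2
    omega
  obtain ⟨g, g0, hs, -, hE'⟩ := exists_poly_of_det_eq_zero (D := D + k) hN1 m hm hmdeg E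
    (fun η hη => (hE η hη).2.1) (by
      intro rows hrows
      refine det_eq_zero_of_residue_class (n := 2) (N := Y ^ τ) q e W f ξ hu m hW rows
        (fun i => (hE _ (hrows i)).2.2) (fun i => (hE _ (hrows i)).1) hN1
        (fun i => (hE _ (hrows i)).2.1) ?_ ?_
      · intro β hβ
        have h1 := le_sum_degree_of_injective_two (e := 2 * k) β hβ
        have h2 := hpar.exponent
        omega
      · have h1 : s.factorial * (Y ^ τ) ^ W < Y ^ (t * e) :=
          calc s.factorial * (Y ^ τ) ^ W = s.factorial * Y ^ (τ * W) := by rw [← pow_mul]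
            _ < Y * Y ^ (τ * W) := Nat.mul_lt_mul_of_pos_right hYs (by positivity)
            _ = Y ^ (τ * W + 1) := by ring
            _ ≤ Y ^ (t * e) := Nat.pow_le_pow_right hY hpar.bound
        calc ((s.factorial * (Y ^ τ) ^ W : ℕ) : ℤ) < ((Y ^ (t * e) : ℕ) : ℤ) := by
              exact_mod_cast h1
          _ = ((Y : ℤ) ^ t) ^ e := by push_cast; rw [pow_mul]
          _ ≤ q ^ e := pow_le_pow_left₀ (by positivity) hq e)
  refine ⟨g, g0, totalDegree_le_of_degree_le ?_, ?_, hE'⟩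
  · intro κ hκ
    obtain ⟨j, rfl⟩ := hs κ hκ
    exact hmdeg j
  · intro hD
    rw [degreeOf_lt_iff hD]
    intro κ hκ
    obtain ⟨j, rfl⟩ := hs κ hκ
    simp [m, BoxTriangle.exponent]

theorem eval_map_intCast {R σ : Type*} [CommRing R] (g : MvPolynomial σ ℤ) (ξ : σ → ℤ) :
    eval (fun i => (ξ i : R)) (map (Int.castRingHom R) g) = ((eval ξ g : ℤ) : R) := by
  have h := eval_map (Int.castRingHom R) (fun i => (ξ i : R)) g
  rw [h]
  have h2 := eval₂_comp_left (Int.castRingHom R) (RingHom.id ℤ) ξ g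
  simp only [RingHom.comp_id] at h2
  exact h2.symm

/-- Points of an integral surface in a single residue class project to a plane curve of bounded
degree and height. -/
theorem exists_curve_of_class {R : Type*} [CommRing R] [IsDomain R] [CharZero R]
    {d D k τ t s e W Y : ℕ} (hpar : SurfaceParams D k τ t s e W) (hD : 0 < D) (hDd : D ≤ d)
    (hY : 1 ≤ Y) (hYs : s.factorial < Y) (q : ℤ) (hq : (Y : ℤ) ^ t ≤ q)
    (f : MvPolynomial (Fin 3) ℤ) (hf : Prime (map (Int.castRingHom R) f))
    (hfd : f.totalDegree ≤ d) (hc : coeff (Finsupp.single 0 d) f ≠ 0)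
    (ξ : Fin 3 → ℤ) (hu : IsCoprime (eval ξ (pderiv 0 f)) q) (E : Set (Fin 3 → ℤ))
    (hE : ∀ η ∈ E, eval η f = 0 ∧ (∀ i, |η i| ≤ (Y ^ τ : ℕ)) ∧ ∀ i, q ∣ η i - ξ i)
    (L : ℕ) (hL : 2 * (d + k) * (d + k) + (d + k) = L) :
    ∃ A : MvPolynomial (Fin 2) ℤ, A ≠ 0 ∧ A.totalDegree ≤ L ∧
      (∀ m, |coeff m A| ≤ (((L + 1) ^ 2).factorial * (Y ^ τ) ^ (L * (L + 1) ^ 2) : ℕ)) ∧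
      ∀ η ∈ E, eval (Fin.tail η) A = 0 := by
  obtain ⟨g, g0, hgdeg, hg0, hgE⟩ := exists_surface_aux hpar hY hYs q hq f ξ hu E hE
  have hinj : Function.Injective (Int.castRingHom R) := Int.cast_injective
  have hgK : map (Int.castRingHom R) g ≠ 0 := fun h =>
    g0 (map_injective _ hinj (by rw [h, map_zero]))
  have hnd : ¬ map (Int.castRingHom R) f ∣ map (Int.castRingHom R) g := by
    refine not_dvd_of_degreeOf_lt hf.ne_zero hgK 0 ?_
    have h1 : d ≤ (map (Int.castRingHom R) f).degreeOf 0 := by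
      refine le_degreeOf_of_coeff_ne_zero ?_
      rw [coeff_map]
      exact fun h => hc (hinj (by rw [h, map_zero]))
    have h2 : (map (Int.castRingHom R) g).degreeOf 0 ≤ g.degreeOf 0 := by
      rw [degreeOf_eq_sup, degreeOf_eq_sup]
      exact Finset.sup_mono (support_map_subset _ _)
    have := hg0 hD
    omega
  have hfd' : (map (Int.castRingHom R) f).totalDegree ≤ d + k :=
    (totalDegree_map_le_totalDegree _ _).trans (hfd.trans (Nat.le_add_right _ _))
  have hgd' : (map (Int.castRingHom R) g).totalDegree ≤ d + k :=
    (totalDegree_map_le_totalDegree _ _).trans (hgdeg.trans (by omega))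
  obtain ⟨r, r0, hrL, hr⟩ := exists_elimination hf hnd hfd' hgd'
  obtain ⟨A, A0, hA, hAH, hAE⟩ := exists_small_poly (N := Y ^ τ) (Nat.one_le_pow _ _ hY) r0
    (hrL.trans hL.le) ((fun η => Fin.tail η) '' E) (by
      rintro _ ⟨η, hη, rfl⟩
      refine ⟨fun i => (hE η hη).2.1 i.succ, ?_⟩
      have h1 := hr (fun i => (η i : R)) (by rw [eval_map_intCast, (hE η hη).1, Int.cast_zero])
        (by rw [eval_map_intCast, hgE η hη, Int.cast_zero])
      exact h1)
  exact ⟨A, A0, hA, hAH, fun η hη => hAE _ ⟨η, hη, rfl⟩⟩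

theorem eval_ne_zero_of_totalDegree_eq_zero {σ R : Type*} [CommRing R] {P : MvPolynomial σ R}
    (hP : P ≠ 0) (h : P.totalDegree = 0) (x : σ → R) : eval x P ≠ 0 := by
  rw [totalDegree_eq_zero_iff_eq_C] at h
  rw [h, eval_C]
  intro h0
  rw [h0, map_zero] at h
  exact hP h

/-- The nonconstant irreducible factors of a polynomial, up to associates. -/
theorem exists_finset_irreducible_factors {σ : Type*} {A : MvPolynomial σ ℤ} (hA : A ≠ 0) :
    ∃ T : Finset (MvPolynomial σ ℤ), T.card ≤ A.totalDegree ∧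
      (∀ P ∈ T, Irreducible P ∧ P ∣ A) ∧ (∀ x, eval x A = 0 → ∃ P ∈ T, eval x P = 0) ∧
      ∀ P, Irreducible P → P ∣ A → 1 ≤ P.totalDegree → ∃ P' ∈ T, Associated P P' := by
  classical
  induction A using WfDvdMonoid.induction_on_irreducible with
  | zero => exact absurd rfl hA
  | unit u hu =>
    refine ⟨∅, by simp, by simp, ?_, ?_⟩
    · intro x hx
      have := hu.map (eval x)
      rw [hx] at this
      exact absurd this (by simp)
    · intro P hP hPu
      exact absurd (isUnit_of_dvd_unit hPu hu) hP.not_isUnit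
  | mul a i ha hi ih =>
    obtain ⟨T, hTc, hT, hTx, hTP⟩ := ih ha
    have hdeg := totalDegree_mul_of_isDomain hi.ne_zero ha
    by_cases h0 : i.totalDegree = 0
    · refine ⟨T, by omega, fun P hP => ⟨(hT P hP).1, (hT P hP).2.mul_left _⟩, ?_, ?_⟩
      · intro x hx
        rw [map_mul] at hx
        exact hTx x ((mul_eq_zero.mp hx).resolve_left
          (eval_ne_zero_of_totalDegree_eq_zero hi.ne_zero h0 x))
      · intro P hP hPd hP1
        rcases hP.prime.dvd_or_dvd hPd with h | h
        · have := totalDegree_le_of_dvd_of_isDomain h hi.ne_zero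
          omega
        · exact hTP P hP h hP1
    · refine ⟨insert i T, (Finset.card_insert_le _ _).trans (by omega), ?_, ?_, ?_⟩
      · intro P hP
        rcases Finset.mem_insert.mp hP with rfl | hP
        · exact ⟨hi, dvd_mul_right _ _⟩
        · exact ⟨(hT P hP).1, (hT P hP).2.mul_left _⟩
      · intro x hx
        rw [map_mul] at hx
        rcases mul_eq_zero.mp hx with h | h
        · exact ⟨i, Finset.mem_insert_self _ _, h⟩
        · obtain ⟨P, hP, hPx⟩ := hTx x h
          exact ⟨P, Finset.mem_insert_of_mem hP, hPx⟩
      · intro P hP hPd hP1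
        rcases hP.prime.dvd_or_dvd hPd with h | h
        · exact ⟨i, Finset.mem_insert_self _ _, (hP.associated_of_dvd hi h)⟩
        · obtain ⟨P', hP', hPP'⟩ := hTP P hP h hP1
          exact ⟨P', Finset.mem_insert_of_mem hP', hPP'⟩

theorem eval_iterate_pderiv_pow_mul {σ R : Type*} [CommRing R] (i : σ) (P : MvPolynomial σ R)
    (x : σ → R) (hx : eval x P = 0) (m : ℕ) (Q : MvPolynomial σ R) :
    eval x ((pderiv i)^[m] (P ^ m * Q)) = m.factorial * eval x (pderiv i P) ^ m * eval x Q := by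
  induction m generalizing Q with
  | zero => simp
  | succ m ih =>
    have h : pderiv i (P ^ (m + 1) * Q) =
        P ^ m * ((m + 1 : ℕ) * pderiv i P * Q + P * pderiv i Q) := by
      rw [Derivation.leibniz, Derivation.leibniz_pow]
      simp only [smul_eq_mul, nsmul_eq_mul, Nat.add_sub_cancel]
      ring
    rw [Function.iterate_succ_apply, h, ih]
    simp only [map_add, map_mul, map_natCast, hx, zero_mul, add_zero, Nat.factorial_succ]
    push_cast
    ring

theorem eval_pderiv_mul_of_eval_eq_zero {σ R : Type*} [CommRing R] (i : σ) {P u : MvPolynomial σ R}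
    {x : σ → R} (hx : eval x P = 0) :
    eval x (pderiv i (P * u)) = eval x (pderiv i P) * eval x u := by
  rw [Derivation.leibniz]
  simp [hx, mul_comm]

/-- A strictly increasing sequence of primes, comparable with `Y`. -/
structure PrimeSequence (Y : ℕ) (p : ℕ → ℕ) : Prop where
  one_le : 1 ≤ Y
  prime : ∀ i, (p i).Prime
  strictMono : StrictMono p
  lt : ∀ i, Y < p i
  le : ∀ i, p i ≤ 2 ^ (i + 1) * Y

theorem card_le_of_class_card_le {p : ℕ → ℕ} {Y n d a t C : ℕ} (hp : PrimeSequence Y p)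
    {f : MvPolynomial (Fin (n + 1)) ℤ} (hf : f.totalDegree ≤ d) (E : Finset (Fin (n + 1) → ℤ))
    (hE : ∀ ξ ∈ E, eval ξ f = 0 ∧ ∀ i < t, ¬ (p (a + i) : ℤ) ∣ eval ξ (pderiv 0 f))
    (hC : ∀ κ, (E.filter fun ξ => residueKey p a t ξ = κ).card ≤ C) :
    E.card ≤ C * (d * 2 ^ ((a + t) * n)) ^ t * Y ^ (n * t) := by
  have h1 := card_image_residueKey_le hp.prime hf E hE
  have h2 := Finset.card_le_mul_card_image (f := residueKey p a t) E C (fun κ _ => hC κ)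
  refine h2.trans ?_
  rw [mul_assoc]
  refine Nat.mul_le_mul_left _ (h1.trans ?_)
  calc ∏ i : Fin t, d * p (a + i) ^ n ≤ ∏ _i : Fin t, (d * 2 ^ ((a + t) * n)) * Y ^ n := by
        refine Finset.prod_le_prod' fun i _ => ?_
        rw [mul_assoc]
        refine Nat.mul_le_mul_left _ ?_
        rw [pow_mul, ← mul_pow]
        refine Nat.pow_le_pow_left ((hp.le _).trans (Nat.mul_le_mul_right _ ?_)) _
        exact Nat.pow_le_pow_right (by norm_num) (by have := i.2; omega)
    _ = _ := by rw [Finset.prod_const, Finset.card_univ, Fintype.card_fin, mul_pow, ← pow_mul]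

theorem card_le_of_tail_mem {n d : ℕ} {f : MvPolynomial (Fin (n + 1)) ℤ} (hf : f.totalDegree ≤ d)
    (hc : coeff (Finsupp.single 0 d) f ≠ 0) (E : Finset (Fin (n + 1) → ℤ))
    (T : Finset (Fin n → ℤ)) (hE : ∀ x ∈ E, eval x f = 0 ∧ Fin.tail x ∈ T) :
    E.card ≤ d * T.card := by
  refine (card_le_mul_card_image_tail hf hc E (fun x hx => by simpa using (hE x hx).1)).trans
    (Nat.mul_le_mul_left _ (Finset.card_le_card ?_))
  intro y hy
  obtain ⟨x, hx, rfl⟩ := Finset.mem_image.mp hy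
  exact (hE x hx).2

theorem not_dvd_pderiv_zero {R : Type*} [CommRing R] [IsDomain R] {n : ℕ}
    {P : MvPolynomial (Fin (n + 1)) R} (h : pderiv 0 P ≠ 0) : ¬ P ∣ pderiv 0 P := by
  have hP : P ≠ 0 := fun h0 => h (by rw [h0, map_zero])
  refine not_dvd_of_degreeOf_lt hP h 0 ?_
  rw [← natDegree_finSuccEquiv, ← natDegree_finSuccEquiv, finSuccEquiv_pderiv_zero]
  refine Polynomial.natDegree_derivative_lt fun h0 => h ?_
  refine (finSuccEquiv R n).injective ?_
  rw [finSuccEquiv_pderiv_zero, Polynomial.derivative_of_natDegree_zero h0, map_zero]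

theorem eval_eq_of_pderiv_zero_eq_zero {R : Type*} [CommRing R] [IsDomain R] [CharZero R] {n : ℕ}
    {P : MvPolynomial (Fin (n + 1)) R} (h : pderiv 0 P = 0) {x y : Fin (n + 1) → R}
    (hxy : Fin.tail x = Fin.tail y) : eval x P = eval y P := by
  have h1 : Polynomial.derivative (finSuccEquiv R n P) = 0 := by
    rw [← finSuccEquiv_pderiv_zero, h, map_zero]
  have h2 := Polynomial.derivative_eq_zero.mp h1
  obtain ⟨c, hc⟩ := Polynomial.natDegree_eq_zero.mp h2
  rw [eval_eq_eval_finSuccEquiv, eval_eq_eval_finSuccEquiv P y, ← hc, hxy]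
  simp

/-- An irreducible plane curve of degree at least two with an integral point is not a union of
lines parallel to the first axis. -/
theorem pderiv_zero_ne_zero_of_irreducible {P : MvPolynomial (Fin 2) ℤ} (hP : Irreducible P)
    (hdeg : 2 ≤ P.totalDegree) {x : Fin 2 → ℤ} (hx : eval x P = 0) : pderiv 0 P ≠ 0 := by
  intro h
  have hX : (X 1 - C (x 1) : MvPolynomial (Fin 2) ℤ).totalDegree ≤ 1 := by
    exact (totalDegree_sub _ _).trans
      (max_le (by simp) ((totalDegree_C _).le.trans zero_le_one))
  have hX0 : (X 1 - C (x 1) : MvPolynomial (Fin 2) ℤ) ≠ 0 := by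
    intro h0
    have := congrArg (eval ![0, x 1 + 1]) h0
    simp at this
  have hnd : ¬ P ∣ X 1 - C (x 1) := fun hd => by
    have := totalDegree_le_of_dvd_of_isDomain hd hX0
    omega
  obtain ⟨T, -, hT⟩ := exists_finset_common_zeros hP.prime hnd (le_refl P.totalDegree)
    (hX.trans (by omega))
  have hmem : ∀ n : ℤ, ![n, x 1] ∈ T := by
    intro n
    refine hT _ ?_ (by simp)
    rw [← hx]
    refine eval_eq_of_pderiv_zero_eq_zero (n := 1) h ?_
    funext i
    fin_cases i
    rfl
  have hinj : Function.Injective fun n : ℤ => (![n, x 1] : Fin 2 → ℤ) := fun a b hab => by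
    simpa using congrFun hab 0
  exact Set.infinite_range_of_injective hinj
    (T.finite_toSet.subset (by rintro _ ⟨n, rfl⟩; exact hmem n))

theorem not_dvd_of_support_subset {P h : MvPolynomial (Fin 2) ℤ} (hP : P ≠ 0) (h0 : h ≠ 0)
    (hsupp : ∀ m ∈ h.support, ∃ i, m i < MonomialOrder.degLex.degree P i) : ¬ P ∣ h := by
  rintro ⟨Q, rfl⟩
  obtain ⟨i, hi⟩ := hsupp _ ((MonomialOrder.degree_mem_support_iff (m := MonomialOrder.degLex) _).mpr
    h0)
  rw [MonomialOrder.degree_mul hP (right_ne_zero_of_mul h0)] at hi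
  simp at hi

/-- A set of `2 * (k + 1)` monomials avoiding the multiples of `μ`. -/
theorem exists_monomial_family (k : ℕ) (μ : Fin 2 →₀ ℕ) (hμ : 2 ≤ μ.degree) :
    ∃ m : Fin (k + 1) × Fin 2 → (Fin 2 →₀ ℕ), Function.Injective m ∧
      (∀ j, (m j).degree = j.1 + j.2) ∧ ∀ j, ∃ i, m j i < μ i := by
  have hdeg : ∀ a b : ℕ, (Finsupp.equivFunOnFinite.symm ![a, b] : Fin 2 →₀ ℕ).degree = a + b := by
    intro a b
    rw [Finsupp.degree_eq_sum, Fin.sum_univ_two]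
    simp
  have hinj : ∀ a b a' b' : ℕ, (Finsupp.equivFunOnFinite.symm ![a, b] : Fin 2 →₀ ℕ) =
      Finsupp.equivFunOnFinite.symm ![a', b'] → a = a' ∧ b = b' := by
    intro a b a' b' h
    have h' := Finsupp.equivFunOnFinite.symm.injective h
    exact ⟨by simpa using congrFun h' 0, by simpa using congrFun h' 1⟩
  rw [Finsupp.degree_eq_sum, Fin.sum_univ_two] at hμ
  by_cases h1 : 2 ≤ μ 1
  · refine ⟨fun j => Finsupp.equivFunOnFinite.symm ![(j.1 : ℕ), (j.2 : ℕ)], ?_, ?_, ?_⟩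
    · intro j j' h
      obtain ⟨ha, hb⟩ := hinj _ _ _ _ h
      exact Prod.ext (Fin.ext ha) (Fin.ext hb)
    · intro j
      exact hdeg _ _
    · intro j
      refine ⟨1, ?_⟩
      have := j.2.2
      simp only [Finsupp.equivFunOnFinite_symm_apply_apply, Matrix.cons_val_one, Matrix.cons_val_fin_one]
      omega
  · by_cases h0 : 2 ≤ μ 0
    · refine ⟨fun j => Finsupp.equivFunOnFinite.symm ![(j.2 : ℕ), (j.1 : ℕ)], ?_, ?_, ?_⟩
      · intro j j' h
        obtain ⟨ha, hb⟩ := hinj _ _ _ _ h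
        exact Prod.ext (Fin.ext hb) (Fin.ext ha)
      · intro j
        rw [hdeg, add_comm]
      · intro j
        refine ⟨0, ?_⟩
        have := j.2.2
        simp only [Finsupp.equivFunOnFinite_symm_apply_apply, Matrix.cons_val_zero]
        omega
    · refine ⟨fun j => Finsupp.equivFunOnFinite.symm
        ![(j.1 : ℕ) * (1 - j.2), ((j.1 : ℕ) + 1) * j.2], ?_, ?_, ?_⟩
      · rintro ⟨a, b⟩ ⟨a', b'⟩ h
        obtain ⟨ha, hb⟩ := hinj _ _ _ _ h
        fin_cases b <;> fin_cases b' <;> simp at ha hb ⊢ <;> omega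
      · rintro ⟨a, b⟩
        rw [hdeg]
        fin_cases b <;> simp
      · rintro ⟨a, b⟩
        fin_cases b
        · refine ⟨1, ?_⟩
          simp
          omega
        · refine ⟨0, ?_⟩
          simp
          omega

/-- The constant of the finiteness statements for intersections of plane curves. -/
def bezoutBound (D : ℕ) : ℕ := (2 * D * D + D) ^ 2

theorem sum_degree_family {k : ℕ} {m : Fin (k + 1) × Fin 2 → (Fin 2 →₀ ℕ)}
    (hm : ∀ j, (m j).degree = j.1 + j.2) : ∑ j, (m j).degree = (k + 1) * (k + 1) := by
  simp only [hm]
  rw [Fintype.sum_prod_type]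
  simp only [Fin.sum_univ_two]
  rw [Fin.sum_univ_eq_sum_range (fun a => a + ((0 : Fin 2) : ℕ) + (a + ((1 : Fin 2) : ℕ)))]
  induction k with
  | zero => simp
  | succ k ih =>
    rw [Finset.sum_range_succ, ih (m := fun j => m (j.1.castSucc, j.2)) (fun j => by simp [hm])]
    simp
    ring

/-- The number of auxiliary conditions needed on a curve. -/
structure CurveParams (k τ t Y : ℕ) : Prop where
  bound : τ * ((k + 1) * (k + 1)) + 1 ≤ t * ((k + 1) * (2 * k + 1))
  large : (2 * (k + 1)).factorial * 2 ^ ((k + 1) * (k + 1)) < Y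

theorem exists_curve_aux_of_family {k τ t Y N : ℕ} (hpar : CurveParams k τ t Y)
    (q : ℤ) (hq : (Y : ℤ) ^ t ≤ q) (hN1 : 1 ≤ N) (hN : N ≤ 2 * Y ^ τ)
    (G : MvPolynomial (Fin 2) ℤ) (ξ : Fin 2 → ℤ) (hu : IsCoprime (eval ξ (pderiv 0 G)) q)
    (m : Fin (k + 1) × Fin 2 → (Fin 2 →₀ ℕ)) (hm : Function.Injective m)
    (hdeg : ∀ j, (m j).degree = j.1 + j.2) (E : Set (Fin 2 → ℤ))
    (hE : ∀ η ∈ E, eval η G = 0 ∧ (∀ i, |η i| ≤ N) ∧ ∀ i, q ∣ η i - ξ i) :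
    ∃ h : MvPolynomial (Fin 2) ℤ, h ≠ 0 ∧ (∀ κ ∈ h.support, ∃ j, κ = m j) ∧
      h.totalDegree ≤ k + 1 ∧ ∀ η ∈ E, eval η h = 0 := by
  have hcard : Fintype.card (Fin (k + 1) × Fin 2) = 2 * (k + 1) := by
    simp [mul_comm]
  let ε : Fin (2 * (k + 1)) ≃ Fin (k + 1) × Fin 2 := (Fintype.equivFinOfCardEq hcard).symm
  have hsum : ∑ j, (m (ε j)).degree ≤ (k + 1) * (k + 1) := by
    rw [ε.sum_comp fun i => (m i).degree, sum_degree_family hdeg]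
  have hY1 : 1 ≤ Y := by
    have := hpar.large
    omega
  obtain ⟨h, h0, hs, hE'⟩ := exists_curve_aux (e := (k + 1) * (2 * k + 1)) q hq hY1 hN1 hN G ξ hu
    (fun j => m (ε j)) (hm.comp ε.injective) hsum (by
      have : 2 * (k + 1) - 1 = 2 * k + 1 := by omega
      rw [this, mul_assoc]) hpar.bound hpar.large E hE
  refine ⟨h, h0, fun κ hκ => ?_, totalDegree_le_of_degree_le fun κ hκ => ?_, hE'⟩
  · obtain ⟨j, hj⟩ := hs κ hκ
    exact ⟨_, hj⟩
  · obtain ⟨j, rfl⟩ := hs κ hκ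
    rw [hdeg]
    have h1 := (ε j).1.2
    have h2 := (ε j).2.2
    omega

theorem exists_finset_of_nonlinear_curve {k τ t Y N L : ℕ} (hpar : CurveParams k τ t Y)
    (q : ℤ) (hq : (Y : ℤ) ^ t ≤ q) (hN1 : 1 ≤ N) (hN : N ≤ 2 * Y ^ τ)
    {P : MvPolynomial (Fin 2) ℤ} (hP : Irreducible P) (hP2 : 2 ≤ P.totalDegree)
    (hPL : P.totalDegree ≤ L) (E : Set (Fin 2 → ℤ))
    (hE : ∀ η ∈ E, eval η P = 0 ∧ (∀ i, |η i| ≤ N) ∧ IsCoprime (eval η (pderiv 0 P)) q ∧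
      ∀ η' ∈ E, ∀ i, q ∣ η i - η' i) :
    ∃ T : Finset (Fin 2 → ℤ), T.card ≤ bezoutBound (L + k + 1) ∧ ∀ η ∈ E, η ∈ T := by
  rcases E.eq_empty_or_nonempty with rfl | ⟨ξ, hξ⟩
  · exact ⟨∅, by simp, by simp⟩
  obtain ⟨m, hm, hdeg, hmμ⟩ := exists_monomial_family k (MonomialOrder.degLex.degree P)
    (by rw [degree_degLexDegree]; exact hP2)
  obtain ⟨h, h0, hs, hdegh, hh⟩ := exists_curve_aux_of_family hpar q hq hN1 hN P ξ (hE ξ hξ).2.2.1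
    m hm hdeg E (fun η hη => ⟨(hE η hη).1, (hE η hη).2.1, fun i => (hE η hη).2.2.2 ξ hξ i⟩)
  have hnd : ¬ P ∣ h := not_dvd_of_support_subset hP.ne_zero h0 fun κ hκ => by
    obtain ⟨j, rfl⟩ := hs κ hκ
    exact hmμ j
  obtain ⟨T, hT, hTE⟩ := exists_finset_common_zeros (D := L + k + 1) hP.prime hnd (by omega)
    (by omega)
  exact ⟨T, hT, fun η hη => hTE η (hE η hη).1 (hh η hη)⟩

theorem eval_aeval_eq {σ τ R : Type*} [CommRing R] (g : σ → MvPolynomial τ R)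
    (f : MvPolynomial σ R) (x : τ → R) :
    eval x (aeval g f) = eval (fun i => eval x (g i)) f := by
  induction f using MvPolynomial.induction_on with
  | C a => simp
  | add p q hp hq => simp only [map_add, hp, hq]
  | mul_X p i hp => simp only [map_mul, hp, aeval_X, eval_X]

theorem totalDegree_aeval_le {σ τ R : Type*} [CommRing R] {g : σ → MvPolynomial τ R}
    (hg : ∀ i, (g i).totalDegree ≤ 1) (f : MvPolynomial σ R) :
    (aeval g f).totalDegree ≤ f.totalDegree := by
  rw [aeval_def, eval₂_eq]
  refine totalDegree_finsetSum_le fun m hm => ?_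
  refine (totalDegree_mul _ _).trans ?_
  rw [algebraMap_eq, totalDegree_C, zero_add]
  refine (totalDegree_finsetProd _ _).trans (le_trans ?_ (le_totalDegree hm))
  refine Finset.sum_le_sum fun i _ => (totalDegree_pow _ _).trans ?_
  calc m i * (g i).totalDegree ≤ m i * 1 := Nat.mul_le_mul_left _ (hg i)
    _ = m i := mul_one _

theorem pderiv_aeval_eq {σ τ R : Type*} [CommRing R] [DecidableEq σ] {g : σ → MvPolynomial τ R}
    (i₀ : σ) (j₀ : τ) (hg : ∀ i, pderiv j₀ (g i) = if i = i₀ then 1 else 0)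
    (f : MvPolynomial σ R) : pderiv j₀ (aeval g f) = aeval g (pderiv i₀ f) := by
  induction f using MvPolynomial.induction_on with
  | C a => simp [algebraMap_eq]
  | add p q hp hq => simp only [map_add, hp, hq]
  | mul_X p i hp =>
    rw [map_mul, aeval_X, Derivation.leibniz, Derivation.leibniz, hp, hg, pderiv_X]
    by_cases h : i = i₀
    · subst h
      simp
    · simp [h]

theorem exists_eq_single_of_degree_eq_one {σ : Type*} {m : σ →₀ ℕ} (hm : m.degree = 1) :
    ∃ i, m = Finsupp.single i 1 := by
  obtain ⟨i, hi⟩ : ∃ i, m i ≠ 0 := by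
    by_contra h
    push Not at h
    have : m = 0 := Finsupp.ext h
    simp [this] at hm
  have hle : Finsupp.single i 1 ≤ m := by
    rw [Finsupp.single_le_iff]
    omega
  obtain ⟨c, rfl⟩ := exists_add_of_le hle
  rw [map_add, Finsupp.degree_single] at hm
  have hc : c = 0 := by
    rw [← Finsupp.degree_eq_zero_iff]
    omega
  exact ⟨i, by rw [hc, add_zero]⟩

theorem eq_sum_of_totalDegree_le_one {σ R : Type*} [Fintype σ] [CommRing R]
    {P : MvPolynomial σ R} (hP : P.totalDegree ≤ 1) :
    P = C (coeff 0 P) + ∑ i, C (coeff (Finsupp.single i 1) P) * X i := by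
  classical
  ext m
  rw [coeff_add, coeff_sum, coeff_C]
  simp only [coeff_C_mul, coeff_X]
  by_cases h0 : m = 0
  · subst h0
    simp
  by_cases h1 : ∃ i, m = Finsupp.single i 1
  · obtain ⟨i, rfl⟩ := h1
    rw [if_neg (Ne.symm h0), zero_add, Finset.sum_eq_single i]
    · simp
    · intro j _ hj
      rw [if_neg, mul_zero]
      exact fun h => hj ((Finsupp.single_left_inj one_ne_zero).mp h)
    · simp
  · rw [if_neg (Ne.symm h0), zero_add, Finset.sum_eq_zero]
    · by_contra hc
      have hd := degree_le_of_mem_support hP (mem_support_iff.mpr hc)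
      rcases Nat.le_one_iff_eq_zero_or_eq_one.mp hd with hd | hd
      · exact h0 (by rwa [Finsupp.degree_eq_zero_iff] at hd)
      · exact h1 (exists_eq_single_of_degree_eq_one hd)
    · intro i _
      rw [if_neg (fun h => h1 ⟨i, h.symm⟩), mul_zero]

theorem eval_of_totalDegree_le_one {σ R : Type*} [Fintype σ] [CommRing R]
    {P : MvPolynomial σ R} (hP : P.totalDegree ≤ 1) (x : σ → R) :
    eval x P = coeff 0 P + ∑ i, coeff (Finsupp.single i 1) P * x i := by
  have h := congrArg (eval x) (eq_sum_of_totalDegree_le_one hP)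
  simpa only [map_add, map_sum, map_mul, eval_C, eval_X] using h

theorem eval_line_of_totalDegree_le_one {σ R : Type*} [Fintype σ] [CommRing R]
    {P : MvPolynomial σ R} (hP : P.totalDegree ≤ 1) {x y : σ → R} (hx : eval x P = 0)
    (hy : eval y P = 0) (n : R) : eval (fun i => x i + n * (y i - x i)) P = 0 := by
  rw [eval_of_totalDegree_le_one hP] at hx hy ⊢
  have h : ∑ i, coeff (Finsupp.single i 1) P * (x i + n * (y i - x i)) =
      ∑ i, coeff (Finsupp.single i 1) P * x i +
        n * (∑ i, coeff (Finsupp.single i 1) P * y i - ∑ i, coeff (Finsupp.single i 1) P * x i) := by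
    rw [mul_sub, Finset.mul_sum, Finset.mul_sum, ← Finset.sum_sub_distrib, ← Finset.sum_add_distrib]
    exact Finset.sum_congr rfl fun i _ => by ring
  rw [h]
  linear_combination (1 - n) * hx + n * hy

/-- The restriction of a polynomial to the line through `y` in direction `x`. -/
noncomputable def lineRestriction {σ R : Type*} [CommRing R] (x y : σ → R)
    (f : MvPolynomial σ R) : Polynomial R :=
  aeval (fun i => Polynomial.C (x i) * Polynomial.X + Polynomial.C (y i)) f

theorem eval_lineRestriction {σ R : Type*} [CommRing R] (x y : σ → R) (f : MvPolynomial σ R)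
    (s : R) : (lineRestriction x y f).eval s = eval (fun i => y i + s * x i) f := by
  unfold lineRestriction
  induction f using MvPolynomial.induction_on with
  | C a => simp
  | add p q hp hq => simp [hp, hq]
  | mul_X p i hp => simp [hp]; ring

theorem lineRestriction_monomial {σ R : Type*} [CommRing R] (x y : σ → R) (m : σ →₀ ℕ) :
    (lineRestriction x y (monomial m 1)).natDegree ≤ m.degree ∧
      (lineRestriction x y (monomial m 1)).coeff m.degree = eval x (monomial m 1) := by
  unfold lineRestriction
  induction m using Finsupp.induction_linear with
  | zero => simp
  | add m m' h h' =>
    have hmul : (monomial (m + m') (1 : R)) = monomial m 1 * monomial m' 1 := by simp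
    rw [hmul, map_mul, map_mul, map_add]
    exact ⟨Polynomial.natDegree_mul_le.trans (add_le_add h.1 h'.1),
      by rw [Polynomial.coeff_mul_add_eq_of_natDegree_le h.1 h'.1, h.2, h'.2]⟩
  | single i n =>
    have h1 : (Polynomial.C (x i) * Polynomial.X + Polynomial.C (y i)).natDegree ≤ 1 :=
      Polynomial.natDegree_linear_le
    rw [aeval_monomial, map_one, one_mul, Finsupp.prod_single_index (by simp), eval_monomial,
      Finsupp.prod_single_index (by simp), Finsupp.degree_single, one_mul]
    refine ⟨(Polynomial.natDegree_pow_le_of_le n h1).trans (by simp), ?_⟩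
    have h2 := Polynomial.coeff_pow_of_natDegree_le (m := n) h1
    rw [mul_one] at h2
    rw [h2]
    simp

theorem coeff_lineRestriction {σ R : Type*} [CommRing R] (x y : σ → R) {f : MvPolynomial σ R}
    {d : ℕ} (hf : f.totalDegree ≤ d) :
    (lineRestriction x y f).coeff d = eval x (homogeneousComponent d f) := by
  have hsum : lineRestriction x y f =
      ∑ m ∈ f.support, Polynomial.C (coeff m f) * lineRestriction x y (monomial m 1) := by
    conv_lhs => rw [f.as_sum]
    unfold lineRestriction
    rw [map_sum]
    refine Finset.sum_congr rfl fun m _ => ?_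
    have : monomial m (coeff m f) = C (coeff m f) * monomial m 1 := by
      rw [C_mul_monomial, mul_one]
    rw [this, map_mul, aeval_C]
    rfl
  rw [hsum, homogeneousComponent_apply, Polynomial.finsetSum_coeff, map_sum, Finset.sum_filter]
  refine Finset.sum_congr rfl fun m hm => ?_
  obtain ⟨h1, h2⟩ := lineRestriction_monomial x y m
  rw [Polynomial.coeff_C_mul]
  split_ifs with h
  · rw [← h, h2, ← smul_eval, smul_monomial, smul_eq_mul, mul_one]
  · have := degree_le_of_mem_support hf hm
    rw [Polynomial.coeff_eq_zero_of_natDegree_lt (by omega), mul_zero]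

theorem natDegree_lineRestriction_le {σ R : Type*} [CommRing R] (x y : σ → R)
    {f : MvPolynomial σ R} {d : ℕ} (hf : f.totalDegree ≤ d) :
    (lineRestriction x y f).natDegree ≤ d := by
  unfold lineRestriction
  rw [aeval_def, eval₂_eq]
  refine Polynomial.natDegree_sum_le_of_forall_le _ _ fun m hm => ?_
  refine (Polynomial.natDegree_C_mul_le _ _).trans ?_
  refine (Polynomial.natDegree_prod_le _ _).trans (le_trans ?_ ((le_totalDegree hm).trans hf))
  refine Finset.sum_le_sum fun i _ => ?_
  exact (Polynomial.natDegree_pow_le_of_le (m i) Polynomial.natDegree_linear_le).trans (by simp)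

theorem eval_single_homogeneousComponent {σ R : Type*} [DecidableEq σ] [CommRing R] (i : σ)
    (d : ℕ) (f : MvPolynomial σ R) :
    eval (Pi.single i 1) (homogeneousComponent d f) = coeff (Finsupp.single i d) f := by
  rw [homogeneousComponent_apply, map_sum]
  have hm : ∀ m ∈ f.support.filter (fun m => m.degree = d), m ≠ Finsupp.single i d →
      eval (Pi.single i 1) (monomial m (coeff m f)) = 0 := by
    intro m hm hne
    obtain ⟨j, hj, hji⟩ : ∃ j ∈ m.support, j ≠ i := by
      by_contra hcon
      push Not at hcon
      have h1 : m = Finsupp.single i (m i) := by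
        ext j
        by_cases hj : j = i
        · subst hj; simp
        · rw [Finsupp.single_eq_of_ne hj]
          by_contra h
          exact hj (hcon j (Finsupp.mem_support_iff.mpr h))
      have h2 := (Finset.mem_filter.mp hm).2
      rw [h1, Finsupp.degree_single] at h2
      rw [h2] at h1
      exact hne h1
    rw [eval_monomial, Finsupp.prod, Finset.prod_eq_zero hj, mul_zero]
    rw [Pi.single_eq_of_ne hji, zero_pow (Finsupp.mem_support_iff.mp hj)]
  by_cases h : Finsupp.single i d ∈ f.support
  · rw [Finset.sum_eq_single_of_mem _ (Finset.mem_filter.mpr ⟨h, by simp⟩) hm, eval_monomial,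
      Finsupp.prod_single_index (by simp)]
    simp
  · rw [Finset.sum_eq_zero, notMem_support_iff.mp h]
    intro m hm'
    refine hm m hm' fun h' => h ?_
    rw [← h']
    exact (Finset.mem_filter.mp hm').1

/-- Integral points on a line in the plane, parametrized by a primitive direction. -/
theorem exists_line_parametrization {P : MvPolynomial (Fin 2) ℤ} (hP : P.totalDegree = 1) :
    ∃ w u : Fin 2 → ℤ, u 0 * w 0 + u 1 * w 1 = 1 ∧ ∀ x y : Fin 2 → ℤ, eval x P = 0 →
      eval y P = 0 → ∀ i, y i - x i = (u 0 * (y 0 - x 0) + u 1 * (y 1 - x 1)) * w i := by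
  set β := coeff (Finsupp.single 0 1) P with hβ
  set γ := coeff (Finsupp.single 1 1) P with hγ
  have hne : 0 < Int.gcd β γ := by
    rw [Int.gcd_pos_iff]
    by_contra hcon
    push Not at hcon
    have h := eq_sum_of_totalDegree_le_one hP.le
    rw [Fin.sum_univ_two, ← hβ, ← hγ, hcon.1, hcon.2] at h
    simp only [map_zero, zero_mul, add_zero] at h
    rw [h, totalDegree_C] at hP
    exact absurd hP (by norm_num)
  obtain ⟨b, c, hbc, hb, hc⟩ := Int.exists_gcd_one hne
  obtain ⟨r, s, hrs⟩ := Int.isCoprime_iff_gcd_eq_one.mpr hbc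
  refine ⟨![c, -b], ![s, -r], ?_, ?_⟩
  · simp only [Matrix.cons_val_zero, Matrix.cons_val_one]
    linear_combination hrs
  · intro x y hx hy i
    rw [eval_of_totalDegree_le_one hP.le, Fin.sum_univ_two, ← hβ, ← hγ] at hx hy
    have h1 : (Int.gcd β γ : ℤ) * (b * (y 0 - x 0) + c * (y 1 - x 1)) = 0 := by
      linear_combination hy - hx - (y 0 - x 0) * hb - (y 1 - x 1) * hc
    have h2 := (mul_eq_zero.mp h1).resolve_left (by exact_mod_cast hne.ne')
    fin_cases i
    · simp only [Fin.zero_eta, Matrix.cons_val_zero, Matrix.cons_val_one]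
      linear_combination r * h2 - (y 0 - x 0) * hrs
    · simp only [Fin.mk_one, Matrix.cons_val_zero, Matrix.cons_val_one]
      linear_combination s * h2 - (y 1 - x 1) * hrs

theorem degreeOf_eq_totalDegree_of_dvd {σ R : Type*} [CommRing R] [IsDomain R] {i : σ}
    {f P : MvPolynomial σ R} (hf : f ≠ 0) (h : f.totalDegree ≤ f.degreeOf i) (hP : P ∣ f) :
    P.degreeOf i = P.totalDegree := by
  obtain ⟨Q, rfl⟩ := hP
  have hP0 := left_ne_zero_of_mul hf
  have hQ0 := right_ne_zero_of_mul hf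
  rw [totalDegree_mul_of_isDomain hP0 hQ0, degreeOf_mul_eq hP0 hQ0] at h
  have h1 := degreeOf_le_totalDegree P i
  have h2 := degreeOf_le_totalDegree Q i
  omega

/-- `ξ` and `ξ'` span a line contained in the zero locus of `f`. -/
def SpanLine {σ : Type*} (f : MvPolynomial σ ℤ) (ξ ξ' : σ → ℤ) : Prop :=
  ξ ≠ ξ' ∧ ∀ n : ℤ, eval (fun i => ξ i + n * (ξ' i - ξ i)) f = 0

theorem card_le_of_not_spanLine {k τ t Y d : ℕ} (hpar : CurveParams k τ t Y)
    (q : ℤ) (hq : (Y : ℤ) ^ t ≤ q) {P : MvPolynomial (Fin 2) ℤ} (hP : P.totalDegree = 1)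
    {f : MvPolynomial (Fin 3) ℤ} (hfd : f.totalDegree ≤ d)
    (hc : coeff (Finsupp.single 0 d) f ≠ 0) (E : Finset (Fin 3 → ℤ))
    (hE : ∀ η ∈ E, eval η f = 0 ∧ eval (Fin.tail η) P = 0 ∧ (∀ i, |η i| ≤ (Y ^ τ : ℕ)) ∧
      IsCoprime (eval η (pderiv 0 f)) q ∧
      ∀ η' ∈ E, (∀ i, q ∣ η i - η' i) ∧ ¬ SpanLine f η η') :
    E.card ≤ d * (bezoutBound (d + k + 1) + 1) := by
  classical
  rcases E.eq_empty_or_nonempty with rfl | ⟨ξ, hξ⟩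
  · simp
  obtain ⟨w, u, huw, hline⟩ := exists_line_parametrization hP
  have hY1 : 1 ≤ Y := by
    have := hpar.large
    omega
  -- coordinates on the plane section
  let s : (Fin 3 → ℤ) → ℤ := fun η => u 0 * (η 1 - ξ 1) + u 1 * (η 2 - ξ 2)
  have hs : ∀ η ∈ E, η 1 = ξ 1 + s η * w 0 ∧ η 2 = ξ 2 + s η * w 1 := by
    intro η hη
    have h := hline (Fin.tail ξ) (Fin.tail η) (hE ξ hξ).2.1 (hE η hη).2.1
    have h0 : η 1 - ξ 1 = s η * w 0 := h 0
    have h1 : η 2 - ξ 2 = s η * w 1 := h 1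
    exact ⟨by linear_combination h0, by linear_combination h1⟩
  let g : Fin 3 → MvPolynomial (Fin 2) ℤ :=
    ![X 0, C (ξ 1) + C (w 0) * X 1, C (ξ 2) + C (w 1) * X 1]
  have hev : ∀ x : Fin 2 → ℤ, ∀ G : MvPolynomial (Fin 3) ℤ,
      eval x (aeval g G) = eval ![x 0, ξ 1 + x 1 * w 0, ξ 2 + x 1 * w 1] G := by
    intro x G
    rw [eval_aeval_eq]
    congr 2
    funext i
    fin_cases i
    · simp [g]
    · simp only [g, Fin.mk_one, Matrix.cons_val_one, Matrix.cons_val_zero, map_add, map_mul,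
        eval_C, eval_X]
      ring
    · simp only [g, Fin.reduceFinMk, Matrix.cons_val, map_add, map_mul, eval_C, eval_X]
      ring
  set fl := aeval g f with hfl
  let π : (Fin 3 → ℤ) → Fin 2 → ℤ := fun η => ![η 0, s η]
  have hπ : ∀ η ∈ E, ∀ G : MvPolynomial (Fin 3) ℤ, eval (π η) (aeval g G) = eval η G := by
    intro η hη G
    rw [hev]
    congr 2
    funext i
    fin_cases i
    · rfl
    · exact ((hs η hη).1).symm
    · exact ((hs η hη).2).symm
  have hπinj : Set.InjOn π E := by
    intro η hη η' hη' h
    have h0 : η 0 = η' 0 := congrFun h 0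
    have h1 : s η = s η' := congrFun h 1
    funext i
    fin_cases i
    · exact h0
    · exact ((hs η hη).1).trans (by rw [h1]; exact ((hs η' hη').1).symm)
    · exact ((hs η hη).2).trans (by rw [h1]; exact ((hs η' hη').2).symm)
  have hg1 : ∀ i, (g i).totalDegree ≤ 1 := by
    have haff : ∀ a b : ℤ, (C a + C b * X 1 : MvPolynomial (Fin 2) ℤ).totalDegree ≤ 1 := by
      intro a b
      refine (totalDegree_add _ _).trans (max_le ((totalDegree_C _).le.trans zero_le_one) ?_)
      refine (totalDegree_mul _ _).trans ?_
      rw [totalDegree_C, totalDegree_X]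
    intro i
    fin_cases i
    · exact (totalDegree_X _).le
    · exact haff _ _
    · exact haff _ _
  have hfld : fl.totalDegree ≤ d := (totalDegree_aeval_le hg1 f).trans hfd
  have hflc : coeff (Finsupp.single 0 d) fl ≠ 0 := by
    have h1 : lineRestriction (Pi.single 0 1) 0 fl =
        lineRestriction (Pi.single 0 1) ![0, ξ 1, ξ 2] f := by
      refine Polynomial.funext fun r => ?_
      rw [eval_lineRestriction, eval_lineRestriction, hev]
      congr 2
      funext i
      fin_cases i <;> simp
    rw [← eval_single_homogeneousComponent, ← coeff_lineRestriction _ 0 hfld, h1,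
      coeff_lineRestriction _ _ hfd, eval_single_homogeneousComponent]
    exact hc
  have hfl0 : fl ≠ 0 := fun h => hflc (by rw [h, coeff_zero])
  have hfldeg : fl.totalDegree ≤ fl.degreeOf 0 :=
    hfld.trans (le_degreeOf_of_coeff_ne_zero hflc)
  have hder : pderiv 0 fl = aeval g (pderiv 0 f) := by
    refine pderiv_aeval_eq 0 0 ?_ f
    intro i
    fin_cases i <;> simp [g, pderiv_X]
  -- the auxiliary polynomial
  obtain ⟨m, hm, hmdeg, hmμ⟩ := exists_monomial_family k (Finsupp.single 0 2) (by simp)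
  have hbox : ∀ η ∈ E, ∀ i, |π η i| ≤ (2 * Y ^ τ : ℕ) := by
    intro η hη
    have h0 := (hE η hη).2.2.1
    have hξ0 := (hE ξ hξ).2.2.1
    have habs : ∀ v : ℤ, v ≠ 0 → |s η| ≤ |s η * v| := fun v hv => by
      rw [abs_mul]
      exact le_mul_of_one_le_right (abs_nonneg _) (Int.one_le_abs hv)
    intro i
    push_cast
    fin_cases i
    · have h := h0 0
      push_cast at h
      have h' := abs_nonneg (η 0)
      change |η 0| ≤ _
      omega
    · change |s η| ≤ _
      by_cases hw : w 0 = 0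
      · have hw1 : w 1 ≠ 0 := fun h => by simp [hw, h] at huw
        have h1 : s η * w 1 = η 2 - ξ 2 := by rw [(hs η hη).2]; ring
        have h2 := habs _ hw1
        rw [h1] at h2
        have h3 := abs_sub (η 2) (ξ 2)
        have h4 := h0 2
        have h5 := hξ0 2
        push_cast at h4 h5
        linarith
      · have h1 : s η * w 0 = η 1 - ξ 1 := by rw [(hs η hη).1]; ring
        have h2 := habs _ hw
        rw [h1] at h2
        have h3 := abs_sub (η 1) (ξ 1)
        have h4 := h0 1
        have h5 := hξ0 1
        push_cast at h4 h5
        linarith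
  have hq' : ∀ η ∈ E, ∀ i, q ∣ π η i - π ξ i := by
    intro η hη i
    have h := ((hE η hη).2.2.2.2 ξ hξ).1
    fin_cases i
    · exact h 0
    · change q ∣ s η - s ξ
      have : s η - s ξ = u 0 * (η 1 - ξ 1) + u 1 * (η 2 - ξ 2) := by simp [s]
      rw [this]
      exact dvd_add ((h 1).mul_left _) ((h 2).mul_left _)
  obtain ⟨h, h0, hsupp, hhdeg, hh⟩ := exists_curve_aux_of_family hpar q hq (N := 2 * Y ^ τ)
    (Nat.mul_pos two_pos (Nat.pow_pos hY1)) le_rfl fl (π ξ)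
    (by rw [hder, hπ ξ hξ]; exact (hE ξ hξ).2.2.2.1) m hm hmdeg (π '' E) (by
      rintro _ ⟨η, hη, rfl⟩
      exact ⟨by rw [hfl, hπ η hη]; exact (hE η hη).1, hbox η hη, hq' η hη⟩)
  have hdegh : h.degreeOf 0 < 2 := by
    rw [degreeOf_lt_iff two_pos]
    intro κ hκ
    obtain ⟨j, rfl⟩ := hsupp κ hκ
    obtain ⟨i, hi⟩ := hmμ j
    by_cases hi0 : i = 0
    · subst hi0
      simpa using hi
    · rw [Finsupp.single_eq_of_ne hi0] at hi
      omega
  obtain ⟨T, hTc, hT, hTx, -⟩ := exists_finset_irreducible_factors hfl0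
  have hcover : E ⊆ T.biUnion fun R => E.filter fun η => eval (π η) R = 0 := by
    intro η hη
    obtain ⟨R, hR, hRx⟩ := hTx (π η) (by rw [hfl, hπ η hη]; exact (hE η hη).1)
    exact Finset.mem_biUnion.mpr ⟨R, hR, Finset.mem_filter.mpr ⟨hη, hRx⟩⟩
  refine (Finset.card_le_card hcover).trans ((Finset.card_biUnion_le_card_mul _ _
    (bezoutBound (d + k + 1) + 1) ?_).trans (Nat.mul_le_mul_right _ (hTc.trans hfld)))
  intro R hR
  obtain ⟨hRirr, hRdvd⟩ := hT R hR
  have hRdeg := (totalDegree_le_of_dvd_of_isDomain hRdvd hfl0).trans hfld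
  by_cases hRh : R ∣ h
  · have hR1 : R.totalDegree ≤ 1 := by
      rw [← degreeOf_eq_totalDegree_of_dvd hfl0 hfldeg hRdvd]
      by_contra hcon
      exact not_dvd_of_degreeOf_lt hRirr.ne_zero h0 0 (by omega) hRh
    refine le_trans (Finset.card_le_one.mpr ?_) (Nat.le_add_left 1 _)
    intro η hη η' hη'
    obtain ⟨hηE, hη⟩ := Finset.mem_filter.mp hη
    obtain ⟨hηE', hη'⟩ := Finset.mem_filter.mp hη'
    by_contra hne
    refine ((hE η hηE).2.2.2.2 η' hηE').2 ⟨hne, fun n => ?_⟩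
    have hR0 := eval_line_of_totalDegree_le_one hR1 hη hη' n
    obtain ⟨Q, hQ⟩ := hRdvd
    have hfl1 : eval (fun i => π η i + n * (π η' i - π η i)) fl = 0 := by
      rw [hQ, map_mul, hR0, zero_mul]
    rw [hfl, hev] at hfl1
    rw [← hfl1]
    congr 2
    funext i
    fin_cases i
    · rfl
    · change η 1 + n * (η' 1 - η 1) = ξ 1 + (s η + n * (s η' - s η)) * w 0
      rw [(hs η hηE).1, (hs η' hηE').1]
      ring
    · change η 2 + n * (η' 2 - η 2) = ξ 2 + (s η + n * (s η' - s η)) * w 1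
      rw [(hs η hηE).2, (hs η' hηE').2]
      ring
  · obtain ⟨T', hT', hT'E⟩ := exists_finset_common_zeros (D := d + k + 1) hRirr.prime hRh
      (by omega) (by omega)
    refine le_trans ?_ (Nat.le_succ _)
    refine le_trans (Finset.card_le_card_of_injOn π ?_ ?_) hT'
    · intro η hη
      obtain ⟨hηE, hη⟩ := Finset.mem_filter.mp hη
      exact hT'E _ hη (hh _ ⟨η, hηE, rfl⟩)
    · exact hπinj.mono (by intro η hη; exact (Finset.mem_filter.mp hη).1)

/-- Zeros of `f` in a box at which the derivative in the first variable is coprime to the primes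
`p a, …, p (a + M - 1)`. -/
structure CleanBlock (Y τ d : ℕ) (p : ℕ → ℕ) (f : MvPolynomial (Fin 3) ℤ) (a M : ℕ)
    (S : Finset (Fin 3 → ℤ)) : Prop where
  primes : PrimeSequence Y p
  degree : f.totalDegree ≤ d
  coeff_ne_zero : coeff (Finsupp.single 0 d) f ≠ 0
  eval_eq_zero : ∀ ξ ∈ S, eval ξ f = 0
  abs_le : ∀ ξ ∈ S, ∀ i, |ξ i| ≤ (Y ^ τ : ℕ)
  not_dvd : ∀ ξ ∈ S, ∀ i < M, ¬ (p (a + i) : ℤ) ∣ eval ξ (pderiv 0 f)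

theorem CleanBlock.mono {Y τ d a M a' M' : ℕ} {p : ℕ → ℕ} {f : MvPolynomial (Fin 3) ℤ}
    {S S' : Finset (Fin 3 → ℤ)} (h : CleanBlock Y τ d p f a M S) (hS : S' ⊆ S) (ha : a ≤ a')
    (hM : a' + M' ≤ a + M) : CleanBlock Y τ d p f a' M' S' where
  primes := h.primes
  degree := h.degree
  coeff_ne_zero := h.coeff_ne_zero
  eval_eq_zero ξ hξ := h.eval_eq_zero ξ (hS hξ)
  abs_le ξ hξ := h.abs_le ξ (hS hξ)
  not_dvd ξ hξ i hi := by
    have := h.not_dvd ξ (hS hξ) (a' - a + i) (by omega)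
    rwa [← add_assoc, Nat.add_sub_cancel' ha] at this

theorem CleanBlock.isCoprime {Y τ d a t : ℕ} {p : ℕ → ℕ} {f : MvPolynomial (Fin 3) ℤ}
    {S : Finset (Fin 3 → ℤ)} (h : CleanBlock Y τ d p f a t S) {ξ : Fin 3 → ℤ} (hξ : ξ ∈ S) :
    IsCoprime (eval ξ (pderiv 0 f)) (∏ i : Fin t, (p (a + i) : ℤ)) :=
  isCoprime_prod_of_not_dvd h.primes.prime (h.not_dvd ξ hξ)

/-- The residue classes of a window of primes are covered by plane curves of bounded degree and
height, together with their irreducible components. -/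
structure CurveCover (p : ℕ → ℕ) (a t L H : ℕ) (S : Finset (Fin 3 → ℤ))
    (A : (Fin t → Fin 3 → ℤ) → MvPolynomial (Fin 2) ℤ)
    (T : (Fin t → Fin 3 → ℤ) → Finset (MvPolynomial (Fin 2) ℤ)) : Prop where
  ne_zero : ∀ κ, A κ ≠ 0
  degree : ∀ κ, (A κ).totalDegree ≤ L
  height : ∀ κ m, |coeff m (A κ)| ≤ H
  eval_eq_zero : ∀ ξ ∈ S, eval (Fin.tail ξ) (A (residueKey p a t ξ)) = 0
  card : ∀ κ, (T κ).card ≤ L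
  irreducible : ∀ κ, ∀ P ∈ T κ, Irreducible P
  dvd : ∀ κ, ∀ P ∈ T κ, P ∣ A κ
  exists_factor : ∀ κ x, eval x (A κ) = 0 → ∃ P ∈ T κ, eval x P = 0
  exists_associated : ∀ κ P, Irreducible P → P ∣ A κ → 1 ≤ P.totalDegree →
    ∃ P' ∈ T κ, Associated P P'

theorem CurveCover.degree_le {p : ℕ → ℕ} {a t L H : ℕ} {S : Finset (Fin 3 → ℤ)}
    {A : (Fin t → Fin 3 → ℤ) → MvPolynomial (Fin 2) ℤ}
    {T : (Fin t → Fin 3 → ℤ) → Finset (MvPolynomial (Fin 2) ℤ)}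
    (h : CurveCover p a t L H S A T) {κ : Fin t → Fin 3 → ℤ} {P : MvPolynomial (Fin 2) ℤ}
    (hP : P ∈ T κ) : P.totalDegree ≤ L :=
  (totalDegree_le_of_dvd_of_isDomain (h.dvd κ P hP) (h.ne_zero κ)).trans (h.degree κ)

theorem CurveCover.mono {p : ℕ → ℕ} {a t L H : ℕ} {S S' : Finset (Fin 3 → ℤ)}
    {A : (Fin t → Fin 3 → ℤ) → MvPolynomial (Fin 2) ℤ}
    {T : (Fin t → Fin 3 → ℤ) → Finset (MvPolynomial (Fin 2) ℤ)}
    (h : CurveCover p a t L H S A T) (hS : S' ⊆ S) : CurveCover p a t L H S' A T :=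
  { h with eval_eq_zero := fun ξ hξ => h.eval_eq_zero ξ (hS hξ) }

theorem CleanBlock.exists_curveCover {R : Type*} [CommRing R] [IsDomain R] [CharZero R]
    {d D k τ t s e W Y a : ℕ} {p : ℕ → ℕ} {f : MvPolynomial (Fin 3) ℤ} {S : Finset (Fin 3 → ℤ)}
    (h : CleanBlock Y τ d p f a t S) (hpar : SurfaceParams D k τ t s e W) (hD : 0 < D)
    (hDd : D ≤ d) (hYs : s.factorial < Y) (hf : Prime (map (Int.castRingHom R) f))
    (L : ℕ) (hL : 2 * (d + k) * (d + k) + (d + k) = L) :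
    ∃ A T, CurveCover p a t L (((L + 1) ^ 2).factorial * (Y ^ τ) ^ (L * (L + 1) ^ 2)) S A T := by
  have key : ∀ κ : Fin t → Fin 3 → ℤ, ∃ A : MvPolynomial (Fin 2) ℤ, A ≠ 0 ∧ A.totalDegree ≤ L ∧
      (∀ m, |coeff m A| ≤ (((L + 1) ^ 2).factorial * (Y ^ τ) ^ (L * (L + 1) ^ 2) : ℕ)) ∧
      ∀ η ∈ {η : Fin 3 → ℤ | η ∈ S ∧ residueKey p a t η = κ}, eval (Fin.tail η) A = 0 := by
    intro κ
    by_cases hne : ∃ ξ ∈ S, residueKey p a t ξ = κ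
    · obtain ⟨ξ, hξ, hκ⟩ := hne
      refine exists_curve_of_class hpar hD hDd h.primes.one_le hYs _
        (pow_le_prod_primes h.primes.lt a t) f hf h.degree h.coeff_ne_zero ξ (h.isCoprime hξ) _
        ?_ L hL
      rintro η ⟨hη, hηκ⟩
      exact ⟨h.eval_eq_zero η hη, h.abs_le η hη, fun i =>
        prod_dvd_sub_of_residueKey_eq h.primes.prime h.primes.strictMono (hηκ.trans hκ.symm) i⟩
    · refine ⟨1, one_ne_zero, by simp, fun m => ?_, fun η hη => absurd ⟨η, hη.1, hη.2⟩ hne⟩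
      have h1 : 1 ≤ ((L + 1) ^ 2).factorial * (Y ^ τ) ^ (L * (L + 1) ^ 2) :=
        Nat.one_le_iff_ne_zero.mpr (mul_ne_zero (Nat.factorial_ne_zero _)
          (pow_ne_zero _ (pow_ne_zero _ (by have := h.primes.one_le; omega))))
      rw [coeff_one]
      split_ifs
      · rw [abs_one]; exact_mod_cast h1
      · simp only [abs_zero]; positivity
  choose A hA0 hAd hAH hAE using key
  choose T hTc hTi hTf hTa using fun κ => exists_finset_irreducible_factors (hA0 κ)
  exact ⟨A, T, hA0, hAd, hAH, fun ξ hξ => hAE _ ξ ⟨hξ, rfl⟩, fun κ => (hTc κ).trans (hAd κ),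
    fun κ P hP => (hTi κ P hP).1, fun κ P hP => (hTi κ P hP).2, hTf, hTa⟩

theorem CleanBlock.card_le_of_factors {Y τ d a t L C : ℕ} {p : ℕ → ℕ}
    {f : MvPolynomial (Fin 3) ℤ} {S : Finset (Fin 3 → ℤ)} (h : CleanBlock Y τ d p f a t S)
    (T : (Fin t → Fin 3 → ℤ) → Finset (MvPolynomial (Fin 2) ℤ)) (hT : ∀ κ, (T κ).card ≤ L)
    (Q : (Fin t → Fin 3 → ℤ) → MvPolynomial (Fin 2) ℤ → (Fin 3 → ℤ) → Prop)
    (hS : ∀ ξ ∈ S, ∃ P ∈ T (residueKey p a t ξ), Q (residueKey p a t ξ) P ξ)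
    (hC : ∀ κ, ∀ P ∈ T κ, ∀ E : Finset (Fin 3 → ℤ), E ⊆ S →
      (∀ ξ ∈ E, residueKey p a t ξ = κ ∧ Q κ P ξ) → E.card ≤ C) :
    S.card ≤ L * C * (d * 2 ^ ((a + t) * 2)) ^ t * Y ^ (2 * t) := by
  classical
  refine card_le_of_class_card_le h.primes h.degree S
    (fun ξ hξ => ⟨h.eval_eq_zero ξ hξ, h.not_dvd ξ hξ⟩) fun κ => ?_
  have hsub : (S.filter fun ξ => residueKey p a t ξ = κ) ⊆
      (T κ).biUnion fun P => S.filter fun ξ => residueKey p a t ξ = κ ∧ Q κ P ξ := by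
    intro ξ hξ
    rw [Finset.mem_filter] at hξ
    obtain ⟨P, hP, hQ⟩ := hS ξ hξ.1
    rw [hξ.2] at hP hQ
    exact Finset.mem_biUnion.mpr ⟨P, hP, Finset.mem_filter.mpr ⟨hξ.1, hξ.2, hQ⟩⟩
  refine (Finset.card_le_card hsub).trans ((Finset.card_biUnion_le_card_mul _ _ C ?_).trans
    (Nat.mul_le_mul_right _ (hT κ)))
  intro P hP
  exact hC κ P hP _ (Finset.filter_subset _ _) fun ξ hξ => (Finset.mem_filter.mp hξ).2

theorem CleanBlock.card_le_of_tail_mem {Y τ d a t : ℕ} {p : ℕ → ℕ}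
    {f : MvPolynomial (Fin 3) ℤ} {S : Finset (Fin 3 → ℤ)} (h : CleanBlock Y τ d p f a t S)
    {E : Finset (Fin 3 → ℤ)} (hE : E ⊆ S) (T : Finset (Fin 2 → ℤ))
    (hT : ∀ ξ ∈ E, Fin.tail ξ ∈ T) : E.card ≤ d * T.card :=
  _root_.card_le_of_tail_mem h.degree h.coeff_ne_zero E T
    fun ξ hξ => ⟨h.eval_eq_zero ξ (hE hξ), hT ξ hξ⟩

theorem CleanBlock.card_le_of_common_zero {Y τ d a t L : ℕ} {p : ℕ → ℕ}
    {f : MvPolynomial (Fin 3) ℤ} {S : Finset (Fin 3 → ℤ)} (h : CleanBlock Y τ d p f a t S)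
    (T : (Fin t → Fin 3 → ℤ) → Finset (MvPolynomial (Fin 2) ℤ)) (hT : ∀ κ, (T κ).card ≤ L)
    (hTi : ∀ κ, ∀ P ∈ T κ, Irreducible P) (hTd : ∀ κ, ∀ P ∈ T κ, P.totalDegree ≤ L)
    (Q : (Fin t → Fin 3 → ℤ) → MvPolynomial (Fin 2) ℤ → MvPolynomial (Fin 2) ℤ)
    (hQ : ∀ κ, ∀ P ∈ T κ, (Q κ P).totalDegree ≤ L)
    (hS : ∀ ξ ∈ S, ∃ P ∈ T (residueKey p a t ξ), eval (Fin.tail ξ) P = 0 ∧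
      ¬ P ∣ Q (residueKey p a t ξ) P ∧ eval (Fin.tail ξ) (Q (residueKey p a t ξ) P) = 0) :
    S.card ≤ L * (d * bezoutBound L) * (d * 2 ^ ((a + t) * 2)) ^ t * Y ^ (2 * t) := by
  refine h.card_le_of_factors T hT (fun κ P ξ => eval (Fin.tail ξ) P = 0 ∧
    ¬ P ∣ Q κ P ∧ eval (Fin.tail ξ) (Q κ P) = 0) hS ?_
  intro κ P hP E hES hE
  rcases E.eq_empty_or_nonempty with rfl | ⟨ξ, hξ⟩
  · simp
  obtain ⟨U, hU, hUm⟩ := exists_finset_common_zeros (hTi κ P hP).prime (hE ξ hξ).2.2.1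
    (hTd κ P hP) (hQ κ P hP)
  exact (h.card_le_of_tail_mem hES U fun η hη => hUm _ (hE η hη).2.1 (hE η hη).2.2.2).trans
    (Nat.mul_le_mul_left _ hU)

theorem CleanBlock.card_le_of_linear {k Y τ d a t L H : ℕ} {p : ℕ → ℕ}
    {f : MvPolynomial (Fin 3) ℤ} {S : Finset (Fin 3 → ℤ)} (h : CleanBlock Y τ d p f a t S)
    (hpar : CurveParams k τ t Y) {A : (Fin t → Fin 3 → ℤ) → MvPolynomial (Fin 2) ℤ}
    {T : (Fin t → Fin 3 → ℤ) → Finset (MvPolynomial (Fin 2) ℤ)} (hA : CurveCover p a t L H S A T)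
    (hline : ∀ ξ ∈ S, ∀ ξ' ∈ S, ¬ SpanLine f ξ ξ')
    (hS : ∀ ξ ∈ S, ∃ P ∈ T (residueKey p a t ξ), eval (Fin.tail ξ) P = 0 ∧ P.totalDegree = 1) :
    S.card ≤ L * (d * (bezoutBound (d + k + 1) + 1)) * (d * 2 ^ ((a + t) * 2)) ^ t *
      Y ^ (2 * t) := by
  refine h.card_le_of_factors T hA.card
    (fun κ P ξ => eval (Fin.tail ξ) P = 0 ∧ P.totalDegree = 1) hS ?_
  intro κ P hP E hES hE
  rcases E.eq_empty_or_nonempty with rfl | ⟨ξ, hξ⟩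
  · simp
  refine card_le_of_not_spanLine hpar _ (pow_le_prod_primes h.primes.lt a t) (hE ξ hξ).2.2
    h.degree h.coeff_ne_zero E fun η hη => ⟨h.eval_eq_zero η (hES hη), (hE η hη).2.1,
      h.abs_le η (hES hη), h.isCoprime (hES hη), fun η' hη' => ⟨fun i => ?_,
        hline η (hES hη) η' (hES hη')⟩⟩
  exact prod_dvd_sub_of_residueKey_eq h.primes.prime h.primes.strictMono
    ((hE η hη).1.trans (hE η' hη').1.symm) i

theorem CleanBlock.card_le_of_nonlinear {k Y τ d a t L H : ℕ} {p : ℕ → ℕ}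
    {f : MvPolynomial (Fin 3) ℤ} {S : Finset (Fin 3 → ℤ)} (h : CleanBlock Y τ d p f a t S)
    (hpar : CurveParams k τ t Y) {A : (Fin t → Fin 3 → ℤ) → MvPolynomial (Fin 2) ℤ}
    {T : (Fin t → Fin 3 → ℤ) → Finset (MvPolynomial (Fin 2) ℤ)} (hA : CurveCover p a t L H S A T)
    (hS : ∀ ξ ∈ S, ∃ P ∈ T (residueKey p a t ξ), eval (Fin.tail ξ) P = 0 ∧ 2 ≤ P.totalDegree ∧
      ∀ i < t, ¬ (p (a + i) : ℤ) ∣ eval (Fin.tail ξ) (pderiv 0 P)) :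
    S.card ≤ L * (d * bezoutBound (L + k + 1)) * (d * 2 ^ ((a + t) * 2)) ^ t * Y ^ (2 * t) := by
  refine h.card_le_of_factors T hA.card (fun κ P ξ => eval (Fin.tail ξ) P = 0 ∧
    2 ≤ P.totalDegree ∧ ∀ i < t, ¬ (p (a + i) : ℤ) ∣ eval (Fin.tail ξ) (pderiv 0 P)) hS ?_
  intro κ P hP E hES hE
  rcases E.eq_empty_or_nonempty with rfl | ⟨ξ, hξ⟩
  · simp
  have hY := h.primes.one_le
  obtain ⟨U, hU, hUm⟩ := exists_finset_of_nonlinear_curve (N := Y ^ τ) hpar _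
    (pow_le_prod_primes h.primes.lt a t) (Nat.one_le_pow _ _ hY) (by omega)
    (hA.irreducible κ P hP) (hE ξ hξ).2.2.1 (hA.degree_le hP) (Fin.tail '' (E : Set (Fin 3 → ℤ)))
    (by
      rintro _ ⟨η, hη, rfl⟩
      refine ⟨(hE η hη).2.1, fun i => h.abs_le η (hES hη) i.succ,
        isCoprime_prod_of_not_dvd h.primes.prime (hE η hη).2.2.2, ?_⟩
      rintro _ ⟨η', hη', rfl⟩ i
      exact prod_dvd_sub_of_residueKey_eq h.primes.prime h.primes.strictMono
        ((hE η hη).1.trans (hE η' hη').1.symm) i.succ)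
  exact (h.card_le_of_tail_mem hES U fun η hη => hUm _ ⟨η, hη, rfl⟩).trans
    (Nat.mul_le_mul_left _ hU)

/-- Bound for the number of points of a clean block, up to a power of `Y`. -/
def blockBound (d k t L a M : ℕ) : ℕ :=
  L * (d * (bezoutBound (L + k + 1) + (bezoutBound (d + k + 1) + 1))) *
    (d * 2 ^ ((a + M) * 2)) ^ (t + 1)

theorem mul_le_blockBound_mul {d k t L a M C a' t' Y : ℕ} (hd : 1 ≤ d) (hY : 1 ≤ Y)
    (hC : C ≤ d * (bezoutBound (L + k + 1) + (bezoutBound (d + k + 1) + 1)))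
    (ha : a' + t' ≤ a + M) (ht : t' ≤ t + 1) :
    L * C * (d * 2 ^ ((a' + t') * 2)) ^ t' * Y ^ (2 * t') ≤
      blockBound d k t L a M * Y ^ (2 * t + 2) := by
  unfold blockBound
  have h1 : (d * 2 ^ ((a' + t') * 2)) ^ t' ≤ (d * 2 ^ ((a + M) * 2)) ^ (t + 1) := by
    calc (d * 2 ^ ((a' + t') * 2)) ^ t' ≤ (d * 2 ^ ((a + M) * 2)) ^ t' := by
          gcongr; norm_num
      _ ≤ _ := Nat.pow_le_pow_right (Nat.mul_pos hd (by positivity)) ht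
  have h2 : Y ^ (2 * t') ≤ Y ^ (2 * t + 2) := Nat.pow_le_pow_right hY (by omega)
  gcongr

theorem bezoutBound_mono {D D' : ℕ} (h : D ≤ D') : bezoutBound D ≤ bezoutBound D' := by
  unfold bezoutBound
  gcongr

theorem totalDegree_pow_eq {σ R : Type*} [CommRing R] [IsDomain R] {P : MvPolynomial σ R}
    (hP : P ≠ 0) (m : ℕ) : (P ^ m).totalDegree = m * P.totalDegree := by
  induction m with
  | zero => simp
  | succ m ih =>
    rw [pow_succ, totalDegree_mul_of_isDomain (pow_ne_zero _ hP) hP, ih]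
    ring

theorem CurveCover.abs_eval_pderiv_le {p : ℕ → ℕ} {a t L H N : ℕ} {S : Finset (Fin 3 → ℤ)}
    {A : (Fin t → Fin 3 → ℤ) → MvPolynomial (Fin 2) ℤ}
    {T : (Fin t → Fin 3 → ℤ) → Finset (MvPolynomial (Fin 2) ℤ)}
    (h : CurveCover p a t L H S A T) (hL : 1 ≤ L) (hN : 1 ≤ N) {κ : Fin t → Fin 3 → ℤ}
    {P Q : MvPolynomial (Fin 2) ℤ} (hP1 : 1 ≤ P.totalDegree) {m : ℕ} (hm : 1 ≤ m)
    (hA : A κ = P ^ m * Q) {x : Fin 2 → ℤ} (hx : eval x P = 0) (hxN : ∀ i, |x i| ≤ N)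
    (hx' : eval x (pderiv 0 P) ≠ 0) (hQ : eval x Q ≠ 0) :
    |eval x (pderiv 0 P)| ≤ (((L + 1) ^ 2 * (L ^ L * H) * N ^ L : ℕ) : ℤ) := by
  have hmL : m ≤ L := by
    have h0 := h.ne_zero κ
    have h1 := h.degree κ
    rw [hA] at h0 h1
    have hQ0 := right_ne_zero_of_mul h0
    have hP0 := left_ne_zero_of_mul h0
    rw [totalDegree_mul_of_isDomain hP0 hQ0, totalDegree_pow_eq (pow_ne_zero_iff (by omega) |>.mp hP0)] at h1
    nlinarith
  have h1 := iterate_pderiv_bounds (h.degree κ) (h.height κ) 0 m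
  have h2 := abs_eval_le hN h1.1 h1.2 hxN
  have h3 := eval_iterate_pderiv_pow_mul 0 P x hx m Q
  rw [hA, h3] at h2
  have hne : (m.factorial : ℤ) * eval x (pderiv 0 P) ^ m * eval x Q ≠ 0 :=
    mul_ne_zero (mul_ne_zero (by exact_mod_cast m.factorial_ne_zero) (pow_ne_zero _ hx')) hQ
  have hdvd : eval x (pderiv 0 P) ∣ (m.factorial : ℤ) * eval x (pderiv 0 P) ^ m * eval x Q :=
    Dvd.dvd.mul_right (Dvd.dvd.mul_left (dvd_pow_self _ (by omega)) _) _
  have h4 : |eval x (pderiv 0 P)| ≤ |(m.factorial : ℤ) * eval x (pderiv 0 P) ^ m * eval x Q| :=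
    Int.le_of_dvd (abs_pos.mpr hne) ((abs_dvd_abs _ _).mpr hdvd)
  refine h4.trans (h2.trans ?_)
  have h5 : L ^ m ≤ L ^ L := Nat.pow_le_pow_right hL hmL
  exact_mod_cast Nat.mul_le_mul_right _ (Nat.mul_le_mul_left _ (Nat.mul_le_mul_right _ h5))

theorem totalDegree_eq_of_associated {σ R : Type*} [CommRing R] [IsDomain R]
    {P Q : MvPolynomial σ R} (h : Associated P Q) : P.totalDegree = Q.totalDegree := by
  by_cases hP : P = 0
  · rw [hP] at h ⊢
    rw [(associated_zero_iff_eq_zero Q).mp h.symm]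
  · have hQ : Q ≠ 0 := fun h0 => hP ((associated_zero_iff_eq_zero P).mp (h0 ▸ h))
    exact le_antisymm (totalDegree_le_of_dvd_of_isDomain h.dvd hQ)
      (totalDegree_le_of_dvd_of_isDomain h.symm.dvd hP)

theorem eval_eq_zero_of_dvd {σ R : Type*} [CommRing R] {P Q : MvPolynomial σ R} (h : P ∣ Q)
    {x : σ → R} (hx : eval x P = 0) : eval x Q = 0 := by
  obtain ⟨u, rfl⟩ := h
  rw [map_mul, hx, zero_mul]

theorem residueKey_succ (p : ℕ → ℕ) (a t : ℕ) {n : ℕ} (ξ : Fin n → ℤ) :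
    (fun j : Fin t => residueKey p a (t + 1) ξ j.succ) = residueKey p (a + 1) t ξ := by
  funext j i
  simp [residueKey, add_assoc, add_comm 1]

theorem CleanBlock.card_le {R : Type*} [CommRing R] [IsDomain R] [CharZero R]
    {d D k τ t s e W Y a L K : ℕ} {p : ℕ → ℕ} {f : MvPolynomial (Fin 3) ℤ}
    {S : Finset (Fin 3 → ℤ)} (h : CleanBlock Y τ d p f a ((K + 1) * t) S)
    (hpar : SurfaceParams D k τ t s e W) (hpar' : CurveParams k τ t Y) (hD : 0 < D)
    (hDd : D ≤ d) (hYs : s.factorial < Y) (hf : Prime (map (Int.castRingHom R) f))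
    (hL : 2 * (d + k) * (d + k) + (d + k) = L)
    (hK : (L + 1) ^ 2 * (L ^ L * (((L + 1) ^ 2).factorial * (Y ^ τ) ^ (L * (L + 1) ^ 2))) *
      (Y ^ τ) ^ L ≤ Y ^ K)
    (hline : ∀ ξ ∈ S, ∀ ξ' ∈ S, ¬ SpanLine f ξ ξ') :
    S.card ≤ (K * t + K + 4) * (blockBound d k t L a ((K + 1) * t) * Y ^ (2 * t + 2)) := by
  classical
  have hY := h.primes.one_le
  have hL1 : 1 ≤ L := by rw [← hL]; nlinarith
  have hMt : (K + 1) * t = K * t + t := by ring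
  set G := blockBound d k t L a ((K + 1) * t) * Y ^ (2 * t + 2) with hG
  have hcov : ∀ i, i ≤ K * t → ∃ A T, CurveCover p (a + i) t L
      (((L + 1) ^ 2).factorial * (Y ^ τ) ^ (L * (L + 1) ^ 2)) S A T := fun i hi =>
    (h.mono (Finset.Subset.refl S) (Nat.le_add_right a i) (by omega)).exists_curveCover (R := R)
      hpar hD hDd hYs hf L hL
  choose! A T hcov using hcov
  have hfac : ∀ κ P, ∃ m Q, P ∈ T 0 κ → ¬ P ∣ Q ∧ A 0 κ = P ^ m * Q := by
    intro κ P
    by_cases hP : P ∈ T 0 κ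
    · obtain ⟨m, Q, hQ⟩ := WfDvdMonoid.max_power_factor ((hcov 0 (Nat.zero_le _)).ne_zero κ)
        ((hcov 0 (Nat.zero_le _)).irreducible κ P hP)
      exact ⟨m, Q, fun _ => hQ⟩
    · exact ⟨0, 0, fun h0 => absurd h0 hP⟩
  choose m Q hfac using hfac
  let κ : ℕ → (Fin 3 → ℤ) → Fin t → Fin 3 → ℤ := fun i ξ => residueKey p (a + i) t ξ
  let S₁ := S.filter fun ξ => ∃ P ∈ T 0 (κ 0 ξ), eval (Fin.tail ξ) P = 0 ∧ P.totalDegree = 1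
  let S₂ := fun i => S.filter fun ξ => ∃ P ∈ T i (κ i ξ), eval (Fin.tail ξ) P = 0 ∧
    ¬ P ∣ A (i + 1) (κ (i + 1) ξ) ∧ eval (Fin.tail ξ) (A (i + 1) (κ (i + 1) ξ)) = 0
  let S₃ := S.filter fun ξ => ∃ P ∈ T 0 (κ 0 ξ), eval (Fin.tail ξ) P = 0 ∧
    ¬ P ∣ pderiv 0 P ∧ eval (Fin.tail ξ) (pderiv 0 P) = 0
  let S₄ := S.filter fun ξ => ∃ P ∈ T 0 (κ 0 ξ), eval (Fin.tail ξ) P = 0 ∧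
    ¬ P ∣ Q (κ 0 ξ) P ∧ eval (Fin.tail ξ) (Q (κ 0 ξ) P) = 0
  let S₅ := fun j => S.filter fun ξ => ∃ P ∈ T (j * t) (κ (j * t) ξ), eval (Fin.tail ξ) P = 0 ∧
    2 ≤ P.totalDegree ∧ ∀ i < t, ¬ (p (a + j * t + i) : ℤ) ∣ eval (Fin.tail ξ) (pderiv 0 P)
  have hd1 : 1 ≤ d := by omega
  have hc0 := hcov 0 (Nat.zero_le _)
  have hb0 : ∀ {E}, E ⊆ S → CleanBlock Y τ d p f (a + 0) t E := fun hE =>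
    h.mono hE (Nat.le_add_right _ _) (by omega)
  have hbez : bezoutBound L ≤ bezoutBound (L + k + 1) + (bezoutBound (d + k + 1) + 1) :=
    (bezoutBound_mono (by omega)).trans (Nat.le_add_right _ _)
  have hS₁ : S₁.card ≤ G := by
    have hsub : S₁ ⊆ S := Finset.filter_subset _ _
    refine ((hb0 hsub).card_le_of_linear hpar' (hc0.mono hsub)
      (fun ξ hξ ξ' hξ' => hline ξ (hsub hξ) ξ' (hsub hξ'))
      fun ξ hξ => (Finset.mem_filter.mp hξ).2).trans ?_
    exact mul_le_blockBound_mul hd1 hY (Nat.mul_le_mul_left _ (Nat.le_add_left _ _))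
      (by omega) (by omega)
  have hS₂ : ∀ i < K * t, (S₂ i).card ≤ G := by
    intro i hi
    have hsub : S₂ i ⊆ S := Finset.filter_subset _ _
    have hci := hcov i hi.le
    have hci' := hcov (i + 1) hi
    refine ((h.mono (M' := t + 1) hsub (Nat.le_add_right a i)
      (by omega)).card_le_of_common_zero (L := L)
      (fun κ' => T i fun j => κ' j.castSucc) (fun _ => hci.card _) (fun _ => hci.irreducible _)
      (fun _ P hP => hci.degree_le hP) (fun κ' _ => A (i + 1) fun j => κ' j.succ)
      (fun _ _ _ => hci'.degree _) ?_).trans ?_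
    · intro ξ hξ
      have h1 := (Finset.mem_filter.mp hξ).2
      rw [residueKey_succ]
      exact h1
    · exact mul_le_blockBound_mul hd1 hY (Nat.mul_le_mul_left _ hbez) (by omega) le_rfl
  have hS₃ : S₃.card ≤ G := by
    have hsub : S₃ ⊆ S := Finset.filter_subset _ _
    refine ((hb0 hsub).card_le_of_common_zero (T 0) hc0.card hc0.irreducible
      (fun _ P hP => hc0.degree_le hP) (fun _ P => pderiv 0 P)
      (fun _ P hP => (totalDegree_pderiv_le _ _).trans (hc0.degree_le hP))
      fun ξ hξ => (Finset.mem_filter.mp hξ).2).trans ?_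
    exact mul_le_blockBound_mul hd1 hY (Nat.mul_le_mul_left _ hbez) (by omega) (by omega)
  have hS₄ : S₄.card ≤ G := by
    have hsub : S₄ ⊆ S := Finset.filter_subset _ _
    refine ((hb0 hsub).card_le_of_common_zero (T 0) hc0.card hc0.irreducible
      (fun _ P hP => hc0.degree_le hP) Q (fun κ' P hP => ?_)
      fun ξ hξ => (Finset.mem_filter.mp hξ).2).trans ?_
    · refine (totalDegree_le_of_dvd_of_isDomain ?_ (hc0.ne_zero κ')).trans (hc0.degree κ')
      rw [(hfac κ' P hP).2]
      exact dvd_mul_left _ _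
    · exact mul_le_blockBound_mul hd1 hY (Nat.mul_le_mul_left _ hbez) (by omega) (by omega)
  have hjt : ∀ j < K + 1, j * t ≤ K * t := fun j hj => Nat.mul_le_mul_right _ (by omega)
  have hS₅ : ∀ j < K + 1, (S₅ j).card ≤ G := by
    intro j hj
    have hsub : S₅ j ⊆ S := Finset.filter_subset _ _
    have hle := hjt j hj
    refine ((h.mono (M' := t) hsub (Nat.le_add_right a (j * t))
      (by omega)).card_le_of_nonlinear hpar' ((hcov _ hle).mono hsub)
      fun ξ hξ => (Finset.mem_filter.mp hξ).2).trans ?_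
    exact mul_le_blockBound_mul hd1 hY (Nat.mul_le_mul_left _ (Nat.le_add_right _ _))
      (by omega) (by omega)
  have hcover : S ⊆ S₁ ∪ (Finset.range (K * t)).biUnion S₂ ∪ S₃ ∪ S₄ ∪
      (Finset.range (K + 1)).biUnion S₅ := by
    intro ξ hξ
    simp only [Finset.mem_union, Finset.mem_biUnion, Finset.mem_range]
    obtain ⟨P, hP, hPξ⟩ := hc0.exists_factor _ _ (hc0.eval_eq_zero ξ hξ)
    have hPi := hc0.irreducible _ P hP
    have hP0 : P.totalDegree ≠ 0 := fun h0 =>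
      eval_ne_zero_of_totalDegree_eq_zero hPi.ne_zero h0 _ hPξ
    by_cases hP1 : P.totalDegree = 1
    · exact Or.inl (Or.inl (Or.inl (Or.inl (Finset.mem_filter.mpr ⟨hξ, P, hP, hPξ, hP1⟩))))
    have hP2 : 2 ≤ P.totalDegree := by omega
    by_cases hall : ∀ i ≤ K * t, P ∣ A i (κ i ξ)
    · by_cases hsing : eval (Fin.tail ξ) (pderiv 0 P) = 0
      · exact Or.inl (Or.inl (Or.inr (Finset.mem_filter.mpr ⟨hξ, P, hP, hPξ,
          not_dvd_pderiv_zero (pderiv_zero_ne_zero_of_irreducible hPi hP2 hPξ), hsing⟩)))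
      obtain ⟨hPQ, hPm⟩ := hfac _ P hP
      by_cases hQ0 : eval (Fin.tail ξ) (Q (κ 0 ξ) P) = 0
      · exact Or.inl (Or.inr (Finset.mem_filter.mpr ⟨hξ, P, hP, hPξ, hPQ, hQ0⟩))
      have hm1 : 1 ≤ m (κ 0 ξ) P := by
        by_contra hm0
        have h1 := hc0.dvd _ P hP
        rw [hPm, show m (residueKey p (a + 0) t ξ) P = 0 by
          have : ¬ 1 ≤ m (residueKey p (a + 0) t ξ) P := hm0
          omega, pow_zero, one_mul] at h1
        exact hPQ h1
      have hbd := hc0.abs_eval_pderiv_le hL1 (Nat.one_le_pow τ Y hY) (by omega) hm1 hPm hPξ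
        (fun i => h.abs_le ξ hξ i.succ) hsing hQ0
      have hbd' : |eval (Fin.tail ξ) (pderiv 0 P)| ≤ (Y : ℤ) ^ K :=
        hbd.trans (by exact_mod_cast hK)
      obtain ⟨j, hj, hjp⟩ := exists_block_not_dvd h.primes.prime h.primes.strictMono hY
        h.primes.lt hsing hbd' t a
      obtain ⟨P', hP', hass⟩ := (hcov _ (hjt j hj)).exists_associated _ P hPi
        (hall _ (hjt j hj)) (by omega)
      refine Or.inr ⟨j, hj, Finset.mem_filter.mpr ⟨hξ, P', hP',
        eval_eq_zero_of_dvd hass.dvd hPξ, ?_, fun i hi => ?_⟩⟩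
      · rwa [← totalDegree_eq_of_associated hass]
      · obtain ⟨u, rfl⟩ := hass
        rw [eval_pderiv_mul_of_eval_eq_zero 0 hPξ,
          (u.isUnit.map (eval (Fin.tail ξ))).dvd_mul_right, add_assoc]
        exact hjp i hi
    · have hex : ∃ i, i ≤ K * t ∧ ¬ P ∣ A i (κ i ξ) := by
        push Not at hall
        exact hall
      obtain ⟨hile, hndvd⟩ := Nat.find_spec hex
      have hmin := fun i => Nat.find_min hex (m := i)
      set i₀ := Nat.find hex
      have hi0 : i₀ ≠ 0 := by
        intro h0
        rw [h0] at hndvd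
        exact hndvd (hc0.dvd _ P hP)
      obtain ⟨i, hi⟩ := Nat.exists_eq_succ_of_ne_zero hi0
      rw [hi] at hndvd hile
      have hdvd : P ∣ A i (κ i ξ) := by
        by_contra hcon
        exact hmin i (by omega) ⟨by omega, hcon⟩
      obtain ⟨P', hP', hass⟩ := (hcov i (by omega)).exists_associated _ P hPi hdvd (by omega)
      refine Or.inl (Or.inl (Or.inl (Or.inr ⟨i, by omega, Finset.mem_filter.mpr
        ⟨hξ, P', hP', eval_eq_zero_of_dvd hass.dvd hPξ, fun h0 => hndvd (hass.dvd.trans h0), ?_⟩⟩)))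
      exact (hcov (i + 1) hile).eval_eq_zero ξ hξ
  have hU₂ := Finset.card_biUnion_le_card_mul (Finset.range (K * t)) S₂ G
    fun i hi => hS₂ i (Finset.mem_range.mp hi)
  have hU₅ := Finset.card_biUnion_le_card_mul (Finset.range (K + 1)) S₅ G
    fun i hi => hS₅ i (Finset.mem_range.mp hi)
  rw [Finset.card_range] at hU₂ hU₅
  have h1 := Finset.card_le_card hcover
  have h2 := Finset.card_union_le (S₁ ∪ (Finset.range (K * t)).biUnion S₂ ∪ S₃ ∪ S₄)
    ((Finset.range (K + 1)).biUnion S₅)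
  have h3 := Finset.card_union_le (S₁ ∪ (Finset.range (K * t)).biUnion S₂ ∪ S₃) S₄
  have h4 := Finset.card_union_le (S₁ ∪ (Finset.range (K * t)).biUnion S₂) S₃
  have h5 := Finset.card_union_le S₁ ((Finset.range (K * t)).biUnion S₂)
  nlinarith

theorem pderiv_zero_ne_zero_of_coeff_ne_zero {R : Type*} [CommRing R] [IsDomain R] [CharZero R]
    {n d : ℕ} (hd : 1 ≤ d) {f : MvPolynomial (Fin (n + 1)) R}
    (hc : coeff (Finsupp.single 0 d) f ≠ 0) : pderiv 0 f ≠ 0 := by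
  intro h
  have h1 : Polynomial.derivative (finSuccEquiv R n f) = 0 := by
    rw [← finSuccEquiv_pderiv_zero, h, map_zero]
  have h2 := Polynomial.derivative_eq_zero.mp h1
  rw [natDegree_finSuccEquiv] at h2
  have h3 := le_degreeOf_of_coeff_ne_zero hc
  omega

theorem mul_pow_le_pow_succ {c Y b : ℕ} (h : c ≤ Y) : c * Y ^ b ≤ Y ^ (1 + b) := by
  rw [pow_add, pow_one]
  exact Nat.mul_le_mul_right _ h

theorem exists_card_le_of_not_spanLine {R : Type*} [CommRing R] [IsDomain R] [CharZero R]
    {d D k τ t s e W : ℕ} (hpar : SurfaceParams D k τ t s e W)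
    (hbound : τ * ((k + 1) * (k + 1)) + 1 ≤ t * ((k + 1) * (2 * k + 1))) (hD : 0 < D)
    (hDd : D ≤ d) (h : ℕ) :
    ∃ C Y₀ : ℕ, ∀ Y ≥ Y₀, ∀ f : MvPolynomial (Fin 3) ℤ, Prime (map (Int.castRingHom R) f) →
      f.totalDegree ≤ d → coeff (Finsupp.single 0 d) f ≠ 0 →
      (∀ m, |coeff m f| ≤ (Y ^ h : ℕ)) → ∀ E : Finset (Fin 3 → ℤ),
      (∀ ξ ∈ E, eval ξ f = 0 ∧ ∀ i, |ξ i| ≤ (Y ^ τ : ℕ)) →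
      (∀ ξ ∈ E, ∀ ξ' ∈ E, ¬ SpanLine f ξ ξ') → E.card ≤ C * (Y ^ (2 * t + 2) + Y ^ τ) := by
  classical
  obtain ⟨L, hL⟩ : ∃ L, 2 * (d + k) * (d + k) + (d + k) = L := ⟨_, rfl⟩
  set K := 1 + (τ * (L * (L + 1) ^ 2) + τ * L) with hK
  set K₀ := 1 + (h + τ * d) with hK₀
  set M := (K + 1) * t with hM
  set c₁ := (L + 1) ^ 2 * (L ^ L * ((L + 1) ^ 2).factorial) with hc₁
  set c₂ := (d + 1) ^ 3 * d with hc₂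
  refine ⟨(∑ j ∈ Finset.range (K₀ + 1), (K * t + K + 4) * blockBound d k t L (j * M) M) +
    d * ((2 * d * d + d) * 3), c₁ + c₂ + s.factorial +
    (2 * (k + 1)).factorial * 2 ^ ((k + 1) * (k + 1)) + 1, ?_⟩
  intro Y hY f hf hfd hc hH E hE hline
  have hY1 : 1 ≤ Y := by omega
  have hd1 : 1 ≤ d := by omega
  obtain ⟨p, hp1, hp2, hp3, hp4⟩ := exists_prime_sequence Y hY1
  have hp : PrimeSequence Y p := ⟨hY1, hp1, hp2, hp3, hp4⟩
  have hN1 : 1 ≤ Y ^ τ := Nat.one_le_pow _ _ hY1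
  have hinj : Function.Injective (Int.castRingHom R) := Int.cast_injective
  have hcK : coeff (Finsupp.single 0 d) (map (Int.castRingHom R) f) ≠ 0 := by
    rw [coeff_map]
    exact fun h0 => hc (hinj (by rw [h0, map_zero]))
  have hfdK : (map (Int.castRingHom R) f).totalDegree ≤ d :=
    (totalDegree_map_le_totalDegree _ _).trans hfd
  let E₀ := E.filter fun ξ => eval ξ (pderiv 0 f) = 0
  let S := fun j => E.filter fun ξ => ∀ i < M, ¬ (p (j * M + i) : ℤ) ∣ eval ξ (pderiv 0 f)
  have hE₀ : E₀.card ≤ d * ((2 * d * d + d) * 3) * Y ^ τ := by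
    have h1 := card_le_of_not_dvd (N := Y ^ τ) hfdK hcK hf
      (not_dvd_pderiv_zero (pderiv_zero_ne_zero_of_coeff_ne_zero hd1 hcK)) le_rfl
      ((totalDegree_pderiv_le 0 _).trans hfdK) E₀ (by
        intro ξ hξ
        obtain ⟨hξE, hξ0⟩ := Finset.mem_filter.mp hξ
        refine ⟨?_, ?_, (hE ξ hξE).2⟩
        · rw [eval_map_intCast, (hE ξ hξE).1, Int.cast_zero]
        · rw [pderiv_map, eval_map_intCast, hξ0, Int.cast_zero])
    refine h1.trans ?_
    calc d * ((2 * d * d + d) * (2 * Y ^ τ + 1) ^ 1)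
        ≤ d * ((2 * d * d + d) * (3 * Y ^ τ)) := by rw [pow_one]; gcongr; omega
      _ = _ := by ring
  have hS : ∀ j, (S j).card ≤
      (K * t + K + 4) * blockBound d k t L (j * M) M * Y ^ (2 * t + 2) := by
    intro j
    have hsub : S j ⊆ E := Finset.filter_subset _ _
    have hblock : CleanBlock Y τ d p f (j * M) ((K + 1) * t) (S j) :=
      ⟨hp, hfd, hc, fun ξ hξ => (hE ξ (hsub hξ)).1, fun ξ hξ => (hE ξ (hsub hξ)).2,
        fun ξ hξ => (Finset.mem_filter.mp hξ).2⟩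
    have h1 := hblock.card_le (R := R) hpar ⟨hbound, by omega⟩ hD hDd (by omega) hf hL
      (by
        have h2 : (L + 1) ^ 2 * (L ^ L * (((L + 1) ^ 2).factorial *
            (Y ^ τ) ^ (L * (L + 1) ^ 2))) * (Y ^ τ) ^ L =
            c₁ * Y ^ (τ * (L * (L + 1) ^ 2) + τ * L) := by
          rw [pow_add, pow_mul, pow_mul, hc₁]
          ring
        rw [h2]
        exact mul_pow_le_pow_succ (by omega))
      (fun ξ hξ ξ' hξ' => hline ξ (hsub hξ) ξ' (hsub hξ'))
    rwa [mul_assoc]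
  have hcover : E ⊆ E₀ ∪ (Finset.range (K₀ + 1)).biUnion S := by
    intro ξ hξ
    rw [Finset.mem_union, Finset.mem_biUnion]
    by_cases h0 : eval ξ (pderiv 0 f) = 0
    · exact Or.inl (Finset.mem_filter.mpr ⟨hξ, h0⟩)
    · have h1 := iterate_pderiv_bounds hfd hH 0 1
      rw [Function.iterate_one, pow_one] at h1
      have h2 := abs_eval_le hN1 h1.1 h1.2 (hE ξ hξ).2
      have h3 : |eval ξ (pderiv 0 f)| ≤ (Y : ℤ) ^ K₀ := by
        refine h2.trans ?_
        have h4 : (d + 1) ^ 3 * (d * Y ^ h) * (Y ^ τ) ^ d = c₂ * Y ^ (h + τ * d) := by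
          rw [pow_add, pow_mul, hc₂]
          ring
        rw [h4]
        exact_mod_cast mul_pow_le_pow_succ (by omega)
      obtain ⟨j, hj, hjp⟩ := exists_block_not_dvd hp1 hp2 hY1 hp3 h0 h3 M 0
      refine Or.inr ⟨j, Finset.mem_range.mpr hj, Finset.mem_filter.mpr ⟨hξ, fun i hi => ?_⟩⟩
      have := hjp i hi
      rwa [zero_add] at this
  have h1 : ((Finset.range (K₀ + 1)).biUnion S).card ≤
      (∑ j ∈ Finset.range (K₀ + 1), (K * t + K + 4) * blockBound d k t L (j * M) M) *
        Y ^ (2 * t + 2) := by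
    rw [Finset.sum_mul]
    exact Finset.card_biUnion_le.trans (Finset.sum_le_sum fun j _ => hS j)
  have h2 := (Finset.card_le_card hcover).trans (Finset.card_union_le _ _)
  refine h2.trans ?_
  rw [mul_add, add_comm]
  refine add_le_add (h1.trans (Nat.mul_le_mul_right _ (Nat.le_add_right _ _)))
    (hE₀.trans (Nat.mul_le_mul_right _ (Nat.le_add_left _ _)))

theorem eval_mul_of_isHomogeneous {σ R : Type*} [CommRing R] {F : MvPolynomial σ R} {d : ℕ}
    (hF : F.IsHomogeneous d) (a : R) (x : σ → R) :
    eval (fun i => a * x i) F = a ^ d * eval x F := by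
  rw [eval_eq, eval_eq, Finset.mul_sum]
  refine Finset.sum_congr rfl fun m hm => ?_
  have h := hF.degree_eq_sum_deg_support hm
  simp only [mul_pow, Finset.prod_mul_distrib, Finset.prod_pow_eq_pow_sum]
  rw [h]
  ring

/-- A primitive integer vector: one that some integral linear form maps to `1`. -/
def IsPrimitiveVector {n : ℕ} (v : Fin n → ℤ) : Prop :=
  ∃ c : Fin n → ℤ, ∑ i, c i * v i = 1

theorem IsPrimitiveVector.exists_eq_mul {n : ℕ} {v u : Fin n → ℤ} (hv : IsPrimitiveVector v)
    (h : ∀ i j, u i * v j = u j * v i) : ∃ m : ℤ, ∀ i, u i = m * v i := by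
  obtain ⟨c, hc⟩ := hv
  refine ⟨∑ j, c j * u j, fun i => ?_⟩
  rw [← mul_one (u i), ← hc, Finset.mul_sum, Finset.sum_mul]
  refine Finset.sum_congr rfl fun j _ => ?_
  linear_combination c j * h i j

theorem IsPrimitiveVector.exists_ne_zero {n : ℕ} {v : Fin n → ℤ} (hv : IsPrimitiveVector v) :
    ∃ i, v i ≠ 0 := by
  obtain ⟨c, hc⟩ := hv
  by_contra! h
  simp [h] at hc

theorem IsPrimitiveVector.eq_or_eq_neg {n : ℕ} {v u : Fin n → ℤ} (hv : IsPrimitiveVector v)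
    (hu : IsPrimitiveVector u) (h : ∀ i j, u i * v j = u j * v i) : u = v ∨ u = -v := by
  obtain ⟨m, hm⟩ := hv.exists_eq_mul h
  obtain ⟨c, hc⟩ := hu
  have h1 : m * (∑ i, c i * v i) = 1 := by
    rw [← hc, Finset.mul_sum]
    exact Finset.sum_congr rfl fun i _ => by rw [hm i]; ring
  rcases Int.isUnit_iff.mp (IsUnit.of_mul_eq_one _ h1) with h2 | h2
  · exact Or.inl (funext fun i => by rw [hm i, h2, one_mul])
  · exact Or.inr (funext fun i => by rw [hm i, h2, Pi.neg_apply]; ring)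

theorem exists_primitive_eq_mul {n : ℕ} {v : Fin n → ℤ} (hv : v ≠ 0) :
    ∃ (g : ℤ) (w : Fin n → ℤ), IsPrimitiveVector w ∧ ∀ i, v i = g * w i := by
  obtain ⟨g, hg⟩ := (IsPrincipalIdealRing.principal (Ideal.span (Set.range v))).principal
  have hmem : ∀ i, g ∣ v i := fun i => by
    rw [← Ideal.mem_span_singleton, ← Ideal.submodule_span_eq, ← hg]
    exact Ideal.subset_span ⟨i, rfl⟩
  choose w hw using hmem
  have hg0 : g ≠ 0 := by
    rintro rfl
    exact hv (funext fun i => by rw [hw i, zero_mul, Pi.zero_apply])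
  have hgm : g ∈ Ideal.span (Set.range v) := by
    rw [hg]
    exact Submodule.mem_span_singleton_self g
  obtain ⟨c, hc⟩ := Ideal.mem_span_range_iff_exists_fun.mp hgm
  refine ⟨g, w, ⟨c, ?_⟩, hw⟩
  refine mul_left_cancel₀ hg0 ?_
  rw [Finset.mul_sum, mul_one, ← hc]
  refine Finset.sum_congr rfl fun i _ => ?_
  rw [hw i, hc]
  ring

theorem card_le_two_of_parallel {n : ℕ} (V : Finset (Fin n → ℤ))
    (hV : ∀ v ∈ V, IsPrimitiveVector v) (h : ∀ v ∈ V, ∀ u ∈ V, ∀ i j, u i * v j = u j * v i) :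
    V.card ≤ 2 := by
  classical
  rcases V.eq_empty_or_nonempty with rfl | ⟨v, hv⟩
  · simp
  have hsub : V ⊆ {v, -v} := by
    intro u hu
    rw [Finset.mem_insert, Finset.mem_singleton]
    exact (hV v hv).eq_or_eq_neg (hV u hu) (h v hv u hu)
  exact (Finset.card_le_card hsub).trans Finset.card_le_two

/-- `F` does not vanish identically on any plane through the origin. -/
def NonvanishingOnPlanes {K : Type*} [Field K] (F : MvPolynomial (Fin 3) K) : Prop :=
  ∀ u w : Fin 3 → K, (∃ i j, u i * w j ≠ u j * w i) →
    ∃ a b : K, eval (fun i => a * u i + b * w i) F ≠ 0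

theorem eval_plane_eq_zero {K : Type*} [Field K] {F : MvPolynomial (Fin 3) K} {d : ℕ}
    (hF : F.IsHomogeneous d) {u w : Fin 3 → K} (hu : eval u F = 0)
    (h : ∀ s : K, eval (fun i => w i + s * u i) F = 0) (a b : K) :
    eval (fun i => a * u i + b * w i) F = 0 := by
  by_cases hb : b = 0
  · have h1 : (fun i => a * u i + b * w i) = fun i => a * u i := by
      funext i; rw [hb]; ring
    rw [h1, eval_mul_of_isHomogeneous hF, hu, mul_zero]
  · have h1 : (fun i => a * u i + b * w i) = fun i => b * (w i + a / b * u i) := by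
      funext i; field_simp; ring
    rw [h1, eval_mul_of_isHomogeneous hF, h, mul_zero]

theorem plane_coordinates {R : Type*} [CommRing R] {u w v : Fin 3 → R}
    (h : Matrix.det (Matrix.of ![u, w, v]) = 0) (i j k : Fin 3) :
    (u i * w j - u j * w i) * v k =
      (v i * w j - v j * w i) * u k + (u i * v j - u j * v i) * w k := by
  rw [Matrix.det_fin_three] at h
  simp only [Matrix.of_apply, Matrix.cons_val_zero, Matrix.cons_val_one, Matrix.cons_val] at h
  fin_cases i <;> fin_cases j <;> fin_cases k <;>
    simp only [Fin.zero_eta, Fin.mk_one, Fin.reduceFinMk] <;>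
    first
      | ring1
      | linear_combination h
      | linear_combination -h

theorem card_primitive_zeros_in_plane_le {K : Type*} [Field K] [CharZero K]
    {F : MvPolynomial (Fin 3) K} {d : ℕ} (hF : F.IsHomogeneous d)
    (hFp : NonvanishingOnPlanes F) (V : Finset (Fin 3 → ℤ))
    (hV : ∀ v ∈ V, IsPrimitiveVector v ∧ eval (fun i => (v i : K)) F = 0)
    (hdet : ∀ u ∈ V, ∀ w ∈ V, ∀ v ∈ V, Matrix.det (Matrix.of ![u, w, v]) = 0) :
    V.card ≤ 2 * (d + 1) := by
  classical
  by_cases hpar : ∀ v ∈ V, ∀ u ∈ V, ∀ i j, u i * v j = u j * v i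
  · have := card_le_two_of_parallel V (fun v hv => (hV v hv).1) hpar
    omega
  push Not at hpar
  obtain ⟨w, hw, u, hu, i, j, hij⟩ := hpar
  have hδ : ((u i * w j - u j * w i : ℤ) : K) ≠ 0 := by
    rw [Int.cast_ne_zero]
    exact sub_ne_zero.mpr hij
  set α : (Fin 3 → ℤ) → K := fun v => ((v i * w j - v j * w i : ℤ) : K)
  set β : (Fin 3 → ℤ) → K := fun v => ((u i * v j - u j * v i : ℤ) : K)
  set δ : K := ((u i * w j - u j * w i : ℤ) : K)
  have hcoord : ∀ v ∈ V, ∀ k, δ * (v k : K) = α v * u k + β v * w k := by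
    intro v hv k
    have := plane_coordinates (hdet u hu w hw v hv) i j k
    simp only [δ, α, β]
    exact_mod_cast congrArg (Int.cast : ℤ → K) this
  set p := lineRestriction (fun k => (u k : K)) (fun k => (w k : K)) F with hp
  have hp0 : p ≠ 0 := by
    intro h0
    obtain ⟨a, b, hab⟩ := hFp (fun k => (u k : K)) (fun k => (w k : K))
      ⟨i, j, fun h => hδ (by simp only [δ]; push_cast; rw [h, sub_self])⟩
    refine hab (eval_plane_eq_zero hF (hV u hu).2 (fun s => ?_) a b)
    rw [← eval_lineRestriction, ← hp, h0, Polynomial.eval_zero]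
  set φ : (Fin 3 → ℤ) → Option K := fun v => if β v = 0 then none else some (α v / β v)
  have himage : V.image φ ⊆ Finset.insertNone p.roots.toFinset := by
    intro o ho
    obtain ⟨v, hv, rfl⟩ := Finset.mem_image.mp ho
    by_cases hb : β v = 0
    · simp [φ, hb]
    · have hroot : p.IsRoot (α v / β v) := by
        have h1 : (fun k => (w k : K) + α v / β v * u k) = fun k => δ / β v * v k := by
          funext k
          have := hcoord v hv k
          field_simp
          linear_combination -this
        rw [Polynomial.IsRoot, hp, eval_lineRestriction, h1, eval_mul_of_isHomogeneous hF,
          (hV v hv).2, mul_zero]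
      simp only [φ, if_neg hb]
      rw [Finset.some_mem_insertNone, Multiset.mem_toFinset, Polynomial.mem_roots hp0]
      exact hroot
  have hcard : (V.image φ).card ≤ d + 1 := by
    refine (Finset.card_le_card himage).trans ?_
    rw [Finset.card_insertNone]
    refine Nat.add_le_add_right ((Multiset.toFinset_card_le _).trans ?_) 1
    exact (Polynomial.card_roots' _).trans
      (natDegree_lineRestriction_le _ _ hF.totalDegree_le)
  have hfib := Finset.card_le_mul_card_image (f := φ) V 2 fun o _ => by
    refine card_le_two_of_parallel _ (fun v hv => (hV v (Finset.mem_filter.mp hv).1).1) ?_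
    intro v hv v' hv' k l
    obtain ⟨hvV, hvo⟩ := Finset.mem_filter.mp hv
    obtain ⟨hvV', hvo'⟩ := Finset.mem_filter.mp hv'
    have h1 : φ v' = φ v := hvo'.trans hvo.symm
    have h2 : α v' * β v = β v' * α v := by
      by_cases hb : β v = 0
      · by_cases hb' : β v' = 0
        · rw [hb, hb']; ring
        · simp [φ, hb, hb'] at h1
      · by_cases hb' : β v' = 0
        · simp [φ, hb, hb'] at h1
        · simp only [φ, if_neg hb, if_neg hb', Option.some.injEq] at h1
          field_simp at h1
          linear_combination h1
    have h3 : δ ^ 2 * ((v' k : K) * v l - v' l * v k) = 0 := by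
      have hk := hcoord v hvV k
      have hl := hcoord v hvV l
      have hk' := hcoord v' hvV' k
      have hl' := hcoord v' hvV' l
      linear_combination δ * v l * hk' + (α v' * u k + β v' * w k) * hl - δ * v k * hl' -
        (α v' * u l + β v' * w l) * hk + (u k * w l - u l * w k) * h2
    have h4 := (mul_eq_zero.mp h3).resolve_left (pow_ne_zero 2 hδ)
    exact_mod_cast sub_eq_zero.mp h4
  exact hfib.trans (Nat.mul_le_mul_left _ hcard)

theorem dvd_det_of_dvd_det_normalized {q : ℕ} {u w v : Fin 3 → ℤ} {a b c : ℤ}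
    (ha : (q : ℤ) ∣ a * u 1 - 1) (hb : (q : ℤ) ∣ b * w 1 - 1) (hc : (q : ℤ) ∣ c * v 1 - 1)
    (h : (q : ℤ) ∣ Matrix.det (Matrix.of
      ![![a * u 0, 1, a * u 2], ![b * w 0, 1, b * w 2], ![c * v 0, 1, c * v 2]])) :
    (q : ℤ) ∣ Matrix.det (Matrix.of ![u, w, v]) := by
  rw [Matrix.det_fin_three] at h ⊢
  simp only [Matrix.of_apply, Matrix.cons_val_zero, Matrix.cons_val_one, Matrix.cons_val] at h ⊢
  obtain ⟨a', ha⟩ := ha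
  obtain ⟨b', hb⟩ := hb
  obtain ⟨c', hc⟩ := hc
  obtain ⟨m, hm⟩ := h
  have ha := congrArg (Int.cast : ℤ → ZMod q) ha
  have hb := congrArg (Int.cast : ℤ → ZMod q) hb
  have hc := congrArg (Int.cast : ℤ → ZMod q) hc
  have hm := congrArg (Int.cast : ℤ → ZMod q) hm
  push_cast at ha hb hc hm
  rw [CharP.cast_eq_zero, zero_mul] at ha hb hc hm
  rw [← ZMod.intCast_zmod_eq_zero_iff_dvd]
  push_cast
  have hab : (a : ZMod q) * u 1 * (b * w 1) = 1 := by
    linear_combination (b * w 1 : ZMod q) * ha + hb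
  have hac : (a : ZMod q) * u 1 * (c * v 1) = 1 := by
    linear_combination (c * v 1 : ZMod q) * ha + hc
  have hbc : (b : ZMod q) * w 1 * (c * v 1) = 1 := by
    linear_combination (c * v 1 : ZMod q) * hb + hc
  linear_combination (u 1 * w 1 * v 1 : ZMod q) * hm
    - (u 0 * w 1 * v 2 - u 2 * w 1 * v 0 : ZMod q) * hac
    - (u 2 * w 0 * v 1 - u 0 * w 2 * v 1 : ZMod q) * hab
    - (u 1 * w 2 * v 0 - u 1 * w 0 * v 2 : ZMod q) * hbc

theorem abs_det_lt_of_two_mul_lt {H p : ℕ} (hHp : 2 * H < p) {u w v : Fin 3 → ℤ}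
    (hu : ∀ i, |u i| ≤ H) (hw : ∀ i, |w i| ≤ H) (hv : ∀ i, |v i| ≤ H) :
    |Matrix.det (Matrix.of ![u, w, v])| < (p : ℤ) ^ 3 := by
  have h := Matrix.det_le (A := Matrix.of ![u, w, v]) (abv := AbsoluteValue.abs) (x := (H : ℤ))
    (fun i j => by fin_cases i <;> simp [hu, hw, hv])
  rw [AbsoluteValue.abs_apply] at h
  refine h.trans_lt ?_
  have h1 : ((2 * H + 1 : ℕ) : ℤ) ^ 3 ≤ (p : ℤ) ^ 3 := by gcongr; exact_mod_cast hHp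
  refine lt_of_lt_of_le ?_ h1
  have h2 : (0 : ℤ) ≤ H := by positivity
  simp [Nat.factorial]
  nlinarith [pow_nonneg h2 3, pow_nonneg h2 2]

theorem card_directions_mod_prime_le {K : Type*} [Field K] [CharZero K]
    {F : MvPolynomial (Fin 3) K} {d : ℕ} (hF : F.IsHomogeneous d) (hFp : NonvanishingOnPlanes F)
    {p H : ℕ} (hp : p.Prime) (hHp : 2 * H < p) {G : MvPolynomial (Fin 3) ℤ} {D : ℕ}
    (hG : G.IsHomogeneous D) (hD : D ≤ d) (V : Finset (Fin 3 → ℤ))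
    (hV : ∀ v ∈ V, IsPrimitiveVector v ∧ eval (fun i => (v i : K)) F = 0)
    (hVG : ∀ v ∈ V, v 1 ≠ 0 ∧ (∀ i, |v i| ≤ H) ∧ eval v G = 0 ∧
      ¬ (p : ℤ) ∣ eval v (pderiv 0 G)) :
    V.card ≤ 2 * (d + 1) * (d * p) := by
  classical
  have hpp : Prime (p : ℤ) := Nat.prime_iff_prime_int.mp hp
  have hinv : ∀ v ∈ V, ∃ w : ℤ, (p : ℤ) ^ 3 ∣ w * v 1 - 1 := by
    intro v hv
    obtain ⟨h1, h2, -⟩ := hVG v hv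
    have h3 : ¬ (p : ℤ) ∣ v 1 := fun h => h1 (Int.eq_zero_of_abs_lt_dvd h (by have := h2 1; omega))
    obtain ⟨a, b, hab⟩ := ((hpp.coprime_iff_not_dvd.mpr h3).pow_left (m := 3))
    exact ⟨b, -a, by linear_combination hab⟩
  choose! w hw using hinv
  obtain ⟨θ, hθ⟩ : ∃ θ : Fin 3 → MvPolynomial (Fin 2) ℤ, θ = ![X 0, 1, X 1] := ⟨_, rfl⟩
  obtain ⟨g, hg⟩ : ∃ g, aeval θ G = g := ⟨_, rfl⟩
  have hgd : g.totalDegree ≤ d := by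
    rw [← hg]
    refine (totalDegree_aeval_le (fun i => ?_) G).trans (hG.totalDegree_le.trans hD)
    subst hθ
    fin_cases i <;> simp
  have hpd : pderiv 0 g = aeval θ (pderiv 0 G) := by
    rw [← hg]
    refine pderiv_aeval_eq 0 0 (fun i => ?_) G
    subst hθ
    fin_cases i <;> simp [pderiv_X]
  let η : (Fin 3 → ℤ) → Fin 2 → ℤ := fun v => ![w v * v 0, w v * v 2]
  have hcong : ∀ v ∈ V, ∀ P : MvPolynomial (Fin 3) ℤ, ∀ n, P.IsHomogeneous n →
      (p : ℤ) ^ 3 ∣ eval (η v) (aeval θ P) - w v ^ n * eval v P := by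
    intro v hv P n hP
    rw [eval_aeval_eq, ← eval_mul_of_isHomogeneous hP]
    refine dvd_eval_sub_eval P fun i => ?_
    subst hθ
    fin_cases i
    · simp [η]
    · simp only [Fin.mk_one, Matrix.cons_val_one, Matrix.cons_val_zero, map_one]
      rw [← neg_sub, dvd_neg]
      exact hw v hv
    · simp [η]
  have hdvd : ∀ v ∈ V, (p : ℤ) ^ 3 ∣ eval (η v) g := by
    intro v hv
    have h := hcong v hv G D hG
    rwa [(hVG v hv).2.2.1, mul_zero, sub_zero, hg] at h
  have hpw : ∀ v ∈ V, ¬ (p : ℤ) ∣ w v := by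
    intro v hv h
    have h1 := (dvd_pow_self (p : ℤ) (three_ne_zero)).trans (hw v hv)
    exact hpp.not_dvd_one ((dvd_sub_right (h.mul_right _)).mp h1)
  have hndvd : ∀ v ∈ V, ¬ (p : ℤ) ∣ eval (η v) (pderiv 0 g) := by
    intro v hv h
    have h1 := (dvd_pow_self (p : ℤ) (three_ne_zero)).trans (hcong v hv (pderiv 0 G) _ hG.pderiv)
    rw [← hpd] at h1
    rcases hpp.dvd_or_dvd ((dvd_sub_right h).mp h1) with h2 | h2
    · exact hpw v hv (hpp.dvd_of_dvd_pow h2)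
    · exact (hVG v hv).2.2.2 h2
  let key : (Fin 3 → ℤ) → Fin 2 → ℤ := fun v k => η v k % (p : ℤ)
  have himage : (V.image key).card ≤ d * p := by
    have h := card_image_emod_le hp hgd (V.image η) (by
      intro ξ hξ
      obtain ⟨v, hv, rfl⟩ := Finset.mem_image.mp hξ
      exact ⟨(dvd_pow_self (p : ℤ) (three_ne_zero)).trans (hdvd v hv), hndvd v hv⟩)
    rw [Finset.image_image, pow_one] at h
    exact h
  refine (Finset.card_le_mul_card_image (f := key) V (2 * (d + 1)) fun κ _ => ?_).trans
    (Nat.mul_le_mul_left _ himage)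
  refine card_primitive_zeros_in_plane_le hF hFp _
    (fun v hv => hV v (Finset.mem_filter.mp hv).1) ?_
  intro u hu x hx v hv
  rw [Finset.mem_filter] at hu hx hv
  refine Int.eq_zero_of_abs_lt_dvd ?_ (abs_det_lt_of_two_mul_lt hHp (hVG u hu.1).2.1
    (hVG x hx.1).2.1 (hVG v hv.1).2.1)
  have hcast : ((p : ℤ) ^ 3) = ((p ^ 3 : ℕ) : ℤ) := by push_cast; ring
  have hcls : ∀ y, y ∈ V ∧ key y = κ → ∀ k, (p : ℤ) ∣ η y k - η u k := by
    intro y hy k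
    have h := congrFun (hy.2.trans hu.2.symm) k
    exact Int.ModEq.dvd (h.symm : η u k % (p : ℤ) = η y k % (p : ℤ))
  have hmain := pow_dvd_det_of_residue_class (n := 1) (s := 3) (p : ℤ) 3 2 le_rfl g (η u)
    ((hpp.coprime_iff_not_dvd.mpr (hndvd u hu.1)).symm) ![X 0, 1, X 1] ![η u, η x, η v]
    (by
      intro i
      fin_cases i
      · exact hcls u hu
      · exact hcls x hx
      · exact hcls v hv)
    (by
      intro i
      fin_cases i
      · exact hdvd u hu.1
      · exact hdvd x hx.1
      · exact hdvd v hv.1)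
    (fun β hβ => by
      have := le_sum_degree_of_injective_one β hβ
      omega)
  rw [hcast] at hmain ⊢
  refine dvd_det_of_dvd_det_normalized (a := w u) (b := w x) (c := w v)
    (hcast ▸ hw u hu.1) (hcast ▸ hw x hx.1) (hcast ▸ hw v hv.1) ?_
  convert hmain using 3
  ext i j
  fin_cases i <;> fin_cases j <;> simp [η]

theorem map_homogeneousComponent {σ R S : Type*} [CommSemiring R] [CommSemiring S] (φ : R →+* S)
    (n : ℕ) (f : MvPolynomial σ R) :
    map φ (homogeneousComponent n f) = homogeneousComponent n (map φ f) := by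
  ext m
  rw [coeff_map, coeff_homogeneousComponent, coeff_homogeneousComponent, coeff_map]
  split_ifs <;> simp

theorem coeff_iterate_pderiv_ne_zero {n d : ℕ} {F : MvPolynomial (Fin n) ℤ} (i : Fin n)
    (hF : coeff (Finsupp.single i d) F ≠ 0) :
    ∀ m ≤ d, coeff (Finsupp.single i (d - m)) ((pderiv i)^[m] F) ≠ 0 := by
  intro m
  induction m with
  | zero => intro _; simpa using hF
  | succ m ih =>
    intro hm
    rw [Function.iterate_succ_apply', coeff_pderiv, ← Finsupp.single_add,
      show d - (m + 1) + 1 = d - m by omega]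
    refine mul_ne_zero (ih (by omega)) ?_
    positivity

theorem isHomogeneous_iterate_pderiv {n d : ℕ} {F : MvPolynomial (Fin n) ℤ} (i : Fin n)
    (hF : F.IsHomogeneous d) (m : ℕ) : ((pderiv i)^[m] F).IsHomogeneous (d - m) := by
  induction m with
  | zero => simpa using hF
  | succ m ih =>
    rw [Function.iterate_succ_apply', ← Nat.sub_sub]
    exact ih.pderiv

theorem exists_iterate_pderiv_eq_zero_and_ne_zero {n d : ℕ} {F : MvPolynomial (Fin n) ℤ}
    (i : Fin n) (hF : F.IsHomogeneous d) (hc : coeff (Finsupp.single i d) F ≠ 0) {v : Fin n → ℤ}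
    (hv : eval v F = 0) :
    ∃ m < d, eval v ((pderiv i)^[m] F) = 0 ∧ eval v ((pderiv i)^[m + 1] F) ≠ 0 := by
  classical
  have hlast : eval v ((pderiv i)^[d] F) ≠ 0 := by
    refine eval_ne_zero_of_totalDegree_eq_zero (fun h => ?_) ?_ v
    · have h1 := coeff_iterate_pderiv_ne_zero i hc d le_rfl
      rw [h] at h1
      simp at h1
    · have h1 := (isHomogeneous_iterate_pderiv i hF d).totalDegree_le
      omega
  have hex : ∃ m, eval v ((pderiv i)^[m] F) ≠ 0 := ⟨d, hlast⟩
  have hd : Nat.find hex ≤ d := Nat.find_min' hex hlast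
  have hspec := Nat.find_spec hex
  obtain ⟨m, hm⟩ : ∃ m, Nat.find hex = m + 1 := by
    refine Nat.exists_eq_succ_of_ne_zero fun h => ?_
    rw [h] at hspec
    exact hspec hv
  refine ⟨m, by omega, ?_, hm ▸ hspec⟩
  by_contra h
  have := Nat.find_min' hex h
  omega

theorem exists_card_directions_le (K : Type*) [Field K] [CharZero K] (d h : ℕ) :
    ∃ C H₀ : ℕ, ∀ H ≥ H₀, ∀ f : MvPolynomial (Fin 3) ℤ, coeff (Finsupp.single 0 d) f ≠ 0 →
      (∀ m, |coeff m f| ≤ (H ^ h : ℕ)) →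
      NonvanishingOnPlanes (homogeneousComponent d (map (Int.castRingHom K) f)) →
      ∀ V : Finset (Fin 3 → ℤ), (∀ v ∈ V, IsPrimitiveVector v ∧
        eval (fun i => (v i : K)) (homogeneousComponent d (map (Int.castRingHom K) f)) = 0 ∧
        ∀ i, |v i| ≤ (H : ℤ)) → V.card ≤ C * H := by
  classical
  obtain ⟨k, hk⟩ : ∃ k, 1 + h + d = k := ⟨_, rfl⟩
  refine ⟨2 * (d + 1) + d * ((k + 1) * (2 * (d + 1) * (d * (2 ^ (k + 2))))),
    (d + 1) ^ 3 * (d + 1) ^ d, ?_⟩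
  intro H hH f hc hht hpl V hV
  have hH1 : 1 ≤ H := le_trans (Nat.mul_pos (by positivity) (by positivity)) hH
  obtain ⟨F, hFdef⟩ : ∃ F, homogeneousComponent d (map (Int.castRingHom K) f) = F := ⟨_, rfl⟩
  rw [hFdef] at hpl hV
  have hF : F.IsHomogeneous d := hFdef ▸ homogeneousComponent_isHomogeneous d _
  obtain ⟨G, hGdef⟩ : ∃ G, homogeneousComponent d f = G := ⟨_, rfl⟩
  have hG : G.IsHomogeneous d := hGdef ▸ homogeneousComponent_isHomogeneous d _
  have hGc : coeff (Finsupp.single 0 d) G ≠ 0 := by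
    rw [← hGdef, coeff_homogeneousComponent, if_pos (by simp)]
    exact hc
  have hGht : ∀ m, |coeff m G| ≤ (H ^ h : ℕ) := by
    intro m
    rw [← hGdef, coeff_homogeneousComponent]
    split_ifs
    · exact hht m
    · simp
  have hGv : ∀ v ∈ V, eval v G = 0 := by
    intro v hv
    have h1 := (hV v hv).2.1
    rw [← hFdef, ← map_homogeneousComponent, eval_map_intCast, hGdef] at h1
    exact_mod_cast h1
  obtain ⟨p, hp, hmono, hYp, hpY⟩ := exists_prime_sequence (2 * H) (by omega)
  let A : ℕ → ℕ → Finset (Fin 3 → ℤ) := fun m j => V.filter fun v => v 1 ≠ 0 ∧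
    eval v ((pderiv 0)^[m] G) = 0 ∧ ¬ (p j : ℤ) ∣ eval v ((pderiv 0)^[m + 1] G)
  have hA : ∀ m, ∀ j ≤ k, (A m j).card ≤ 2 * (d + 1) * (d * (2 ^ (k + 2))) * H := by
    intro m j hj
    refine (card_directions_mod_prime_le hF hpl (hp j) (hYp j)
      (isHomogeneous_iterate_pderiv 0 hG m) (Nat.sub_le _ _) (A m j) ?_ ?_).trans ?_
    · intro v hv
      have h1 := hV v (Finset.mem_filter.mp hv).1
      exact ⟨h1.1, h1.2.1⟩
    · intro v hv
      obtain ⟨hvV, h1, h2, h3⟩ := Finset.mem_filter.mp hv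
      rw [Function.iterate_succ_apply'] at h3
      exact ⟨h1, (hV v hvV).2.2, h2, h3⟩
    · have h1 : p j ≤ 2 ^ (k + 2) * H := by
        refine (hpY j).trans ?_
        rw [pow_succ 2 (k + 1), mul_assoc]
        exact Nat.mul_le_mul_right _ (Nat.pow_le_pow_right (by norm_num) (by omega))
      calc 2 * (d + 1) * (d * p j) ≤ 2 * (d + 1) * (d * (2 ^ (k + 2) * H)) := by gcongr
        _ = _ := by ring
  have hcover : V ⊆ V.filter (fun v => v 1 = 0) ∪
      (Finset.range d).biUnion fun m => (Finset.range (k + 1)).biUnion fun j => A m j := by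
    intro v hv
    rw [Finset.mem_union]
    by_cases hv1 : v 1 = 0
    · exact Or.inl (Finset.mem_filter.mpr ⟨hv, hv1⟩)
    right
    obtain ⟨m, hm, hm0, hm1⟩ := exists_iterate_pderiv_eq_zero_and_ne_zero 0 hG hGc (hGv v hv)
    have hbd := iterate_pderiv_bounds hG.totalDegree_le hGht 0 (m + 1)
    have hle := abs_eval_le hH1 hbd.1 hbd.2 (hV v hv).2.2
    have hpow : d ^ (m + 1) ≤ (d + 1) ^ d := (Nat.pow_le_pow_left (Nat.le_succ d) _).trans
      (Nat.pow_le_pow_right (by omega) (by omega))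
    have hle2 : (d + 1) ^ 3 * (d ^ (m + 1) * H ^ h) * H ^ d ≤ (2 * H) ^ k := by
      calc (d + 1) ^ 3 * (d ^ (m + 1) * H ^ h) * H ^ d
          ≤ (d + 1) ^ 3 * ((d + 1) ^ d * H ^ h) * H ^ d := by
            gcongr
        _ = (d + 1) ^ 3 * (d + 1) ^ d * H ^ h * H ^ d := by ring
        _ ≤ H * H ^ h * H ^ d := by gcongr
        _ = H ^ k := by rw [← hk]; ring
        _ ≤ (2 * H) ^ k := Nat.pow_le_pow_left (by omega) _
    obtain ⟨j, hj, hj'⟩ := exists_block_not_dvd hp hmono (by omega) hYp hm1 (k := k)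
      (hle.trans (by exact_mod_cast hle2)) 1 0
    have h1 := hj' 0 one_pos
    rw [zero_add, mul_one, add_zero] at h1
    simp only [Finset.mem_biUnion, Finset.mem_range]
    exact ⟨m, hm, j, hj, Finset.mem_filter.mpr ⟨hv, hv1, hm0, h1⟩⟩
  have hplane : (V.filter (fun v => v 1 = 0)).card ≤ 2 * (d + 1) := by
    refine card_primitive_zeros_in_plane_le hF hpl _ ?_ ?_
    · intro v hv
      have h1 := hV v (Finset.mem_filter.mp hv).1
      exact ⟨h1.1, h1.2.1⟩
    · intro u hu w hw v hv
      rw [Matrix.det_fin_three]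
      simp only [Matrix.of_apply, Matrix.cons_val_zero, Matrix.cons_val_one, Matrix.cons_val]
      rw [(Finset.mem_filter.mp hu).2, (Finset.mem_filter.mp hw).2, (Finset.mem_filter.mp hv).2]
      ring
  have hunion : ((Finset.range d).biUnion fun m => (Finset.range (k + 1)).biUnion
      fun j => A m j).card ≤ d * ((k + 1) * (2 * (d + 1) * (d * (2 ^ (k + 2))) * H)) := by
    refine (Finset.card_biUnion_le_card_mul _ _ _ fun m _ =>
      (Finset.card_biUnion_le_card_mul _ _ _ fun j hj => hA m j ?_)).trans_eq ?_
    · exact Nat.lt_succ_iff.mp (Finset.mem_range.mp hj)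
    · rw [Finset.card_range, Finset.card_range]
  calc V.card ≤ _ := Finset.card_le_card hcover
    _ ≤ _ := Finset.card_union_le _ _
    _ ≤ 2 * (d + 1) + d * ((k + 1) * (2 * (d + 1) * (d * (2 ^ (k + 2))) * H)) :=
      Nat.add_le_add hplane hunion
    _ ≤ 2 * (d + 1) * H + d * ((k + 1) * (2 * (d + 1) * (d * (2 ^ (k + 2))) * H)) :=
      Nat.add_le_add_right (Nat.le_mul_of_pos_right _ hH1) _
    _ = _ := by ring

theorem eval_translate {σ R : Type*} [CommRing R] (v : σ → R) (f : MvPolynomial σ R)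
    (x : σ → R) : eval x (aeval (fun i => X i + C (v i)) f) = eval (fun i => x i + v i) f := by
  rw [eval_aeval_eq]
  simp

theorem lineRestriction_ne_zero {σ R : Type*} [CommRing R] {d : ℕ} {x : σ → R}
    {f : MvPolynomial σ R} (hf : f.totalDegree ≤ d)
    (hx : eval x (homogeneousComponent d f) ≠ 0) (y : σ → R) : lineRestriction x y f ≠ 0 := by
  intro h
  rw [← coeff_lineRestriction x y hf, h, Polynomial.coeff_zero] at hx
  exact hx rfl

theorem eval_add_eq_of_dvd_translate_sub {σ K : Type*} [Field K] [Infinite K] {d : ℕ} {x : σ → K}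
    {f : MvPolynomial σ K} (hf : f.totalDegree ≤ d)
    (hx : eval x (homogeneousComponent d f) ≠ 0) {v : σ → K}
    (h : f ∣ aeval (fun i => X i + C (v i)) f - f) (y : σ → K) :
    eval (fun i => y i + v i) f = eval y f := by
  obtain ⟨g, hg⟩ : ∃ g, aeval (fun i => X i + C (v i)) f - f = g := ⟨_, rfl⟩
  rw [hg] at h
  have hline : lineRestriction x y g =
      lineRestriction x (fun i => y i + v i) f - lineRestriction x y f := by
    refine Polynomial.funext fun s => ?_
    rw [Polynomial.eval_sub, eval_lineRestriction, eval_lineRestriction, eval_lineRestriction,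
      ← hg, map_sub, eval_translate]
    simp only [add_right_comm]
  have hzero : lineRestriction x y g = 0 := by
    by_contra hne
    have hdvd : lineRestriction x y f ∣ lineRestriction x y g := by
      unfold lineRestriction
      exact map_dvd _ h
    have hle := Polynomial.natDegree_le_of_dvd hdvd hne
    have hfd : d ≤ (lineRestriction x y f).natDegree := by
      refine Polynomial.le_natDegree_of_ne_zero ?_
      rwa [coeff_lineRestriction x y hf]
    have hgd : (lineRestriction x y g).natDegree ≤ d := by
      rw [hline]
      refine (Polynomial.natDegree_sub_le_of_le (natDegree_lineRestriction_le x _ hf)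
        (natDegree_lineRestriction_le x _ hf)).trans_eq (max_self d)
    have hcoeff : (lineRestriction x y g).coeff d = 0 := by
      rw [hline, Polynomial.coeff_sub, coeff_lineRestriction _ _ hf, coeff_lineRestriction _ _ hf,
        sub_self]
    rw [← le_antisymm hgd (hfd.trans hle), Polynomial.coeff_natDegree,
      Polynomial.leadingCoeff_eq_zero] at hcoeff
    exact hne hcoeff
  have h0 := congrArg (Polynomial.eval 0) hzero
  rw [eval_lineRestriction, ← hg, map_sub, eval_translate, Polynomial.eval_zero] at h0
  simpa using sub_eq_zero.mp h0

theorem eval_homogeneousComponent_add_eq_of_periodic {σ K : Type*} [Field K] [CharZero K] {d : ℕ}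
    {f : MvPolynomial σ K} (hf : f.totalDegree ≤ d) {v : σ → K}
    (h : ∀ y, eval (fun i => y i + v i) f = eval y f) (w : σ → K) (b : K) :
    eval (fun i => w i + b * v i) (homogeneousComponent d f) =
      eval w (homogeneousComponent d f) := by
  have hnat : ∀ (n : ℕ) y, eval (fun i => y i + n * v i) f = eval y f := by
    intro n
    induction n with
    | zero => intro y; simp
    | succ n ih =>
      intro y
      rw [← ih y, ← h fun i => y i + n * v i]
      congr 2
      funext i
      push_cast
      ring
  have hall : ∀ (s : K) y, eval (fun i => y i + s * v i) f = eval y f := by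
    intro s y
    have h1 : lineRestriction v y f = Polynomial.C (eval y f) := by
      refine Polynomial.eq_of_infinite_eval_eq _ _ ?_
      refine Set.Infinite.mono ?_ (Set.infinite_range_of_injective (Nat.cast_injective (R := K)))
      rintro _ ⟨n, rfl⟩
      rw [Set.mem_ofPred_eq, eval_lineRestriction, Polynomial.eval_C]
      exact hnat n y
    rw [← eval_lineRestriction, h1, Polynomial.eval_C]
  rw [← coeff_lineRestriction _ 0 hf, ← coeff_lineRestriction _ 0 hf]
  congr 1
  refine Polynomial.funext fun s => ?_
  rw [eval_lineRestriction, eval_lineRestriction, ← hall (s * b) fun i => (0 : σ → K) i + s * w i]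
  congr 2
  funext i
  ring

theorem not_dvd_translate_sub {K : Type*} [Field K] [IsAlgClosed K] [CharZero K] {d : ℕ}
    (hd : d ≠ 0) {f : MvPolynomial (Fin 3) K} (hf : f.totalDegree ≤ d)
    (hc : coeff (Finsupp.single 0 d) f ≠ 0)
    (hpl : NonvanishingOnPlanes (homogeneousComponent d f)) {v : Fin 3 → K}
    (hv : eval v (homogeneousComponent d f) = 0) (hq : v 1 ^ 2 + v 2 ^ 2 ≠ 0) :
    ¬ f ∣ aeval (fun i => X i + C (v i)) f - f := by
  intro hdvd
  have hx : eval (Pi.single 0 1) (homogeneousComponent d f) ≠ 0 := by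
    rwa [eval_single_homogeneousComponent]
  have hper := eval_homogeneousComponent_add_eq_of_periodic hf
    (eval_add_eq_of_dvd_translate_sub hf hx hdvd)
  obtain ⟨F, hF⟩ : ∃ F, homogeneousComponent d f = F := ⟨_, rfl⟩
  have hFh : F.IsHomogeneous d := hF ▸ homogeneousComponent_isHomogeneous d f
  rw [hF] at hx hv hpl hper
  have hxF : eval (Pi.single 0 1) (homogeneousComponent d F) ≠ 0 := by
    rwa [homogeneousComponent_eq_self hFh]
  obtain ⟨z, hz⟩ := IsAlgClosed.exists_root
    (lineRestriction (Pi.single 0 1) ![0, -v 2, v 1] F) (by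
      intro h0
      have h1 : d ≤ (lineRestriction (Pi.single 0 1) ![0, -v 2, v 1] F).natDegree := by
        refine Polynomial.le_natDegree_of_ne_zero ?_
        rwa [coeff_lineRestriction _ _ hFh.totalDegree_le]
      rw [Polynomial.natDegree_eq_of_degree_eq_some (n := 0) h0] at h1
      omega)
  rw [Polynomial.IsRoot.def, eval_lineRestriction] at hz
  obtain ⟨w, hw⟩ : ∃ w : Fin 3 → K, (fun i => ![0, -v 2, v 1] i + z * (Pi.single 0 1 : Fin 3 → K) i)
    = w := ⟨_, rfl⟩
  rw [hw] at hz
  obtain ⟨a, b, hab⟩ := hpl v w ⟨1, 2, by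
    subst hw
    simp only [Matrix.cons_val]
    intro h
    refine hq ?_
    simp at h
    linear_combination h⟩
  exact hab (eval_plane_eq_zero hFh hv (fun s => (hper w s).trans hz) a b)

theorem card_le_of_collinear {n : ℕ} {v : Fin n → ℤ} (hv : IsPrimitiveVector v) {i₀ : Fin n}
    {L M N : ℕ} (hL0 : 0 < L) (hL : (L : ℤ) ≤ |v i₀|) (hN : 2 * N ≤ M * L)
    (W : Finset (Fin n → ℤ)) (hW : ∀ ξ ∈ W, ∀ i, |ξ i| ≤ (N : ℤ))
    (h : ∀ ξ ∈ W, ∀ ξ' ∈ W, ∀ i j, (ξ i - ξ' i) * v j = (ξ j - ξ' j) * v i) :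
    W.card ≤ 2 * M + 1 := by
  classical
  rcases W.eq_empty_or_nonempty with rfl | ⟨ξ₀, hξ₀⟩
  · simp
  have hsub : W ⊆ (Finset.Icc (-(M : ℤ)) M).image fun m i => ξ₀ i + m * v i := by
    intro ξ hξ
    obtain ⟨m, hm⟩ := hv.exists_eq_mul (u := fun i => ξ i - ξ₀ i) (h ξ hξ ξ₀ hξ₀)
    refine Finset.mem_image.mpr ⟨m, ?_, funext fun i => by rw [← hm i]; ring⟩
    have h1 : |m| * |v i₀| ≤ 2 * N := by
      rw [← abs_mul, ← hm i₀]
      have h2 := abs_sub (ξ i₀) (ξ₀ i₀)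
      have h3 := hW ξ hξ i₀
      have h4 := hW ξ₀ hξ₀ i₀
      linarith
    have h2 : |m| * L ≤ M * L :=
      (mul_le_mul_of_nonneg_left hL (abs_nonneg m)).trans (h1.trans (by exact_mod_cast hN))
    rw [Finset.mem_Icc, ← abs_le]
    exact le_of_mul_le_mul_right h2 (by exact_mod_cast hL0)
  refine (Finset.card_le_card hsub).trans (Finset.card_image_le.trans ?_)
  rw [Int.card_Icc]
  omega

theorem card_on_lines_in_direction_le {K : Type*} [Field K] [IsAlgClosed K] [CharZero K] {d : ℕ}
    (hd : d ≠ 0) {f : MvPolynomial (Fin 3) K} (hfp : Prime f) (hf : f.totalDegree ≤ d)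
    (hc : coeff (Finsupp.single 0 d) f ≠ 0)
    (hpl : NonvanishingOnPlanes (homogeneousComponent d f)) {v : Fin 3 → ℤ}
    (hvp : IsPrimitiveVector v)
    (hv : eval (fun i => (v i : K)) (homogeneousComponent d f) = 0) {i₀ : Fin 3}
    {L M N : ℕ} (hL0 : 0 < L) (hL : (L : ℤ) ≤ |v i₀|) (hN : 2 * N ≤ M * L)
    (W : Finset (Fin 3 → ℤ)) (hW : ∀ ξ ∈ W, (∀ i, |ξ i| ≤ (N : ℤ)) ∧
      ∀ s : K, eval (fun i => (ξ i : K) + s * v i) f = 0) :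
    W.card ≤ (2 * M + 1) * ((2 * d * d + d) * d) := by
  classical
  have hx : eval (Pi.single 0 1) (homogeneousComponent d f) ≠ 0 := by
    rwa [eval_single_homogeneousComponent]
  have hq : (v 1 : K) ^ 2 + (v 2 : K) ^ 2 ≠ 0 := by
    intro h
    have h1 : v 1 ^ 2 + v 2 ^ 2 = 0 := by exact_mod_cast h
    have h2 : v 1 = 0 := by nlinarith [sq_nonneg (v 1), sq_nonneg (v 2)]
    have h3 : v 2 = 0 := by nlinarith [sq_nonneg (v 1), sq_nonneg (v 2)]
    have h4 : v 0 ≠ 0 := by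
      obtain ⟨i, hi⟩ := hvp.exists_ne_zero
      fin_cases i
      · exact hi
      · exact absurd h2 hi
      · exact absurd h3 hi
    have h5 : (fun i => (v i : K)) = fun i => (v 0 : K) * (Pi.single 0 1 : Fin 3 → K) i := by
      funext i
      fin_cases i <;> simp [h2, h3]
    rw [h5, eval_mul_of_isHomogeneous (homogeneousComponent_isHomogeneous d f)] at hv
    exact mul_ne_zero (pow_ne_zero _ (Int.cast_ne_zero.mpr h4)) hx hv
  obtain ⟨q, hqdef⟩ : ∃ q, (v 1 : K) ^ 2 + (v 2 : K) ^ 2 = q := ⟨_, rfl⟩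
  have hndvd := not_dvd_translate_sub hd hf hc hpl hv hq
  rw [hqdef] at hq
  have hgd : (aeval (fun i => X i + C (v i : K)) f - f).totalDegree ≤ d := by
    refine (totalDegree_sub _ _).trans (max_le ((totalDegree_aeval_le (fun i => ?_) f).trans hf) hf)
    refine (totalDegree_add _ _).trans ?_
    rw [totalDegree_X, totalDegree_C]
    norm_num
  obtain ⟨r, hr0, hrd, hr⟩ := exists_elimination hfp hndvd hf hgd
  have hrW : ∀ ξ ∈ W, ∀ s : K, eval (Fin.tail fun i => (ξ i : K) + s * v i) r = 0 := by
    intro ξ hξ s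
    refine hr _ ((hW ξ hξ).2 s) ?_
    rw [map_sub, eval_translate, (hW ξ hξ).2 s, sub_zero, ← (hW ξ hξ).2 (s + 1)]
    congr 2
    funext i
    ring
  obtain ⟨c, hcr⟩ : ∃ c, eval c r ≠ 0 := by
    by_contra! h
    exact hr0 (MvPolynomial.funext fun x => by rw [h x, map_zero])
  obtain ⟨ρ, hρ⟩ : ∃ ρ, lineRestriction ![-(v 2 : K), (v 1 : K)] c r = ρ := ⟨_, rfl⟩
  have hρ0 : ρ ≠ 0 := by
    intro h
    refine hcr ?_
    have h1 := eval_lineRestriction ![-(v 2 : K), (v 1 : K)] c r 0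
    rw [hρ, h, Polynomial.eval_zero] at h1
    simpa using h1.symm
  let base : K → Fin 3 → K := fun t => ![0, c 0 - t * v 2, c 1 + t * v 1]
  let fib : K → Polynomial K := fun t => lineRestriction (Pi.single 0 1) (base t) f
  let par : (Fin 3 → ℤ) → K := fun ξ => ((c 0 - ξ 1) * v 1 + (c 1 - ξ 2) * v 2) / q
  let trs : (Fin 3 → ℤ) → K := fun ξ => ((ξ 1 - c 0) * -v 2 + (ξ 2 - c 1) * v 1) / q
  let φ : (Fin 3 → ℤ) → (_ : K) × K := fun ξ => ⟨trs ξ, ξ 0 + par ξ * v 0⟩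
  have h1 : ∀ ξ, (ξ 1 : K) + par ξ * v 1 = c 0 - trs ξ * v 2 := by
    intro ξ
    simp only [par, trs]
    field_simp
    rw [← hqdef]
    ring
  have h2 : ∀ ξ, (ξ 2 : K) + par ξ * v 2 = c 1 + trs ξ * v 1 := by
    intro ξ
    simp only [par, trs]
    field_simp
    rw [← hqdef]
    ring
  have himage : W.image φ ⊆ ρ.roots.toFinset.sigma fun t => (fib t).roots.toFinset := by
    intro o ho
    obtain ⟨ξ, hξ, rfl⟩ := Finset.mem_image.mp ho
    rw [Finset.mem_sigma, Multiset.mem_toFinset, Multiset.mem_toFinset, Polynomial.mem_roots hρ0,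
      Polynomial.mem_roots (lineRestriction_ne_zero hf hx _)]
    constructor
    · rw [Polynomial.IsRoot.def, ← hρ, eval_lineRestriction, ← hrW ξ hξ (par ξ)]
      congr 2
      funext i
      fin_cases i
      · simp [Fin.tail, φ, h1 ξ, sub_eq_add_neg]
      · simp [Fin.tail, φ, h2 ξ]
    · rw [Polynomial.IsRoot.def, eval_lineRestriction, ← (hW ξ hξ).2 (par ξ)]
      congr 2
      funext i
      fin_cases i
      · simp [base, φ]
      · simp [base, φ, h1 ξ]
      · simp [base, φ, h2 ξ]
  have hcard : (W.image φ).card ≤ (2 * d * d + d) * d := by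
    refine (Finset.card_le_card himage).trans ?_
    rw [Finset.card_sigma]
    refine (Finset.sum_le_card_nsmul _ _ d fun t _ => ?_).trans ?_
    · exact (Multiset.toFinset_card_le _).trans ((Polynomial.card_roots' _).trans
        (natDegree_lineRestriction_le _ _ hf))
    · rw [smul_eq_mul]
      refine Nat.mul_le_mul_right _ ((Multiset.toFinset_card_le _).trans
        ((Polynomial.card_roots' _).trans ?_))
      rw [← hρ]
      exact natDegree_lineRestriction_le _ _ hrd
  refine (Finset.card_le_mul_card_image (f := φ) W (2 * M + 1) fun o _ => ?_).trans
    (Nat.mul_le_mul_left _ hcard)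
  refine card_le_of_collinear hvp hL0 hL hN _
    (fun ξ hξ => (hW ξ (Finset.mem_filter.mp hξ).1).1) ?_
  intro ξ hξ ξ' hξ'
  have heq : φ ξ = φ ξ' := (Finset.mem_filter.mp hξ).2.trans (Finset.mem_filter.mp hξ').2.symm
  simp only [φ, Sigma.mk.injEq, heq_eq_eq] at heq
  have hcoord : ∀ i, (ξ i : K) - ξ' i = (par ξ' - par ξ) * v i := by
    have hc0 : (ξ 0 : K) - ξ' 0 = (par ξ' - par ξ) * v 0 := by linear_combination heq.2
    have hc1 : (ξ 1 : K) - ξ' 1 = (par ξ' - par ξ) * v 1 := by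
      linear_combination h1 ξ - h1 ξ' - v 2 * heq.1
    have hc2 : (ξ 2 : K) - ξ' 2 = (par ξ' - par ξ) * v 2 := by
      linear_combination h2 ξ - h2 ξ' + v 1 * heq.1
    intro i
    fin_cases i
    exacts [hc0, hc1, hc2]
  intro i j
  have h3 : ((ξ i : K) - ξ' i) * v j = ((ξ j : K) - ξ' j) * v i := by
    rw [hcoord i, hcoord j]
    ring
  exact_mod_cast h3

/-- The direction of a line joining two integral points of a surface that contains it. -/
theorem SpanLine.exists_direction {K : Type*} [Field K] [CharZero K] {f : MvPolynomial (Fin 3) ℤ}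
    {ξ ξ' : Fin 3 → ℤ} (h : SpanLine f ξ ξ') :
    ∃ v : Fin 3 → ℤ, IsPrimitiveVector v ∧ (∀ i, |v i| ≤ |ξ' i - ξ i|) ∧
      ∀ s : K, eval (fun i => (ξ i : K) + s * v i) (map (Int.castRingHom K) f) = 0 := by
  have hne : (fun i => ξ' i - ξ i) ≠ 0 := fun h0 =>
    h.1 (funext fun i => (sub_eq_zero.mp (congrFun h0 i)).symm)
  obtain ⟨g, v, hv, hg⟩ := exists_primitive_eq_mul hne
  have hg0 : g ≠ 0 := by
    rintro rfl
    exact hne (funext fun i => by rw [hg i, zero_mul, Pi.zero_apply])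
  refine ⟨v, hv, fun i => ?_, fun s => ?_⟩
  · have h1 := hg i
    rw [h1, abs_mul]
    exact le_mul_of_one_le_left (abs_nonneg _) (Int.one_le_abs hg0)
  · have h1 : lineRestriction (fun i => (v i : K)) (fun i => (ξ i : K))
        (map (Int.castRingHom K) f) = 0 := by
      refine Polynomial.eq_zero_of_infinite_isRoot _ ?_
      have hinj : Function.Injective fun n : ℤ => ((n * g : ℤ) : K) := fun a b hab =>
        mul_right_cancel₀ hg0 (Int.cast_injective hab)
      refine Set.Infinite.mono ?_ (Set.infinite_range_of_injective hinj)
      rintro _ ⟨n, rfl⟩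
      rw [Set.mem_ofPred_eq, Polynomial.IsRoot.def, eval_lineRestriction]
      have h2 : (fun i => (ξ i : K) + ((n * g : ℤ) : K) * v i) =
          fun i => ((ξ i + n * (ξ' i - ξ i) : ℤ) : K) := by
        funext i
        have h3 := hg i
        rw [h3]
        push_cast
        ring
      rw [h2, eval_map_intCast, h.2 n, Int.cast_zero]
    rw [← eval_lineRestriction, h1, Polynomial.eval_zero]

theorem exists_pow_le_abs_and_abs_le {n : ℕ} {v : Fin n → ℤ} (hv : ∃ i, v i ≠ 0) {Y τ : ℕ}
    (hY : 3 ≤ Y) (hle : ∀ i, |v i| ≤ 2 * (Y : ℤ) ^ τ) :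
    ∃ j ≤ τ, (∃ i, (Y : ℤ) ^ j ≤ |v i|) ∧ ∀ i, |v i| ≤ (Y : ℤ) ^ (j + 1) := by
  obtain ⟨i₁, hi₁⟩ := hv
  obtain ⟨i₀, -, hi₀⟩ := Finset.exists_max_image Finset.univ (fun i => (v i).natAbs)
    ⟨i₁, Finset.mem_univ _⟩
  have hpos : (v i₀).natAbs ≠ 0 := by
    have := hi₀ i₁ (Finset.mem_univ _)
    omega
  have hlow := Nat.pow_log_le_self Y hpos
  have hupp := Nat.lt_pow_succ_log_self (b := Y) (by omega) (v i₀).natAbs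
  have hcast : ∀ i, |v i| = ((v i).natAbs : ℤ) := fun i => (Int.natCast_natAbs (v i)).symm
  refine ⟨Nat.log Y (v i₀).natAbs, ?_, ⟨i₀, ?_⟩, fun i => ?_⟩
  · have h1 := hle i₀
    rw [hcast] at h1
    have h2 : (v i₀).natAbs ≤ 2 * Y ^ τ := by exact_mod_cast h1
    refine Nat.lt_succ_iff.mp (Nat.log_lt_of_lt_pow hpos (h2.trans_lt ?_))
    rw [pow_succ, mul_comm]
    have : 0 < Y ^ τ := by positivity
    exact Nat.mul_lt_mul_of_pos_left (by omega) this
  · rw [hcast]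
    exact_mod_cast hlow
  · rw [hcast]
    exact_mod_cast (hi₀ i (Finset.mem_univ _)).trans hupp.le

theorem exists_card_spanLine_le (K : Type*) [Field K] [IsAlgClosed K] [CharZero K] {d : ℕ}
    (hd : d ≠ 0) (h τ : ℕ) :
    ∃ C Y₀ : ℕ, ∀ Y ≥ Y₀, ∀ f : MvPolynomial (Fin 3) ℤ, Prime (map (Int.castRingHom K) f) →
      f.totalDegree ≤ d → coeff (Finsupp.single 0 d) f ≠ 0 →
      (∀ m, |coeff m f| ≤ (Y ^ h : ℕ)) →
      NonvanishingOnPlanes (homogeneousComponent d (map (Int.castRingHom K) f)) →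
      ∀ E : Finset (Fin 3 → ℤ), (∀ ξ ∈ E, (∀ i, |ξ i| ≤ (Y ^ τ : ℕ)) ∧
        ∃ ξ' : Fin 3 → ℤ, (∀ i, |ξ' i| ≤ (Y ^ τ : ℕ)) ∧ SpanLine f ξ ξ') →
      E.card ≤ C * Y ^ (τ + 1) := by
  classical
  obtain ⟨C, H₀, hC⟩ := exists_card_directions_le K d h
  refine ⟨(τ + 1) * (5 * ((2 * d * d + d) * d) * C), max H₀ 3, ?_⟩
  intro Y hY f hfp hfd hc hht hpl E hE
  have hY3 : 3 ≤ Y := (le_max_right _ _).trans hY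
  have hfdK : (map (Int.castRingHom K) f).totalDegree ≤ d :=
    (totalDegree_map_le_totalDegree _ f).trans hfd
  have hcK : coeff (Finsupp.single 0 d) (map (Int.castRingHom K) f) ≠ 0 := by
    rw [coeff_map]
    simpa using hc
  have hdir : ∀ ξ ∈ E, ∃ v : Fin 3 → ℤ, ∃ j ≤ τ, IsPrimitiveVector v ∧
      (∃ i, (Y : ℤ) ^ j ≤ |v i|) ∧ (∀ i, |v i| ≤ (Y : ℤ) ^ (j + 1)) ∧
      ∀ s : K, eval (fun i => (ξ i : K) + s * v i) (map (Int.castRingHom K) f) = 0 := by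
    intro ξ hξ
    obtain ⟨hξN, ξ', hξN', hspan⟩ := hE ξ hξ
    obtain ⟨v, hv, hvle, hvs⟩ := hspan.exists_direction (K := K)
    obtain ⟨j, hj, h1, h2⟩ := exists_pow_le_abs_and_abs_le hv.exists_ne_zero hY3 (τ := τ) (by
      intro i
      refine (hvle i).trans ((abs_sub _ _).trans ?_)
      have h3 := hξN i
      have h4 := hξN' i
      push_cast at h3 h4
      linarith)
    exact ⟨v, j, hj, hv, h1, h2, hvs⟩
  choose! v j hj hv hlow hupp hvs using hdir
  let A : ℕ → Finset (Fin 3 → ℤ) := fun a => E.filter fun ξ => j ξ = a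
  have hzero : ∀ ξ ∈ E, eval (fun i => (v ξ i : K))
      (homogeneousComponent d (map (Int.castRingHom K) f)) = 0 := by
    intro ξ hξ
    rw [← coeff_lineRestriction _ (fun i => (ξ i : K)) hfdK]
    have h1 : lineRestriction (fun i => (v ξ i : K)) (fun i => (ξ i : K))
        (map (Int.castRingHom K) f) = 0 :=
      Polynomial.funext fun s => by rw [eval_lineRestriction, hvs ξ hξ, Polynomial.eval_zero]
    rw [h1, Polynomial.coeff_zero]
  have hA : ∀ a ≤ τ, (A a).card ≤ 5 * ((2 * d * d + d) * d) * C * Y ^ (τ + 1) := by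
    intro a ha
    have hdirs : ((A a).image v).card ≤ C * Y ^ (a + 1) := by
      refine hC (Y ^ (a + 1)) ?_ f hc (fun m => (hht m).trans ?_) hpl _ ?_
      · exact ((le_max_left _ _).trans hY).trans (Nat.le_self_pow (by omega) Y)
      · exact_mod_cast Nat.pow_le_pow_left (Nat.le_self_pow (by omega) Y) h
      · intro w hw
        obtain ⟨ξ, hξ, rfl⟩ := Finset.mem_image.mp hw
        obtain ⟨hξE, rfl⟩ := Finset.mem_filter.mp hξ
        exact ⟨hv ξ hξE, hzero ξ hξE, by exact_mod_cast hupp ξ hξE⟩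
    have hfib := Finset.card_le_mul_card_image (f := v) (A a)
      (5 * Y ^ (τ - a) * ((2 * d * d + d) * d)) fun w hw => by
        obtain ⟨ξ, hξ, rfl⟩ := Finset.mem_image.mp hw
        obtain ⟨hξE, rfl⟩ := Finset.mem_filter.mp hξ
        obtain ⟨i₀, hi₀⟩ := hlow ξ hξE
        refine (card_on_lines_in_direction_le hd hfp hfdK hcK hpl (hv ξ hξE) (hzero ξ hξE)
          (i₀ := i₀) (L := Y ^ j ξ) (M := 2 * Y ^ (τ - j ξ)) (N := Y ^ τ) (by positivity)
          (by exact_mod_cast hi₀) ?_ _ ?_).trans ?_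
        · rw [mul_assoc, ← pow_add, Nat.sub_add_cancel ha]
        · intro ξ' hξ'
          obtain ⟨h1, h2⟩ := Finset.mem_filter.mp hξ'
          have hE' := (Finset.mem_filter.mp h1).1
          refine ⟨(hE ξ' hE').1, ?_⟩
          rw [← h2]
          exact hvs ξ' hE'
        · have : 0 < Y ^ (τ - j ξ) := by positivity
          exact Nat.mul_le_mul_right _ (by omega)
    calc (A a).card ≤ 5 * Y ^ (τ - a) * ((2 * d * d + d) * d) * ((A a).image v).card := hfib
      _ ≤ 5 * Y ^ (τ - a) * ((2 * d * d + d) * d) * (C * Y ^ (a + 1)) := by gcongr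
      _ = 5 * ((2 * d * d + d) * d) * C * Y ^ (τ - a + (a + 1)) := by rw [pow_add]; ring
      _ = _ := by rw [← add_assoc, Nat.sub_add_cancel ha]
  have hcover : E ⊆ (Finset.range (τ + 1)).biUnion A := by
    intro ξ hξ
    exact Finset.mem_biUnion.mpr ⟨j ξ, Finset.mem_range.mpr (Nat.lt_succ_iff.mpr (hj ξ hξ)),
      Finset.mem_filter.mpr ⟨hξ, rfl⟩⟩
  refine (Finset.card_le_card hcover).trans ((Finset.card_biUnion_le_card_mul _ _ _
    fun a ha => hA a (Nat.lt_succ_iff.mp (Finset.mem_range.mp ha))).trans_eq ?_)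
  rw [Finset.card_range, Nat.succ_eq_add_one]
  ring

theorem exists_card_integral_points_le (K : Type*) [Field K] [IsAlgClosed K] [CharZero K]
    {d D k τ t s e W : ℕ} (hpar : SurfaceParams D k τ t s e W)
    (hbound : τ * ((k + 1) * (k + 1)) + 1 ≤ t * ((k + 1) * (2 * k + 1))) (hD : 0 < D)
    (hDd : D ≤ d) (h : ℕ) :
    ∃ C Y₀ : ℕ, ∀ Y ≥ Y₀, ∀ f : MvPolynomial (Fin 3) ℤ, Prime (map (Int.castRingHom K) f) →
      f.totalDegree ≤ d → coeff (Finsupp.single 0 d) f ≠ 0 →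
      (∀ m, |coeff m f| ≤ (Y ^ h : ℕ)) →
      NonvanishingOnPlanes (homogeneousComponent d (map (Int.castRingHom K) f)) →
      ∀ E : Finset (Fin 3 → ℤ), (∀ ξ ∈ E, eval ξ f = 0 ∧ ∀ i, |ξ i| ≤ (Y ^ τ : ℕ)) →
      E.card ≤ C * (Y ^ (2 * t + 2) + Y ^ (τ + 1)) := by
  classical
  obtain ⟨C₁, Y₁, h₁⟩ := exists_card_le_of_not_spanLine (R := K) hpar hbound hD hDd h
  obtain ⟨C₂, Y₂, h₂⟩ := exists_card_spanLine_le K (d := d) (by omega) h τ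
  refine ⟨C₁ + C₂, max (max Y₁ Y₂) 1, ?_⟩
  intro Y hY f hfp hfd hc hht hpl E hE
  have hY1 : 1 ≤ Y := (le_max_right _ _).trans hY
  have hYm : max Y₁ Y₂ ≤ Y := (le_max_left _ _).trans hY
  have hl := h₂ Y ((le_max_right _ _).trans hYm) f hfp hfd hc hht hpl
    (E.filter fun ξ => ∃ ξ' ∈ E, SpanLine f ξ ξ') (by
      intro ξ hξ
      obtain ⟨hξE, ξ', hξ', hs⟩ := Finset.mem_filter.mp hξ
      exact ⟨(hE ξ hξE).2, ξ', (hE ξ' hξ').2, hs⟩)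
  have hn := h₁ Y ((le_max_left _ _).trans hYm) f hfp hfd hc hht
    (E.filter fun ξ => ¬ ∃ ξ' ∈ E, SpanLine f ξ ξ')
    (fun ξ hξ => hE ξ (Finset.mem_filter.mp hξ).1) (by
      intro ξ hξ ξ' hξ' hs
      exact (Finset.mem_filter.mp hξ).2 ⟨ξ', (Finset.mem_filter.mp hξ').1, hs⟩)
  rw [← Finset.card_filter_add_card_filter_not (s := E) fun ξ => ∃ ξ' ∈ E, SpanLine f ξ ξ']
  have hpow : Y ^ τ ≤ Y ^ (τ + 1) := Nat.pow_le_pow_right hY1 (Nat.le_succ τ)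
  calc _ ≤ C₂ * Y ^ (τ + 1) + C₁ * (Y ^ (2 * t + 2) + Y ^ τ) := Nat.add_le_add hl hn
    _ ≤ C₂ * (Y ^ (2 * t + 2) + Y ^ (τ + 1)) + C₁ * (Y ^ (2 * t + 2) + Y ^ (τ + 1)) := by
      gcongr
      omega
    _ = _ := by ring

theorem NonvanishingOnPlanes.C_mul {K : Type*} [Field K] {F : MvPolynomial (Fin 3) K}
    (hF : NonvanishingOnPlanes F) {c : K} (hc : c ≠ 0) : NonvanishingOnPlanes (C c * F) := by
  intro u w h
  obtain ⟨a, b, hab⟩ := hF u w h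
  refine ⟨a, b, ?_⟩
  rw [map_mul, eval_C]
  exact mul_ne_zero hc hab

theorem le_totalDegree_of_coeff_single_ne_zero {σ R : Type*} [CommRing R] {f : MvPolynomial σ R}
    {i : σ} {d : ℕ} (hc : coeff (Finsupp.single i d) f ≠ 0) : d ≤ f.totalDegree := by
  have h := le_totalDegree (mem_support_iff.mpr hc)
  simpa using h

theorem eq_C_mul_of_dvd {σ K : Type*} [Field K] {d : ℕ} {f g : MvPolynomial σ K}
    (hfd : d ≤ f.totalDegree) (hg : g ≠ 0) (hgd : g.totalDegree ≤ d) (h : f ∣ g) :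
    ∃ c : K, c ≠ 0 ∧ g = C c * f := by
  obtain ⟨q, rfl⟩ := h
  have hf0 : f ≠ 0 := left_ne_zero_of_mul hg
  have hq0 : q ≠ 0 := right_ne_zero_of_mul hg
  rw [totalDegree_mul_of_isDomain hf0 hq0] at hgd
  have hq : q = C (coeff 0 q) := totalDegree_eq_zero_iff_eq_C.mp (by omega)
  refine ⟨coeff 0 q, fun h => hq0 ?_, ?_⟩
  · rw [hq, h, C_0]
  · rw [← hq, mul_comm]

theorem exists_card_zeros_le (K : Type*) [Field K] [IsAlgClosed K] [CharZero K]
    {d D k τ t s e W : ℕ} (hpar : SurfaceParams D k τ t s e W)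
    (hbound : τ * ((k + 1) * (k + 1)) + 1 ≤ t * ((k + 1) * (2 * k + 1))) (hD : 0 < D)
    (hDd : D ≤ d) :
    ∃ C Y₀ : ℕ, ∀ Y ≥ Y₀, ∀ f : MvPolynomial (Fin 3) K, Prime f →
      f.totalDegree ≤ d → coeff (Finsupp.single 0 d) f ≠ 0 →
      NonvanishingOnPlanes (homogeneousComponent d f) →
      ∀ E : Finset (Fin 3 → ℤ),
        (∀ ξ ∈ E, eval (fun i => (ξ i : K)) f = 0 ∧ ∀ i, |ξ i| ≤ (Y ^ τ : ℕ)) →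
      E.card ≤ C * (Y ^ (2 * t + 2) + Y ^ (τ + 1)) := by
  classical
  obtain ⟨C₁, Y₁, h₁⟩ := exists_card_integral_points_le K hpar hbound hD hDd
    (1 + τ * (d * (d + 1) ^ 3))
  refine ⟨C₁ + d * ((2 * d * d + d) * 3), max Y₁ (((d + 1) ^ 3).factorial), ?_⟩
  intro Y hY f hfp hfd hc hpl E hE
  have hYfac : ((d + 1) ^ 3).factorial ≤ Y := (le_max_right _ _).trans hY
  have hY1 : 1 ≤ Y := (Nat.factorial_pos _).trans_le hYfac
  obtain ⟨g, hg0, hgd, hght, hgE⟩ := exists_small_poly (N := Y ^ τ) (Nat.one_le_pow _ _ hY1)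
    hfp.ne_zero hfd (E : Set (Fin 3 → ℤ)) fun ξ hξ => ⟨(hE ξ hξ).2, (hE ξ hξ).1⟩
  have hgdK : (map (Int.castRingHom K) g).totalDegree ≤ d :=
    (totalDegree_map_le_totalDegree _ g).trans hgd
  by_cases hdvd : f ∣ map (Int.castRingHom K) g
  · have hgK : map (Int.castRingHom K) g ≠ 0 := fun h => hg0
      (map_injective _ (Int.cast_injective (α := K)) (h.trans (map_zero _).symm))
    obtain ⟨c, hc0, hgc⟩ := eq_C_mul_of_dvd (le_totalDegree_of_coeff_single_ne_zero hc) hgK hgdK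
      hdvd
    have hunit : IsUnit (C c : MvPolynomial (Fin 3) K) := (isUnit_iff_ne_zero.mpr hc0).map C
    have h := h₁ Y ((le_max_left _ _).trans hY) g
      (by
        rw [hgc]
        exact (associated_unit_mul_left f _ hunit).prime_iff.mpr hfp) hgd
      (by
        intro h0
        have h2 : coeff (Finsupp.single 0 d) (map (Int.castRingHom K) g) = 0 := by
          rw [coeff_map, h0, map_zero]
        rw [hgc, coeff_C_mul] at h2
        exact mul_ne_zero hc0 hc h2)
      (by
        intro m
        refine (hght m).trans ?_
        rw [pow_add, pow_one, pow_mul Y τ]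
        exact_mod_cast Nat.mul_le_mul_right _ hYfac)
      (by
        rw [hgc, homogeneousComponent_C_mul]
        exact hpl.C_mul hc0)
      E fun ξ hξ => ⟨hgE ξ hξ, (hE ξ hξ).2⟩
    exact h.trans (Nat.mul_le_mul_right _ (Nat.le_add_right _ _))
  · have h := card_le_of_not_dvd (n := 1) hfd hc hfp hdvd le_rfl hgdK E (N := Y ^ τ)
      fun ξ hξ => ⟨(hE ξ hξ).1, by rw [eval_map_intCast, hgE ξ hξ, Int.cast_zero], (hE ξ hξ).2⟩
    have hpow : Y ^ τ ≤ Y ^ (τ + 1) := Nat.pow_le_pow_right hY1 (Nat.le_succ τ)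
    have hpos : 1 ≤ Y ^ τ := Nat.one_le_pow _ _ hY1
    calc E.card ≤ d * ((2 * d * d + d) * (2 * Y ^ τ + 1) ^ 1) := h
      _ ≤ d * ((2 * d * d + d) * (3 * (Y ^ (2 * t + 2) + Y ^ (τ + 1)))) := by
        rw [pow_one]
        gcongr
        omega
      _ = d * ((2 * d * d + d) * 3) * (Y ^ (2 * t + 2) + Y ^ (τ + 1)) := by ring
      _ ≤ _ := Nat.mul_le_mul_right _ (Nat.le_add_left _ _)

theorem dvd_sub_aeval {σ R : Type*} [CommRing R] {ℓ : MvPolynomial σ R} {θ : σ → MvPolynomial σ R}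
    (h : ∀ i, ℓ ∣ X i - θ i) (F : MvPolynomial σ R) : ℓ ∣ F - aeval θ F := by
  induction F using MvPolynomial.induction_on with
  | C a => simp
  | add p q hp hq =>
    rw [map_add, add_sub_add_comm]
    exact dvd_add hp hq
  | mul_X p i hp =>
    rw [map_mul, aeval_X]
    have h1 : p * X i - aeval θ p * θ i = (p - aeval θ p) * X i + aeval θ p * (X i - θ i) := by
      ring
    rw [h1]
    exact dvd_add (hp.mul_right _) ((h i).mul_left _)

theorem exists_linear_factor_of_vanishing_on_plane {K : Type*} [Field K] [Infinite K]
    {F : MvPolynomial (Fin 3) K} (hF : ¬ NonvanishingOnPlanes F) :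
    ∃ ℓ : MvPolynomial (Fin 3) K, ℓ ∣ F ∧ Irreducible ℓ ∧ ℓ.totalDegree = 1 := by
  unfold NonvanishingOnPlanes at hF
  push Not at hF
  obtain ⟨u, w, ⟨i, j, hij⟩, hvan⟩ := hF
  obtain ⟨n, hn⟩ : ∃ n : Fin 3 → K, ![u 1 * w 2 - u 2 * w 1, u 2 * w 0 - u 0 * w 2,
    u 0 * w 1 - u 1 * w 0] = n := ⟨_, rfl⟩
  have hn0 : u 1 * w 2 - u 2 * w 1 = n 0 := by rw [← hn]; rfl
  have hn1 : u 2 * w 0 - u 0 * w 2 = n 1 := by rw [← hn]; rfl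
  have hn2 : u 0 * w 1 - u 1 * w 0 = n 2 := by rw [← hn]; rfl
  obtain ⟨k, hk⟩ : ∃ k, n k ≠ 0 := by
    by_contra! h
    rw [h 0] at hn0
    rw [h 1] at hn1
    rw [h 2] at hn2
    refine hij ?_
    fin_cases i <;> fin_cases j <;> simp only [Fin.zero_eta, Fin.mk_one, Fin.reduceFinMk] <;>
      first
      | linear_combination (0 : K) * hn0
      | linear_combination hn0
      | linear_combination -hn0
      | linear_combination hn1
      | linear_combination -hn1
      | linear_combination hn2
      | linear_combination -hn2
  obtain ⟨ℓ, hℓ⟩ : ∃ ℓ : MvPolynomial (Fin 3) K, ∑ i, C (n i) * X i = ℓ := ⟨_, rfl⟩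
  have hcoeff : coeff (Finsupp.single k 1) ℓ = n k := by
    rw [← hℓ, coeff_sum]
    simp [coeff_C_mul, coeff_X, Finsupp.single_left_inj]
  have hdeg : ℓ.totalDegree = 1 := by
    refine le_antisymm ?_ (le_totalDegree_of_coeff_single_ne_zero (i := k) (hcoeff ▸ hk))
    rw [← hℓ]
    refine totalDegree_finsetSum_le fun i _ => (totalDegree_mul _ _).trans ?_
    rw [totalDegree_C, totalDegree_X]
  refine ⟨ℓ, ?_, ?_, hdeg⟩
  · obtain ⟨θ, hθ⟩ : ∃ θ : Fin 3 → MvPolynomial (Fin 3) K,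
      (fun i => X i - C (if i = k then (n k)⁻¹ else 0) * ℓ) = θ := ⟨_, rfl⟩
    have h1 := dvd_sub_aeval (ℓ := ℓ) (θ := θ) (fun i => by
      rw [← hθ, sub_sub_cancel]
      exact dvd_mul_left _ _) F
    suffices h : aeval θ F = 0 by rwa [h, sub_zero] at h1
    refine MvPolynomial.funext fun x => ?_
    rw [eval_aeval_eq, map_zero]
    obtain ⟨v, hv⟩ : ∃ v : Fin 3 → K, (fun i => eval x (θ i)) = v := ⟨_, rfl⟩
    rw [hv]
    have hvx : ∀ i, v i = x i - (if i = k then (n k)⁻¹ else 0) * eval x ℓ := by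
      intro i
      rw [← hv, ← hθ]
      simp only [map_sub, map_mul, eval_X, eval_C]
    have hxl : eval x ℓ = ∑ i, n i * x i := by
      rw [← hℓ]
      simp
    have hsum : ∑ i, n i * v i = 0 := by
      simp only [hvx, mul_sub, Finset.sum_sub_distrib, ← hxl]
      simp [hk]
    rw [Fin.sum_univ_three] at hsum
    have hdet : Matrix.det (Matrix.of ![u, w, v]) = 0 := by
      rw [Matrix.det_fin_three]
      simp only [Matrix.of_apply, Matrix.cons_val_zero, Matrix.cons_val_one, Matrix.cons_val]
      linear_combination hsum + v 0 * hn0 + v 1 * hn1 + v 2 * hn2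
    have hδ : u i * w j - u j * w i ≠ 0 := sub_ne_zero.mpr hij
    have h2 := hvan ((v i * w j - v j * w i) / (u i * w j - u j * w i))
      ((u i * v j - u j * v i) / (u i * w j - u j * w i))
    rw [← h2]
    congr 2
    funext l
    have h3 := plane_coordinates hdet i j l
    rw [div_mul_eq_mul_div, div_mul_eq_mul_div, ← add_div, eq_div_iff hδ, ← h3, mul_comm]
  · refine irreducible_of_totalDegree_eq_one hdeg fun x hx => isUnit_iff_ne_zero.mpr ?_
    rintro rfl
    have h1 := hx (Finsupp.single k 1)
    rw [hcoeff, zero_dvd_iff] at h1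
    exact hk h1

/-- The substitution `x ↦ (x₀, x₁ + a x₀, x₂ + b x₀)`. -/
noncomputable def shear {K : Type*} [CommRing K] (a b : K) :
    Fin 3 → MvPolynomial (Fin 3) K :=
  ![X 0, X 1 + C a * X 0, X 2 + C b * X 0]

theorem aeval_shear_comp {K : Type*} [CommRing K] (a b : K) :
    (aeval (shear a b)).comp (aeval (shear (-a) (-b))) = AlgHom.id K (MvPolynomial (Fin 3) K) := by
  refine algHom_ext fun i => ?_
  rw [AlgHom.comp_apply, aeval_X, AlgHom.id_apply]
  fin_cases i
  · simp [shear]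
  · simp only [shear, Fin.mk_one, Matrix.cons_val, map_add, map_mul, aeval_X, algHom_C,
      algebraMap_eq, map_neg]
    ring
  · simp only [shear, Fin.reduceFinMk, Matrix.cons_val, map_add, map_mul, aeval_X, algHom_C,
      algebraMap_eq, map_neg]
    ring

theorem eval_aeval_shear {K : Type*} [CommRing K] (a b : K) (f : MvPolynomial (Fin 3) K)
    (x : Fin 3 → K) :
    eval x (aeval (shear a b) f) = eval ![x 0, x 1 + a * x 0, x 2 + b * x 0] f := by
  rw [eval_aeval_eq]
  congr 2
  funext i
  fin_cases i <;> simp [shear]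

theorem totalDegree_aeval_shear_le {K : Type*} [CommRing K] [Nontrivial K] (a b : K)
    (f : MvPolynomial (Fin 3) K) :
    (aeval (shear a b) f).totalDegree ≤ f.totalDegree := by
  refine totalDegree_aeval_le (fun i => ?_) f
  have h : ∀ (c : K) (j : Fin 3), (X j + C c * X 0 : MvPolynomial (Fin 3) K).totalDegree ≤ 1 := by
    intro c j
    refine (totalDegree_add _ _).trans (max_le (totalDegree_X j).le ((totalDegree_mul _ _).trans ?_))
    rw [totalDegree_C, totalDegree_X]
  fin_cases i
  · exact (totalDegree_X 0).le
  · exact h a 1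
  · exact h b 2

theorem prime_aeval_shear {K : Type*} [Field K] (a b : K) {f : MvPolynomial (Fin 3) K}
    (hf : Prime f) : Prime (aeval (shear a b) f) := by
  have h := aeval_shear_comp (-a) (-b)
  rw [neg_neg, neg_neg] at h
  exact (MulEquiv.prime_iff (AlgEquiv.ofAlgHom _ _ (aeval_shear_comp a b) h)).mpr hf

theorem eval_homogeneousComponent_aeval_shear {K : Type*} [Field K] [Infinite K] (a b : K) {d : ℕ}
    {f : MvPolynomial (Fin 3) K} (hf : f.totalDegree ≤ d) (x : Fin 3 → K) :
    eval x (homogeneousComponent d (aeval (shear a b) f)) =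
      eval ![x 0, x 1 + a * x 0, x 2 + b * x 0] (homogeneousComponent d f) := by
  rw [← coeff_lineRestriction x 0 ((totalDegree_aeval_shear_le a b f).trans hf),
    ← coeff_lineRestriction _ 0 hf]
  congr 1
  refine Polynomial.funext fun s => ?_
  rw [eval_lineRestriction, eval_lineRestriction, eval_aeval_shear]
  congr 2
  funext i
  fin_cases i
  · simp
  · simp
    ring
  · simp
    ring

theorem NonvanishingOnPlanes.aeval_shear {K : Type*} [Field K] [Infinite K] (a b : K) {d : ℕ}
    {f : MvPolynomial (Fin 3) K} (hf : f.totalDegree ≤ d)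
    (h : NonvanishingOnPlanes (homogeneousComponent d f)) :
    NonvanishingOnPlanes (homogeneousComponent d (aeval (shear a b) f)) := by
  intro u w huw
  obtain ⟨α, β, hαβ⟩ := h ![u 0, u 1 + a * u 0, u 2 + b * u 0] ![w 0, w 1 + a * w 0, w 2 + b * w 0]
    (by
      by_contra! hcon
      obtain ⟨i, j, hij⟩ := huw
      refine hij ?_
      have h01 := hcon 0 1
      have h02 := hcon 0 2
      have h12 := hcon 1 2
      simp only [Matrix.cons_val_zero, Matrix.cons_val_one, Matrix.cons_val] at h01 h02 h12
      have e01 : u 0 * w 1 = u 1 * w 0 := by linear_combination h01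
      have e02 : u 0 * w 2 = u 2 * w 0 := by linear_combination h02
      have e12 : u 1 * w 2 = u 2 * w 1 := by linear_combination h12 + b * e01 - a * e02
      fin_cases i <;> fin_cases j
      exacts [rfl, e01, e02, e01.symm, rfl, e12, e02.symm, e12.symm, rfl])
  refine ⟨α, β, ?_⟩
  rw [eval_homogeneousComponent_aeval_shear a b hf]
  convert hαβ using 3
  funext i
  fin_cases i
  · simp
  · simp
    ring
  · simp
    ring

theorem exists_eval_one_ne_zero {K : Type*} [Field K] [CharZero K] {d : ℕ}
    {F : MvPolynomial (Fin 3) K} (hF : F.IsHomogeneous d) (hF0 : F ≠ 0) :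
    ∃ a ≤ d, ∃ b ≤ d, eval ![1, (a : K), (b : K)] F ≠ 0 := by
  classical
  obtain ⟨θ, hθ⟩ : ∃ θ : Fin 3 → MvPolynomial (Fin 2) K, ![1, X 0, X 1] = θ := ⟨_, rfl⟩
  have heval : ∀ x : Fin 2 → K, eval x (aeval θ F) = eval ![1, x 0, x 1] F := by
    intro x
    rw [eval_aeval_eq, ← hθ]
    congr 2
    funext i
    fin_cases i <;> simp
  have hdeg : (aeval θ F).totalDegree ≤ d := by
    refine (totalDegree_aeval_le (fun i => ?_) F).trans hF.totalDegree_le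
    rw [← hθ]
    fin_cases i <;> simp
  have hne : aeval θ F ≠ 0 := by
    intro h
    have hX : F * X 0 = 0 := by
      refine MvPolynomial.funext fun x => ?_
      rw [map_mul, eval_X, map_zero]
      by_cases hx : x 0 = 0
      · rw [hx, mul_zero]
      · have h1 := heval ![x 1 / x 0, x 2 / x 0]
        rw [h, map_zero] at h1
        have h2 : x = fun i => x 0 * (![1, x 1 / x 0, x 2 / x 0] : Fin 3 → K) i := by
          funext i
          fin_cases i
          · simp
          · simp [mul_div_cancel₀ _ hx]
          · simp [mul_div_cancel₀ _ hx]
        rw [h2, eval_mul_of_isHomogeneous hF]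
        simp only [Matrix.cons_val_zero, Matrix.cons_val_one] at h1
        rw [← h1, mul_zero, zero_mul]
    exact mul_ne_zero hF0 (X_ne_zero 0) hX
  by_contra! hcon
  refine hne (eq_zero_of_eval_zero_at_prod_finset _
    (fun _ => (Finset.range (d + 1)).image (Nat.cast : ℕ → K)) (fun i => ?_) fun x hx => ?_)
  · rw [Finset.card_image_of_injective _ Nat.cast_injective, Finset.card_range]
    exact Nat.lt_succ_iff.mpr ((degreeOf_le_totalDegree _ i).trans hdeg)
  · obtain ⟨a, ha, hxa⟩ := Finset.mem_image.mp (hx 0)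
    obtain ⟨b, hb, hxb⟩ := Finset.mem_image.mp (hx 1)
    rw [heval, ← hxa, ← hxb]
    exact hcon a (Nat.lt_succ_iff.mp (Finset.mem_range.mp ha)) b
      (Nat.lt_succ_iff.mp (Finset.mem_range.mp hb))

theorem NonvanishingOnPlanes.ne_zero {K : Type*} [Field K] {F : MvPolynomial (Fin 3) K}
    (hF : NonvanishingOnPlanes F) : F ≠ 0 := by
  rintro rfl
  obtain ⟨a, b, hab⟩ := hF (Pi.single 0 1) (Pi.single 1 1) ⟨0, 1, by simp⟩
  simp at hab

theorem exists_card_box_zeros_le (K : Type*) [Field K] [IsAlgClosed K] [CharZero K]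
    {d D k τ t s e W : ℕ} (hpar : SurfaceParams D k τ t s e W)
    (hbound : τ * ((k + 1) * (k + 1)) + 1 ≤ t * ((k + 1) * (2 * k + 1))) (hD : 0 < D)
    (hDd : D ≤ d) :
    ∃ C Y₀ : ℕ, ∀ Y ≥ Y₀, ∀ f : MvPolynomial (Fin 3) K, Prime f →
      f.totalDegree ≤ d → NonvanishingOnPlanes (homogeneousComponent d f) →
      ∀ E : Finset (Fin 3 → ℤ), (∀ ξ ∈ E, eval (fun i => (ξ i : K)) f = 0 ∧
        ∀ i, ((d + 1 : ℕ) : ℤ) * |ξ i| ≤ (Y ^ τ : ℕ)) →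
      E.card ≤ C * (Y ^ (2 * t + 2) + Y ^ (τ + 1)) := by
  classical
  obtain ⟨C, Y₀, h⟩ := exists_card_zeros_le K hpar hbound hD hDd
  refine ⟨C, Y₀, fun Y hY f hfp hfd hpl E hE => ?_⟩
  obtain ⟨a, ha, b, hb, hab⟩ := exists_eval_one_ne_zero
    (homogeneousComponent_isHomogeneous d f) hpl.ne_zero
  let T : (Fin 3 → ℤ) → Fin 3 → ℤ := fun ξ => ![ξ 0, ξ 1 - a * ξ 0, ξ 2 - b * ξ 0]
  have hT : Function.Injective T := by
    intro ξ ξ' hξ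
    have h0 : ξ 0 = ξ' 0 := congrFun hξ 0
    have h1 : ξ 1 - a * ξ 0 = ξ' 1 - a * ξ' 0 := congrFun hξ 1
    have h2 : ξ 2 - b * ξ 0 = ξ' 2 - b * ξ' 0 := congrFun hξ 2
    rw [h0] at h1 h2
    funext i
    fin_cases i
    exacts [h0, sub_left_injective h1, sub_left_injective h2]
  rw [← Finset.card_image_of_injective E hT]
  refine h Y hY (aeval (shear (a : K) (b : K)) f) (prime_aeval_shear _ _ hfp)
    ((totalDegree_aeval_shear_le _ _ f).trans hfd) ?_ (hpl.aeval_shear _ _ hfd) _ ?_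
  · rw [← eval_single_homogeneousComponent, eval_homogeneousComponent_aeval_shear _ _ hfd]
    simpa using hab
  · intro η hη
    obtain ⟨ξ, hξ, rfl⟩ := Finset.mem_image.mp hη
    obtain ⟨hξ0, hξN⟩ := hE ξ hξ
    constructor
    · rw [eval_aeval_shear, ← hξ0]
      congr 2
      funext i
      fin_cases i <;> simp [T]
    · have hself : ∀ i, |ξ i| ≤ ((Y ^ τ : ℕ) : ℤ) := fun i =>
        le_trans (le_mul_of_one_le_left (abs_nonneg _) (by push_cast; omega)) (hξN i)
      have hsub : ∀ (c : ℕ), c ≤ d → ∀ i, |ξ i - c * ξ 0| ≤ ((Y ^ τ : ℕ) : ℤ) := by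
        intro c hc i
        have h1 := abs_sub (ξ i) (c * ξ 0)
        rw [abs_mul, Nat.abs_cast] at h1
        have h2 : ((d + 1 : ℕ) : ℤ) * max |ξ i| |ξ 0| ≤ (Y ^ τ : ℕ) := by
          rcases max_choice |ξ i| |ξ 0| with h | h
          · rw [h]; exact hξN i
          · rw [h]; exact hξN 0
        have h3 : (c : ℤ) * |ξ 0| ≤ d * max |ξ i| |ξ 0| :=
          mul_le_mul (by exact_mod_cast hc) (le_max_right _ _) (abs_nonneg _) (by positivity)
        have h4 := le_max_left |ξ i| |ξ 0|
        push_cast at h2 ⊢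
        linarith
      intro i
      fin_cases i
      exacts [hself 0, hsub a ha 1, hsub b hb 2]

theorem SurfaceParams.four {m : ℕ} (hm : 1 ≤ m) :
    SurfaceParams 4 (3 * m) (2 * m) (m + 1) (2 * (3 * m + 1) * (3 * m + 2))
      ((3 * m + 1) * m * (8 * (3 * m) + 22)) ((3 * m + 1) * (3 * m + 2) * (4 * m + 3)) where
  card := by ring
  weight := by norm_num; ring
  exponent := by nlinarith
  bound := by
    have : 1 ≤ m * (3 * m + 1) := Nat.mul_pos hm (by lia)
    nlinarith [mul_le_mul this (Nat.zero_le m) (Nat.zero_le _) (Nat.zero_le _)]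

theorem exists_surfaceParams_three {m : ℕ} (hm : 1 ≤ m) :
    ∃ s e W, SurfaceParams 3 (3 * m) (5 * m) (3 * m + 1) s e W := by
  obtain ⟨c, hc⟩ := Nat.even_mul_succ_self (3 * m + 1)
  refine ⟨3 * c, (3 * m + 1) * m * (5 * (3 * m) + 16), c * (6 * m + 3), ?_, ?_, ?_, ?_⟩
  · linear_combination 3 * hc.symm
  · norm_num
    linear_combination (36 * m + 18) * hc.symm
  · apply le_of_eq
    linear_combination 54 * m * hc
  · have h : 1 ≤ m * (3 * m + 1) := Nat.mul_pos hm (by lia)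
    have h2 : 2 * (5 * m * (c * (6 * m + 3))) =
        m * (3 * m + 1) * (90 * m ^ 2 + 105 * m + 30) := by
      linear_combination (5 * m * (6 * m + 3)) * hc.symm
    nlinarith

theorem exists_ncard_box_zeros_le (K : Type*) [Field K] [IsAlgClosed K] [CharZero K]
    {d D k τ t s e W : ℕ} (hpar : SurfaceParams D k τ t s e W)
    (hbound : τ * ((k + 1) * (k + 1)) + 1 ≤ t * ((k + 1) * (2 * k + 1))) (hD : 0 < D)
    (hDd : D ≤ d) (hτ : 0 < τ) {θ : ℝ} (ht : ((2 * t + 2 : ℕ) : ℝ) ≤ θ * τ)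
    (hθ : ((τ + 1 : ℕ) : ℝ) ≤ θ * τ) :
    ∃ C : ℝ, 0 ≤ C ∧ ∀ f : MvPolynomial (Fin 3) K, Prime f → f.totalDegree ≤ d →
      NonvanishingOnPlanes (homogeneousComponent d f) → ∀ B : ℝ, 1 ≤ B →
      (Set.ncard {x : Fin 3 → ℤ | eval (fun i => (x i : K)) f = 0 ∧ ∀ i, |(x i : ℝ)| ≤ B} : ℝ)
        ≤ C * B ^ θ := by
  obtain ⟨C, Y₀, hC⟩ := exists_card_box_zeros_le K hpar hbound hD hDd
  set A : ℝ := Y₀ + 1 + ((d + 1 : ℕ) : ℝ) ^ (τ⁻¹ : ℝ) with hA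
  refine ⟨C * (A ^ (2 * t + 2) + A ^ (τ + 1)), by positivity, fun f hf hdeg hF B hB => ?_⟩
  have hB0 : 0 ≤ B := by linarith
  set b : ℝ := B ^ (τ⁻¹ : ℝ) with hb
  have hb1 : 1 ≤ b := Real.one_le_rpow hB (by positivity)
  have hr : (((d + 1 : ℕ) : ℝ) * B) ^ (τ⁻¹ : ℝ) = ((d + 1 : ℕ) : ℝ) ^ (τ⁻¹ : ℝ) * b :=
    Real.mul_rpow (by positivity) hB0
  set r : ℝ := (((d + 1 : ℕ) : ℝ) * B) ^ (τ⁻¹ : ℝ) with hr'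
  have hr0 : 0 ≤ r := by positivity
  set Y : ℕ := Y₀ + ⌈r⌉₊ with hY
  have hrY : r ≤ Y := by
    rw [hY]; push_cast
    have := Nat.le_ceil r
    have : (0 : ℝ) ≤ Y₀ := by positivity
    linarith
  have hYA : (Y : ℝ) ≤ A * b := by
    have h1 := (Nat.ceil_lt_add_one hr0).le
    have h2 : (Y₀ + 1 : ℝ) ≤ (Y₀ + 1) * b := le_mul_of_one_le_right (by positivity) hb1
    rw [hY, hA]; push_cast
    push_cast at hr
    linarith
  have hbox : ((d + 1 : ℕ) : ℝ) * B ≤ (Y : ℝ) ^ τ := by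
    calc ((d + 1 : ℕ) : ℝ) * B = r ^ τ := (Real.rpow_inv_natCast_pow (by positivity) hτ.ne').symm
      _ ≤ (Y : ℝ) ^ τ := by gcongr
  have hpow {n : ℕ} (hn : (n : ℝ) ≤ θ * τ) : (Y : ℝ) ^ n ≤ A ^ n * B ^ θ := by
    calc (Y : ℝ) ^ n ≤ (A * b) ^ n := by gcongr
      _ = A ^ n * b ^ n := mul_pow ..
      _ ≤ A ^ n * B ^ θ := by
        gcongr
        rw [hb, ← Real.rpow_mul_natCast hB0]
        refine Real.rpow_le_rpow_of_exponent_le hB ?_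
        rw [inv_mul_le_iff₀ (by exact_mod_cast hτ), mul_comm]
        exact hn
  set S := {x : Fin 3 → ℤ | eval (fun i => (x i : K)) f = 0 ∧ ∀ i, |(x i : ℝ)| ≤ B} with hS
  have hfin : S.Finite := by
    refine (Set.finite_Icc (fun _ : Fin 3 => -⌊B⌋) (fun _ => ⌊B⌋)).subset fun x hx => ?_
    have h (i) : |x i| ≤ ⌊B⌋ := Int.le_floor.2 (by exact_mod_cast hx.2 i)
    exact ⟨fun i => (abs_le.1 (h i)).1, fun i => (abs_le.1 (h i)).2⟩
  have hcard := hC Y (by lia) f hf hdeg hF hfin.toFinset fun ξ hξ => by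
    rw [Set.Finite.mem_toFinset] at hξ
    refine ⟨hξ.1, fun i => ?_⟩
    have h : ((d + 1 : ℕ) : ℝ) * |(ξ i : ℝ)| ≤ (Y : ℝ) ^ τ :=
      (mul_le_mul_of_nonneg_left (hξ.2 i) (by positivity)).trans hbox
    exact_mod_cast h
  rw [Set.ncard_eq_toFinset_card S hfin]
  calc (hfin.toFinset.card : ℝ) ≤ C * ((Y : ℝ) ^ (2 * t + 2) + (Y : ℝ) ^ (τ + 1)) := by
        exact_mod_cast hcard
    _ ≤ C * (A ^ (2 * t + 2) * B ^ θ + A ^ (τ + 1) * B ^ θ) := by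
        gcongr
        · exact hpow ht
        · exact hpow hθ
    _ = C * (A ^ (2 * t + 2) + A ^ (τ + 1)) * B ^ θ := by ring

theorem exists_ncard_box_zeros_le_of_four_le (K : Type*) [Field K] [IsAlgClosed K] [CharZero K]
    {d : ℕ} (hd : 4 ≤ d) {ε : ℝ} (hε : 0 < ε) :
    ∃ C : ℝ, 0 ≤ C ∧ ∀ f : MvPolynomial (Fin 3) K, Prime f → f.totalDegree ≤ d →
      NonvanishingOnPlanes (homogeneousComponent d f) → ∀ B : ℝ, 1 ≤ B →
      (Set.ncard {x : Fin 3 → ℤ | eval (fun i => (x i : K)) f = 0 ∧ ∀ i, |(x i : ℝ)| ≤ B} : ℝ)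
        ≤ C * B ^ (1 + ε) := by
  obtain ⟨m, hm⟩ := exists_nat_gt (2 / ε)
  have hm0 : 1 ≤ m := by
    have : (0 : ℝ) < m := lt_trans (by positivity) hm
    exact_mod_cast this
  rw [div_lt_iff₀ hε] at hm
  refine exists_ncard_box_zeros_le K (SurfaceParams.four hm0) ?_ (by norm_num) hd (by lia) ?_ ?_
  · nlinarith
  · push_cast; linarith
  · push_cast; linarith

theorem exists_ncard_box_zeros_le_of_three_le (K : Type*) [Field K] [IsAlgClosed K] [CharZero K]
    {d : ℕ} (hd : 3 ≤ d) {ε : ℝ} (hε : 0 < ε) :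
    ∃ C : ℝ, 0 ≤ C ∧ ∀ f : MvPolynomial (Fin 3) K, Prime f → f.totalDegree ≤ d →
      NonvanishingOnPlanes (homogeneousComponent d f) → ∀ B : ℝ, 1 ≤ B →
      (Set.ncard {x : Fin 3 → ℤ | eval (fun i => (x i : K)) f = 0 ∧ ∀ i, |(x i : ℝ)| ≤ B} : ℝ)
        ≤ C * B ^ (6 / 5 + ε) := by
  obtain ⟨m, hm⟩ := exists_nat_gt (1 / ε)
  have hm0 : 1 ≤ m := by
    have : (0 : ℝ) < m := lt_trans (by positivity) hm
    exact_mod_cast this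
  have hm1 : (1 : ℝ) ≤ m := by exact_mod_cast hm0
  rw [div_lt_iff₀ hε] at hm
  obtain ⟨s, e, W, hpar⟩ := exists_surfaceParams_three hm0
  refine exists_ncard_box_zeros_le K hpar ?_ (by norm_num) hd (by lia) ?_ ?_
  · nlinarith
  · push_cast; linarith
  · push_cast; linarith

theorem six_fifths_le : (6 / 5 : ℝ) ≤ 5 / (3 * √3) + 1 / 4 := by
  have h : √3 ≤ 1.754 := Real.sqrt_le_iff.2 (by norm_num)
  have h0 : 0 < √3 := by positivity
  have : (19 / 20 : ℝ) ≤ 5 / (3 * √3) := by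
    rw [le_div_iff₀ (by positivity)]
    linarith
  linarith

theorem one_le_of_le_five {d : ℕ} (hd0 : 0 < d) (hd : d ≤ 5) :
    (1 : ℝ) ≤ 3 / (2 * √d) + 1 / 3 := by
  have hd' : (d : ℝ) ≤ 5 := by exact_mod_cast hd
  have h : √(d : ℝ) ≤ 9 / 4 := Real.sqrt_le_iff.2 ⟨by norm_num, by linarith⟩
  have : (2 / 3 : ℝ) ≤ 3 / (2 * √d) := by
    rw [le_div_iff₀ (by positivity)]
    linarith
  linarith

theorem nonvanishingOnPlanes_of_forall_totalDegree_ne_one {K : Type*} [Field K] [Infinite K]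
    {F : MvPolynomial (Fin 3) K} (hF : ∀ g, g ∣ F → Irreducible g → g.totalDegree ≠ 1) :
    NonvanishingOnPlanes F := by
  by_contra h
  obtain ⟨ℓ, hdvd, hirr, hdeg⟩ := exists_linear_factor_of_vanishing_on_plane h
  exact hF ℓ hdvd hirr hdeg

/-- Let `f ∈ ℚ̄[x_1,x_2,x_3]` be irreducible of degree `d ≥ 3` whose
leading form `F` has no irreducible factors of degree `1` or `2`. Then the number
`N(f,B)` of `x ∈ ℤ³` with `f(x) = 0` and `|x| ≤ B` satisfies
`N(f,B) ≪_{d,ε} B^{5/(3√3)+1/4+ε}` if `d = 3`,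
`N(f,B) ≪_{d,ε} B^{3/(2√d)+1/3+ε}` if `d = 4` or `5`, and
`N(f,B) ≪_{d,ε} B^{1+ε}` if `d ≥ 6`. -/
theorem statement18 (d : ℕ) (hd : 3 ≤ d) :
    ∀ ε : ℝ, 0 < ε → ∃ C : ℝ,
      ∀ f : MvPolynomial (Fin 3) (AlgebraicClosure ℚ),
      Irreducible f → f.totalDegree = d →
      (∀ g : MvPolynomial (Fin 3) (AlgebraicClosure ℚ),
        g ∣ MvPolynomial.homogeneousComponent d f → Irreducible g →
        g.totalDegree ≠ 1 ∧ g.totalDegree ≠ 2) →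
      ∀ B : ℝ, 1 ≤ B →
      (d = 3 →
        ((Set.ncard {x : Fin 3 → ℤ |
            eval (fun i => ((x i : ℤ) : AlgebraicClosure ℚ)) f = 0 ∧
              ∀ i, |(x i : ℝ)| ≤ B} : ℕ) : ℝ)
          ≤ C * B ^ (5 / (3 * Real.sqrt 3) + 1 / 4 + ε)) ∧
      (d = 4 ∨ d = 5 →
        ((Set.ncard {x : Fin 3 → ℤ |
            eval (fun i => ((x i : ℤ) : AlgebraicClosure ℚ)) f = 0 ∧
              ∀ i, |(x i : ℝ)| ≤ B} : ℕ) : ℝ)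
          ≤ C * B ^ (3 / (2 * Real.sqrt d) + 1 / 3 + ε)) ∧
      (6 ≤ d →
        ((Set.ncard {x : Fin 3 → ℤ |
            eval (fun i => ((x i : ℤ) : AlgebraicClosure ℚ)) f = 0 ∧
              ∀ i, |(x i : ℝ)| ≤ B} : ℕ) : ℝ)
          ≤ C * B ^ (1 + ε)) := by
  intro ε hε
  rcases hd.eq_or_lt with rfl | hd4
  · obtain ⟨C, hC0, hC⟩ := exists_ncard_box_zeros_le_of_three_le (AlgebraicClosure ℚ) le_rfl hε
    refine ⟨C, fun f hf hdeg hF B hB => ⟨fun _ => ?_, fun h => by lia, fun h => by lia⟩⟩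
    refine (hC f hf.prime hdeg.le (nonvanishingOnPlanes_of_forall_totalDegree_ne_one
      fun g hg hirr => (hF g hg hirr).1) B hB).trans ?_
    gcongr
    exact six_fifths_le
  · obtain ⟨C, hC0, hC⟩ := exists_ncard_box_zeros_le_of_four_le (AlgebraicClosure ℚ) hd4 hε
    refine ⟨C, fun f hf hdeg hF B hB => ⟨fun h => by lia, fun h => ?_, fun _ => ?_⟩⟩
    all_goals
      have key := hC f hf.prime hdeg.le (nonvanishingOnPlanes_of_forall_totalDegree_ne_one
        fun g hg hirr => (hF g hg hirr).1) B hB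
    · refine key.trans ?_
      gcongr
      exact one_le_of_le_five (by lia) (by lia)
    · exact key
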